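/- W^{2,p} regularity on convex polyhedra, a priori form (Lemma 2.1): Let Ω ⊂ ℝ³ be a convex polyhedron. There exists p₀ > 2 (depending on Ω) such that for every p with 1 < p < p₀ there is a constant C (depending on Ω and p) with the following property: every function v that is twice continuously differentiable on closure(Ω) and vanishes on ∂Ω satisfies ‖v‖_{W^{2,p}(Ω)} ≤ C ‖Δv‖_{L^p(Ω)}. -/

import Mathlib

open MeasureTheory Metric Set
open scoped RealInnerProductSpace ENNReal NNReal

noncomputable section

/-- Three-dimensional Euclidean space. -/
abbrev E3 : Type := EuclideanSpace ℝ (Fin 3)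

/-- A convex polyhedron: a bounded convex open set which is the interior of the
convex hull of a finite set of points. -/
def IsConvexPolyhedron (Ω : Set E3) : Prop :=
  IsOpen Ω ∧ Bornology.IsBounded Ω ∧ Convex ℝ Ω ∧
    ∃ S : Finset E3, Ω = interior (convexHull ℝ (S : Set E3))

/-- The closed tetrahedron with vertices `v 0, v 1, v 2, v 3`. -/
def tet (v : Fin 4 → E3) : Set E3 := convexHull ℝ (Set.range v)

/-- A quasi-uniform conforming tetrahedral partition of `Ω` with mesh size `h`
and quasi-uniformity constant `c`, recorded by the vertex tuples of its tetrahedra. -/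
def IsTetPartition (Ω : Set E3) (T : Finset (Fin 4 → E3)) (h c : ℝ) : Prop :=
  (∀ v ∈ T, AffineIndependent ℝ v) ∧
  (⋃ v ∈ T, tet v) = closure Ω ∧
  (∀ v ∈ T, ∀ w ∈ T, tet v ≠ tet w → interior (tet v) ∩ interior (tet w) = ∅) ∧
  (∀ v ∈ T, ∀ w ∈ T, tet v ≠ tet w →
    tet v ∩ tet w = ∅ ∨ tet v ∩ tet w = convexHull ℝ (Set.range v ∩ Set.range w)) ∧
  (∀ v ∈ T, Metric.diam (tet v) ≤ h) ∧
  (∀ v ∈ T, ∃ x : E3, Metric.closedBall x (c * h) ⊆ tet v)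

/-- The finite element space `S_h` of continuous piecewise polynomials of degree `≤ r`. -/
def MemSh (Ω : Set E3) (T : Finset (Fin 4 → E3)) (r : ℕ) (u : E3 → ℝ) : Prop :=
  ContinuousOn u (closure Ω) ∧
  ∀ v ∈ T, ∃ p : MvPolynomial (Fin 3) ℝ,
    p.totalDegree ≤ r ∧ ∀ x ∈ tet v, u x = MvPolynomial.eval (fun i => x i) p

/-- The subspace `S̊_h` of finite element functions vanishing on the boundary. -/
def MemSh0 (Ω : Set E3) (T : Finset (Fin 4 → E3)) (r : ℕ) (u : E3 → ℝ) : Prop :=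
  MemSh Ω T r u ∧ ∀ x ∈ frontier Ω, u x = 0

/-- The Laplacian, as the trace of the Hessian. -/
def lap (v : E3 → ℝ) (x : E3) : ℝ :=
  ∑ i : Fin 3,
    fderiv ℝ (fun y => fderiv ℝ v y (EuclideanSpace.single i 1)) x (EuclideanSpace.single i 1)

/-- The `L^p(A)` norm. -/
def LpN (A : Set E3) (p : ℝ) (w : E3 → ℝ) : ℝ := (∫ x in A, |w x| ^ p) ^ (1 / p)

/-- The `W^{1,p}(A)` norm. -/
def W1pN (A : Set E3) (p : ℝ) (w : E3 → ℝ) : ℝ :=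
  (∫ x in A, (|w x| ^ p + ‖gradient w x‖ ^ p)) ^ (1 / p)

/-- The `W^{2,p}(A)` norm. -/
def W2pN (A : Set E3) (p : ℝ) (w : E3 → ℝ) : ℝ :=
  (∫ x in A, (|w x| ^ p + ‖gradient w x‖ ^ p + ‖iteratedFDeriv ℝ 2 w x‖ ^ p)) ^ (1 / p)

section
/-! ### Geometry: half-space representation -/

theorem cone_hrep {V : Type*} [AddCommGroup V] [Module ℝ V] [FiniteDimensional ℝ V]
    (S : Finset V) : ∃ T : Finset (V →ₗ[ℝ] ℝ), ∀ z : V,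
      (∃ w : V → ℝ, (∀ s ∈ S, 0 ≤ w s) ∧ z = ∑ s ∈ S, w s • s) ↔ ∀ f ∈ T, f z ≤ 0 := by
  classical
  induction S using Finset.induction_on with
  | empty =>
    let b := Module.finBasis ℝ V
    refine ⟨Finset.univ.image (fun i => b.coord i) ∪ Finset.univ.image (fun i => -b.coord i), ?_⟩
    intro z
    constructor
    · rintro ⟨w, -, rfl⟩ f -
      simp
    · intro h
      refine ⟨0, by simp, ?_⟩
      simp only [Finset.sum_empty]
      apply b.ext_elem
      intro i
      have h1 := h (b.coord i) (by simp)
      have h2 := h (-b.coord i) (by simp)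
      simp at h1 h2 ⊢
      linarith
  | insert s S hs ih =>
    obtain ⟨T, hT⟩ := ih
    refine ⟨T.filter (fun f => f s ≤ 0) ∪
      (T ×ˢ T).image (fun p => if p.1 s < 0 ∧ 0 < p.2 s then p.2 s • p.1 - p.1 s • p.2 else 0), ?_⟩
    intro z
    have key : (∃ w : V → ℝ, (∀ x ∈ insert s S, 0 ≤ w x) ∧ z = ∑ x ∈ insert s S, w x • x) ↔
        ∃ t : ℝ, 0 ≤ t ∧ ∀ f ∈ T, f (z - t • s) ≤ 0 := by
      constructor
      · rintro ⟨w, hw, rfl⟩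
        refine ⟨w s, hw s (by simp), (hT _).1 ⟨w, fun x hx => hw x (by simp [hx]), ?_⟩⟩
        rw [Finset.sum_insert hs]; abel
      · rintro ⟨t, ht, h⟩
        obtain ⟨w, hw, hz⟩ := (hT _).2 h
        refine ⟨fun x => if x = s then t else w x, ?_, ?_⟩
        · intro x hx
          by_cases hxs : x = s
          · simp [hxs, ht]
          · simpa [hxs] using hw x (by simpa [hxs] using hx)
        · rw [Finset.sum_insert hs]
          simp only [if_true]
          rw [Finset.sum_congr rfl (g := fun x => w x • x), ← hz]
          · abel
          · intro x hx
            have : x ≠ s := fun h => hs (h ▸ hx)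
            simp [this]
    rw [key]
    constructor
    · rintro ⟨t, ht, h⟩ f hf
      simp only [Finset.mem_union, Finset.mem_filter, Finset.mem_image, Finset.mem_product,
        Prod.exists] at hf
      rcases hf with ⟨hf, hfs⟩ | ⟨f1, g, ⟨hf1, hg⟩, rfl⟩
      · have := h f hf
        simp only [map_sub, map_smul, smul_eq_mul] at this
        nlinarith
      · split_ifs with hc
        · have h1 := h f1 hf1
          have h2 := h g hg
          simp only [map_sub, map_smul, smul_eq_mul, LinearMap.sub_apply, LinearMap.smul_apply] at *
          nlinarith
        · simp
    · intro h
      let L : Finset ℝ := insert 0 ((T.filter (fun g => 0 < g s)).image (fun g => g z / g s))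
      have hL : L.Nonempty := ⟨0, by simp [L]⟩
      refine ⟨L.max' hL, L.le_max' 0 (by simp [L]), ?_⟩
      intro f hf
      simp only [map_sub, map_smul, smul_eq_mul]
      rcases lt_trichotomy (f s) 0 with h0 | h0 | h0
      · have hm := L.max'_mem hL
        simp only [L, Finset.mem_insert, Finset.mem_image, Finset.mem_filter] at hm
        have hfz := h f (by simp [hf, h0.le])
        rcases hm with hm | ⟨g, ⟨hg, hgs⟩, hm⟩
        · simp only [L]; rw [hm]; linarith
        · have h3 := h (g s • f - f s • g) (by
            simp only [Finset.mem_union, Finset.mem_image, Finset.mem_product, Prod.exists]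
            exact Or.inr ⟨f, g, ⟨hf, hg⟩, by simp [h0, hgs]⟩)
          simp only [L]; rw [← hm]
          simp only [LinearMap.sub_apply, LinearMap.smul_apply, smul_eq_mul] at h3
          have : f z - g z / g s * f s = (g s * f z - f s * g z) / g s := by field_simp
          rw [this]
          exact div_nonpos_of_nonpos_of_nonneg h3 hgs.le
      · have hfz := h f (by simp [hf, h0.le])
        rw [h0]; linarith
      · have hm := L.le_max' (f z / f s) (by
          simp only [L, Finset.mem_insert, Finset.mem_image, Finset.mem_filter]
          exact Or.inr ⟨f, ⟨hf, h0⟩, rfl⟩)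
        rw [div_le_iff₀ h0] at hm
        linarith

theorem hull_hrep (S : Finset E3) : ∃ T : Finset (E3 × ℝ),
    convexHull ℝ (S : Set E3) = {x | ∀ f ∈ T, f.2 ≤ ⟪f.1, x⟫} := by
  classical
  obtain ⟨T, hT⟩ := cone_hrep (V := E3 × ℝ) (S.image (fun s => (s, (1:ℝ))))
  let g : (E3 × ℝ →ₗ[ℝ] ℝ) → E3 × ℝ := fun f =>
    ((InnerProductSpace.toDual ℝ E3).symm
      (LinearMap.toContinuousLinearMap (-(f.comp (LinearMap.inl ℝ E3 ℝ)))), f (0, 1))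
  have hg : ∀ f x, f (x, (1:ℝ)) ≤ 0 ↔ (g f).2 ≤ ⟪(g f).1, x⟫ := by
    intro f x
    have : f (x, (1:ℝ)) = f (x, 0) + f (0, 1) := by rw [← map_add]; simp
    simp only [g, InnerProductSpace.toDual_symm_apply]
    simp [this]
    constructor <;> intro h <;> linarith
  refine ⟨T.image g, ?_⟩
  ext x
  have inj : Function.Injective (fun s : E3 => (s, (1:ℝ))) := fun a b h => by simpa using h
  rw [Finset.mem_convexHull']
  have := hT (x, 1)
  simp only [mem_setOf_eq, Finset.mem_image, forall_exists_index, and_imp,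
    forall_apply_eq_imp_iff₂, ← hg]
  rw [← this]
  constructor
  · rintro ⟨w, h0, h1, h2⟩
    refine ⟨fun p => w p.1, by simpa using h0, ?_⟩
    rw [Finset.sum_image (fun a _ b _ h => inj h)]
    simp only [Prod.smul_mk, smul_eq_mul, mul_one]
    ext1
    · simp [Prod.fst_sum, h2]
    · simp [Prod.snd_sum, h1]
  · rintro ⟨w, h0, h1⟩
    rw [Finset.sum_image (fun a _ b _ h => inj h)] at h1
    refine ⟨fun s => w (s, 1), by simpa using h0, ?_, ?_⟩
    · have := congrArg Prod.snd h1
      simpa [Prod.snd_sum] using this.symm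
    · have := congrArg Prod.fst h1
      simpa [Prod.fst_sum] using this.symm
end

section
/-- Irredundant half-space data of a polyhedron. -/
structure HPoly (ι : Type) (Ω : Set E3) where
  n : ι → E3
  c : ι → ℝ
  a : ι → E3
  o : E3
  unit : ∀ i, ‖n i‖ = 1
  eq : ∀ x, x ∈ Ω ↔ ∀ i, c i < ⟪n i, x⟫
  cl : ∀ x, x ∈ closure Ω ↔ ∀ i, c i ≤ ⟪n i, x⟫
  fa : ∀ i, ⟪n i, a i⟫ = c i
  fb : ∀ i j, j ≠ i → c j < ⟪n j, a i⟫
  ho : o ∈ Ω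
  bdd : Bornology.IsBounded Ω
  op : IsOpen Ω
  cvx : Convex ℝ Ω

/-- signed distance to the `i`-th face plane -/
def HPoly.l {ι : Type} {Ω : Set E3} (P : HPoly ι Ω) (i : ι) (x : E3) : ℝ := ⟪P.n i, x⟫ - P.c i

theorem exists_poly (Ω : Set E3) (hΩ : IsConvexPolyhedron Ω) (hne : Ω.Nonempty) :
    ∃ (ι : Type) (_ : Fintype ι), Nonempty (HPoly ι Ω) := by
  classical
  obtain ⟨hop, hbd, hcv, S, hS⟩ := hΩ
  obtain ⟨T0, hT0⟩ := hull_hrep S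
  set H := convexHull ℝ (S : Set E3) with hH
  let good : Finset (E3 × ℝ) → Prop := fun T => H = {x | ∀ f ∈ T, f.2 ≤ ⟪f.1, x⟫}
  obtain ⟨T, hTg, hTm⟩ : ∃ T, good T ∧ ∀ T', good T' → T.card ≤ T'.card := by
    have hex : ∃ k, ∃ T, good T ∧ T.card = k := ⟨_, T0, hT0, rfl⟩
    obtain ⟨T, hT, hc⟩ := Nat.find_spec hex
    exact ⟨T, hT, fun T' h' => hc ▸ Nat.find_min' hex ⟨T', h', rfl⟩⟩
  obtain ⟨o, ho⟩ := hne
  have hmem : ∀ x, x ∈ H ↔ ∀ f ∈ T, f.2 ≤ ⟪f.1, x⟫ := fun x => by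
    conv_lhs => rw [hTg]
    rfl
  have hoH : o ∈ interior H := hS ▸ ho
  have hx : ∀ f ∈ T, ∃ x, ⟪f.1, x⟫ < f.2 ∧ ∀ g ∈ T, g ≠ f → g.2 ≤ ⟪g.1, x⟫ := by
    intro f hf
    by_contra hcon
    push Not at hcon
    have : good (T.erase f) := by
      ext x
      rw [hmem]
      constructor
      · intro h g hg; exact h g (Finset.mem_of_mem_erase hg)
      · intro h g hg
        have h : ∀ g ∈ T.erase f, g.2 ≤ ⟪g.1, x⟫ := h
        by_cases hgf : g = f
        · by_contra hlt
          push Not at hlt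
          obtain ⟨g', hg', hne', hlt'⟩ := hcon x (hgf ▸ hlt)
          exact absurd (h g' (Finset.mem_erase.2 ⟨hne', hg'⟩)) (not_le.2 hlt')
        · exact h g (Finset.mem_erase.2 ⟨hgf, hg⟩)
    have h1 := hTm _ this
    have h2 := Finset.card_erase_lt_of_mem hf
    omega
  have hn0 : ∀ f ∈ T, f.1 ≠ 0 := by
    intro f hf h0
    obtain ⟨x, hx1, -⟩ := hx f hf
    have := (hmem o).1 (interior_subset hoH) f hf
    simp [h0] at this hx1
    linarith
  have hstrict : ∀ x ∈ interior H, ∀ f ∈ T, f.2 < ⟪f.1, x⟫ := by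
    intro x hxi f hf
    have h0 := hn0 f hf
    obtain ⟨ε, hε, hball⟩ := Metric.isOpen_iff.1 isOpen_interior x hxi
    have hpos : 0 < ‖f.1‖ := norm_pos_iff.2 h0
    have hy : x - (ε / (2 * ‖f.1‖)) • f.1 ∈ Metric.ball x ε := by
      rw [mem_ball, dist_eq_norm]
      simp only [sub_sub_cancel_left, norm_neg, norm_smul, Real.norm_eq_abs]
      rw [abs_of_pos (by positivity)]
      field_simp
      linarith
    have := (hmem _).1 (interior_subset (hball hy)) f hf
    rw [inner_sub_right, inner_smul_right, real_inner_self_eq_norm_sq] at this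
    have : 0 < ε / (2 * ‖f.1‖) * ‖f.1‖ ^ 2 := by positivity
    linarith
  have hO : ∀ x, x ∈ Ω ↔ ∀ f ∈ T, f.2 < ⟪f.1, x⟫ := by
    intro x
    constructor
    · intro h; exact hstrict x (hS ▸ h)
    · intro h
      rw [hS]
      have hopen : IsOpen {y : E3 | ∀ f ∈ T, f.2 < ⟪f.1, y⟫} := by
        have : {y : E3 | ∀ f ∈ T, f.2 < ⟪f.1, y⟫} = ⋂ f ∈ T, {y : E3 | f.2 < ⟪f.1, y⟫} := by
          ext y; simp
        rw [this]
        exact isOpen_biInter_finset fun f _ =>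
          isOpen_lt continuous_const (continuous_const.inner continuous_id)
      exact interior_maximal (fun y hy => (hmem y).2 fun f hf => (hy f hf).le) hopen h
  have hclosed : IsClosed H := by
    rw [hTg]
    have : {y : E3 | ∀ f ∈ T, f.2 ≤ ⟪f.1, y⟫} = ⋂ f ∈ T, {y : E3 | f.2 ≤ ⟪f.1, y⟫} := by
      ext y; simp
    rw [this]
    exact isClosed_biInter fun f _ =>
      isClosed_le continuous_const (continuous_const.inner continuous_id)
  have hcl : closure Ω = H := by
    rw [hS, (convex_convexHull ℝ (S : Set E3)).closure_interior_eq_closure_of_nonempty_interior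
      ⟨o, hoH⟩, hclosed.closure_eq]
  have ha : ∀ f : T, ∃ a : E3, ⟪f.1.1, a⟫ = f.1.2 ∧ ∀ g ∈ T, g ≠ f.1 → g.2 < ⟪g.1, a⟫ := by
    rintro ⟨f, hf⟩
    obtain ⟨x, hx1, hx2⟩ := hx f hf
    have ho1 := (hO o).1 ho f hf
    set t := (⟪f.1, o⟫ - f.2) / (⟪f.1, o⟫ - ⟪f.1, x⟫) with ht
    have hd : 0 < ⟪f.1, o⟫ - ⟪f.1, x⟫ := by linarith
    have ht0 : 0 < t := div_pos (by linarith) hd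
    have ht1 : t < 1 := by rw [ht, div_lt_one hd]; linarith
    refine ⟨(1 - t) • o + t • x, ?_, ?_⟩
    · simp only [inner_add_right, inner_smul_right]
      have : t * (⟪f.1, o⟫ - ⟪f.1, x⟫) = ⟪f.1, o⟫ - f.2 := div_mul_cancel₀ _ hd.ne'
      linarith
    · intro g hg hgf
      simp only [inner_add_right, inner_smul_right]
      have h1 := (hO o).1 ho g hg
      have h2 := hx2 g hg hgf
      nlinarith
  choose a ha1 ha2 using ha
  have hpos : ∀ f : T, 0 < ‖f.1.1‖ := fun f => norm_pos_iff.2 (hn0 _ f.2)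
  refine ⟨T, inferInstance, ⟨⟨fun f => ‖f.1.1‖⁻¹ • f.1.1, fun f => ‖f.1.1‖⁻¹ * f.1.2, a, o,
    ?_, ?_, ?_, ?_, ?_, ho, hbd, hop, hcv⟩⟩⟩
  · intro f; rw [norm_smul, norm_inv, norm_norm, inv_mul_cancel₀ (hpos f).ne']
  · intro x
    simp only [real_inner_smul_left]
    rw [hO]
    constructor
    · intro h f; exact mul_lt_mul_of_pos_left (h f.1 f.2) (inv_pos.2 (hpos f))
    · intro h f hf; exact lt_of_mul_lt_mul_left (h ⟨f, hf⟩) (inv_pos.2 (hpos ⟨f, hf⟩)).le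
  · intro x
    simp only [real_inner_smul_left]
    rw [hcl, hmem]
    constructor
    · intro h f; exact mul_le_mul_of_nonneg_left (h f.1 f.2) (inv_pos.2 (hpos f)).le
    · intro h f hf; exact le_of_mul_le_mul_left (h ⟨f, hf⟩) (inv_pos.2 (hpos ⟨f, hf⟩))
  · intro f; rw [real_inner_smul_left, ha1]
  · intro f g hgf
    rw [real_inner_smul_left]
    exact mul_lt_mul_of_pos_left (ha2 f g.1 g.2 (fun h => hgf (Subtype.ext h))) (inv_pos.2 (hpos g))

namespace HPoly
variable {ι : Type} {Ω : Set E3} (P : HPoly ι Ω)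

theorem mem {x : E3} : x ∈ Ω ↔ ∀ i, 0 < P.l i x := by
  rw [P.eq]; simp only [l, sub_pos]

theorem mem_cl {x : E3} : x ∈ closure Ω ↔ ∀ i, 0 ≤ P.l i x := by
  rw [P.cl]; simp only [l, sub_nonneg]

theorem mem_fr {x : E3} : x ∈ frontier Ω ↔ (∀ i, 0 ≤ P.l i x) ∧ ∃ i, P.l i x = 0 := by
  rw [P.op.frontier_eq, mem_diff, P.mem_cl, P.mem]
  constructor
  · rintro ⟨h1, h2⟩
    push Not at h2
    obtain ⟨i, hi⟩ := h2
    exact ⟨h1, i, le_antisymm hi (h1 i)⟩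
  · rintro ⟨h1, i, hi⟩
    exact ⟨h1, fun h => (h i).ne' hi⟩

theorem l_add (i : ι) (x y : E3) : P.l i (x + y) = P.l i x + ⟪P.n i, y⟫ := by
  simp only [l, inner_add_right]; ring

theorem l_lip (i : ι) (x y : E3) : |P.l i x - P.l i y| ≤ ‖x - y‖ := by
  have : P.l i x - P.l i y = ⟪P.n i, x - y⟫ := by simp only [l, inner_sub_right]; ring
  rw [this]
  simpa [P.unit i] using abs_real_inner_le_norm (P.n i) (x - y)

theorem l_comb (i : ι) (x y : E3) (t : ℝ) :
    P.l i (x + t • (y - x)) = (1 - t) * P.l i x + t * P.l i y := by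
  simp only [l, inner_add_right, inner_smul_right, inner_sub_right]; ring

theorem l_a (i : ι) : P.l i (P.a i) = 0 := by simp [l, P.fa]

theorem l_a_pos (i j : ι) (h : j ≠ i) : 0 < P.l j (P.a i) := by
  simpa [l] using P.fb i j h

theorem l_cont (i : ι) : Continuous (P.l i) :=
  (continuous_const.inner continuous_id).sub continuous_const

theorem cont_diff_l (i : ι) {k : WithTop ℕ∞} : ContDiff ℝ k (P.l i) :=
  (contDiff_const.inner ℝ contDiff_id).sub contDiff_const

theorem hasFDeriv_l (i : ι) (x : E3) : HasFDerivAt (P.l i) (innerSL ℝ (P.n i)) x :=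
  ((innerSL ℝ (P.n i)).hasFDerivAt).sub_const _

/-- distinct faces have independent or opposite normals -/
theorem indep_or (i j : ι) (h : i ≠ j) :
    LinearIndependent ℝ ![P.n i, P.n j] ∨ ∃ δ > 0, ∀ x, P.l i x + P.l j x = δ := by
  by_cases hli : LinearIndependent ℝ ![P.n i, P.n j]
  · exact Or.inl hli
  right
  have hne : P.n i ≠ 0 := fun h0 => by simpa [h0] using P.unit i
  rw [LinearIndependent.pair_iff' hne] at hli
  push Not at hli
  obtain ⟨a, ha⟩ := hli
  have hab : |a| = 1 := by
    have := congrArg norm ha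
    rwa [norm_smul, P.unit, P.unit, mul_one, Real.norm_eq_abs] at this
  have h1 := P.l_a i
  have h2 := P.l_a j
  have h3 := P.l_a_pos i j h.symm
  have h4 := P.l_a_pos j i h
  simp only [l, ← ha, real_inner_smul_left] at *
  rcases eq_or_eq_neg_of_abs_eq hab with rfl | rfl
  · linarith
  · exact ⟨-P.c i - P.c j, by linarith, fun x => by ring⟩

end HPoly
end

section
theorem lay_K {a m : ℝ} (ha : 0 < a) (hm : 0 ≤ m) :
    ∫⁻ t in Ioc 0 m, ENNReal.ofReal (t ^ (a - 1)) = ENNReal.ofReal (m ^ a / a) := by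
  have h1 : IntegrableOn (fun t : ℝ => t ^ (a - 1)) (Ioc 0 m) :=
    (intervalIntegrable_iff_integrableOn_Ioc_of_le hm).1
      (intervalIntegral.intervalIntegrable_rpow' (by linarith))
  rw [← ofReal_integral_eq_lintegral_ofReal h1, ← intervalIntegral.integral_of_le hm,
    integral_rpow (Or.inl (by linarith))]
  · simp [Real.zero_rpow ha.ne']
  · filter_upwards [ae_restrict_mem measurableSet_Ioc] with t ht
    exact Real.rpow_nonneg ht.1.le _

theorem lay {W : E3 → ℝ≥0∞} (hW : Measurable W) {F : E3 → ℝ} (hF : Measurable F)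
    (hF0 : ∀ x, 0 ≤ F x) {a c M : ℝ} (ha : 0 < a) (hc : 0 < c) (hM : 0 < M) :
    ∫⁻ t in Ioc 0 M, ENNReal.ofReal (t ^ (a - 1)) * ∫⁻ x in {x | c * t < F x}, W x
      = ∫⁻ x, W x * ENNReal.ofReal ((min M (F x / c)) ^ a / a) := by
  have hms : ∀ t : ℝ, MeasurableSet {x | c * t < F x} := fun t => measurableSet_lt measurable_const hF
  have h1 : ∀ t : ℝ, ENNReal.ofReal (t ^ (a - 1)) * ∫⁻ x in {x | c * t < F x}, W x
      = ∫⁻ x, ENNReal.ofReal (t ^ (a - 1)) * ({x | c * t < F x}.indicator W x) := by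
    intro t
    rw [lintegral_const_mul _ (hW.indicator (hms t)), lintegral_indicator (hms t)]
  simp_rw [h1]
  rw [lintegral_lintegral_swap]
  · refine lintegral_congr fun x => ?_
    have hm : 0 ≤ min M (F x / c) := le_min hM.le (div_nonneg (hF0 x) hc.le)
    have h2 : ∀ t : ℝ, ENNReal.ofReal (t ^ (a - 1)) * ({x | c * t < F x}.indicator W x)
        = W x * (Iio (F x / c)).indicator (fun t => ENNReal.ofReal (t ^ (a - 1))) t := by
      intro t
      by_cases h : c * t < F x
      · rw [indicator_of_mem (by exact h), indicator_of_mem (by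
          rw [mem_Iio, lt_div_iff₀ hc]; linarith), mul_comm]
      · rw [indicator_of_notMem (by exact h), indicator_of_notMem (by
          rw [mem_Iio, lt_div_iff₀ hc]; linarith), mul_zero, mul_zero]
    simp only [h2]
    rw [lintegral_const_mul _ (Measurable.indicator (by fun_prop) measurableSet_Iio), lintegral_indicator measurableSet_Iio,
      Measure.restrict_restrict measurableSet_Iio, ← lay_K ha hm]
    congr 1
    apply setLIntegral_congr
    have : Iio (F x / c) =ᵐ[volume] Iic (F x / c) := Iio_ae_eq_Iic
    have h3 := this.inter (Filter.EventuallyEq.refl (ae volume) (Ioc 0 M))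
    refine h3.trans (Filter.EventuallyEq.of_eq
      (?_ : Iic (F x / c) ∩ Ioc 0 M = Ioc 0 (min M (F x / c))))
    ext t; simp only [mem_inter_iff, mem_Iic, mem_Ioc, le_min_iff]; tauto
  · apply Measurable.aemeasurable
    apply Measurable.mul (by fun_prop)
    have : (fun p : ℝ × E3 => {x | c * p.1 < F x}.indicator W p.2)
      = {p : ℝ × E3 | c * p.1 < F p.2}.indicator (fun p => W p.2) := by
      ext p; simp [indicator]
    rw [this]
    exact (hW.comp measurable_snd).indicator
      (measurableSet_lt (by fun_prop) (hF.comp measurable_snd))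

theorem goodlam {q s A κ c C1 : ℝ} (hq : 2 < q) (hs2 : s ≤ 2) (hA : 1 ≤ A) (hκ : 0 ≤ κ)
    (hc : 0 < c) (hC1 : 0 ≤ C1) (habs : κ * A ^ (q - 2) * (q - 2) / (q - s) ≤ 1 / 2) :
    ∃ C : ℝ, 0 ≤ C ∧ ∀ (F G : E3 → ℝ) (l0 : ℝ) (Y : ℝ≥0∞), Measurable F → Measurable G →
      (∀ x, 0 ≤ F x) → (∀ x, 0 ≤ G x) → 0 ≤ l0 → (∫⁻ x, ENNReal.ofReal (F x ^ 2)) ≠ ∞ →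
      (∀ t > 0, ∫⁻ x in {x | A * t < F x}, ENNReal.ofReal (F x ^ 2) ≤
        ENNReal.ofReal (κ * t ^ (2 - s)) * (∫⁻ x in {x | 1 * t < F x}, ENNReal.ofReal (F x ^ s))
        + ENNReal.ofReal C1 * (∫⁻ x in {x | c * t < G x}, ENNReal.ofReal (G x ^ 2))
        + (Iic l0).indicator (fun _ => Y) t) →
      ∫⁻ x, ENNReal.ofReal (F x ^ q) ≤ ENNReal.ofReal C * (∫⁻ x, ENNReal.ofReal (G x ^ q))
        + ENNReal.ofReal (C * l0 ^ (q - 2)) * Y := by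
  have hq2 : 0 < q - 2 := by linarith
  have hqs : 0 < q - s := by linarith
  have hA0 : 0 < A := by linarith
  refine ⟨A ^ (q - 2) * (2 * (C1 * (c ^ (q - 2))⁻¹) + 2), by positivity, ?_⟩
  intro F G l0 Y hF hG hF0 hG0 hl0 hfin hyp
  have key : ∀ M : ℝ, 0 < M → ∫⁻ x, ENNReal.ofReal (F x ^ 2 * (min M (F x / A)) ^ (q - 2)) ≤
      ENNReal.ofReal (2 * (C1 * (c ^ (q - 2))⁻¹)) * (∫⁻ x, ENNReal.ofReal (G x ^ q))
        + ENNReal.ofReal (2 * l0 ^ (q - 2)) * Y := by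
    intro M hM
    set X := ∫⁻ x, ENNReal.ofReal (F x ^ 2 * (min M (F x / A)) ^ (q - 2)) with hX
    have hm0 : ∀ x, 0 ≤ min M (F x / A) := fun x => le_min hM.le (div_nonneg (hF0 x) hA0.le)
    have hXfin : X ≠ ∞ := by
      refine ne_top_of_le_ne_top (ENNReal.mul_ne_top hfin (ENNReal.ofReal_ne_top (r := M ^ (q - 2)))) ?_
      rw [hX, ← lintegral_mul_const _ (by fun_prop)]
      refine lintegral_mono fun x => ?_
      rw [← ENNReal.ofReal_mul (by positivity)]
      refine ENNReal.ofReal_le_ofReal (mul_le_mul_of_nonneg_left ?_ (by positivity))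
      exact Real.rpow_le_rpow (hm0 x) (min_le_left _ _) hq2.le
    have e1 := lay (W := fun x => ENNReal.ofReal (F x ^ 2)) (by fun_prop) hF hF0 hq2 hA0 hM
    have e2 := lay (W := fun x => ENNReal.ofReal (F x ^ s)) (by fun_prop) hF hF0 hqs one_pos hM
    have e3 := lay (W := fun x => ENNReal.ofReal (G x ^ 2)) (by fun_prop) hG hG0 hq2 hc hM
    have i1 : ENNReal.ofReal (q - 2)⁻¹ * X = ∫⁻ x, ENNReal.ofReal (F x ^ 2) *
        ENNReal.ofReal ((min M (F x / A)) ^ (q - 2) / (q - 2)) := by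
      rw [hX, ← lintegral_const_mul _ (by fun_prop)]
      refine lintegral_congr fun x => ?_
      rw [← ENNReal.ofReal_mul (by positivity), ← ENNReal.ofReal_mul (by positivity)]
      congr 1; field_simp
    have i2 : ENNReal.ofReal κ * ∫⁻ x, ENNReal.ofReal (F x ^ s) *
        ENNReal.ofReal ((min M (F x / 1)) ^ (q - s) / (q - s)) ≤ ENNReal.ofReal ((q - 2)⁻¹ / 2) * X := by
      rw [hX, ← lintegral_const_mul _ (by fun_prop), ← lintegral_const_mul _ (by fun_prop)]
      refine lintegral_mono fun x => ?_
      rw [← ENNReal.ofReal_mul (Real.rpow_nonneg (hF0 x) _), ← ENNReal.ofReal_mul hκ,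
        ← ENNReal.ofReal_mul (by positivity)]
      refine ENNReal.ofReal_le_ofReal ?_
      rw [div_one]
      set m := min M (F x) with hmdef
      have hFx := hF0 x
      have hm : 0 ≤ m := le_min hM.le hFx
      have hmF : m ≤ F x := min_le_right _ _
      rcases hFx.eq_or_lt with h0 | h0
      · have hm' : m = 0 := le_antisymm (h0 ▸ hmF) hm
        rw [hm', Real.zero_rpow hqs.ne', zero_div, mul_zero, mul_zero]
        exact mul_nonneg (by positivity) (mul_nonneg (by positivity) (Real.rpow_nonneg (hm0 x) _))
      have hmp : 0 < m := lt_min hM h0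
      have h1 : m ^ (q - s) = m ^ (2 - s) * m ^ (q - 2) := by
        rw [← Real.rpow_add hmp]; ring_nf
      have h2 : F x ^ s * F x ^ (2 - s) = F x ^ 2 := by
        rw [← Real.rpow_add h0]; norm_num
      have h3 : m ^ (2 - s) ≤ F x ^ (2 - s) := Real.rpow_le_rpow hm hmF (by linarith)
      have h4 : m ^ (q - 2) ≤ A ^ (q - 2) * (min M (F x / A)) ^ (q - 2) := by
        rw [← Real.mul_rpow hA0.le (hm0 x)]
        refine Real.rpow_le_rpow hm ?_ hq2.le
        rw [mul_min_of_nonneg _ _ hA0.le, mul_div_cancel₀ _ hA0.ne']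
        exact min_le_min_right _ (le_mul_of_one_le_left hM.le hA)
      have h5 : F x ^ s * m ^ (q - s) ≤ F x ^ 2 * (A ^ (q - 2) * (min M (F x / A)) ^ (q - 2)) := by
        rw [h1, ← h2, ← mul_assoc]
        exact mul_le_mul (mul_le_mul_of_nonneg_left h3 (by positivity)) h4 (by positivity) (by positivity)
      have h6 : 0 ≤ F x ^ 2 * (min M (F x / A)) ^ (q - 2) :=
        mul_nonneg (by positivity) (Real.rpow_nonneg (hm0 x) _)
      calc κ * (F x ^ s * (m ^ (q - s) / (q - s))) = κ / (q - s) * (F x ^ s * m ^ (q - s)) := by ring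
        _ ≤ κ / (q - s) * (F x ^ 2 * (A ^ (q - 2) * (min M (F x / A)) ^ (q - 2))) :=
          mul_le_mul_of_nonneg_left h5 (by positivity)
        _ = (κ * A ^ (q - 2) * (q - 2) / (q - s)) * ((q - 2)⁻¹ * (F x ^ 2 * (min M (F x / A)) ^ (q - 2))) := by
          field_simp
        _ ≤ 1 / 2 * ((q - 2)⁻¹ * (F x ^ 2 * (min M (F x / A)) ^ (q - 2))) :=
          mul_le_mul_of_nonneg_right habs (by positivity)
        _ = _ := by ring
    have i3 : ∫⁻ x, ENNReal.ofReal (G x ^ 2) * ENNReal.ofReal ((min M (G x / c)) ^ (q - 2) / (q - 2))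
        ≤ ENNReal.ofReal ((q - 2)⁻¹ * (c ^ (q - 2))⁻¹) * ∫⁻ x, ENNReal.ofReal (G x ^ q) := by
      rw [← lintegral_const_mul _ (by fun_prop)]
      refine lintegral_mono fun x => ?_
      rw [← ENNReal.ofReal_mul (by positivity), ← ENNReal.ofReal_mul (by positivity)]
      refine ENNReal.ofReal_le_ofReal ?_
      have hGx := hG0 x
      have h0 : 0 ≤ min M (G x / c) := le_min hM.le (div_nonneg hGx hc.le)
      have h1 : (min M (G x / c)) ^ (q - 2) ≤ G x ^ (q - 2) * (c ^ (q - 2))⁻¹ := by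
        rw [← div_eq_mul_inv, ← Real.div_rpow hGx hc.le]
        exact Real.rpow_le_rpow h0 (min_le_right _ _) hq2.le
      have h2 : G x ^ 2 * G x ^ (q - 2) = G x ^ q := by
        rcases hGx.eq_or_lt with h | h
        · rw [← h, Real.zero_rpow (by linarith : q ≠ 0)]; simp
        · rw [← Real.rpow_natCast, ← Real.rpow_add h]; congr 1; push_cast; ring
      calc G x ^ 2 * ((min M (G x / c)) ^ (q - 2) / (q - 2))
          ≤ G x ^ 2 * (G x ^ (q - 2) * (c ^ (q - 2))⁻¹ / (q - 2)) := by gcongr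
        _ = _ := by rw [← h2]; field_simp
    have i4 : ∫⁻ t in Ioc 0 M, ENNReal.ofReal (t ^ (q - 2 - 1)) * (Iic l0).indicator (fun _ => Y) t
        ≤ ENNReal.ofReal ((q - 2)⁻¹ * l0 ^ (q - 2)) * Y := by
      have : ∀ t, ENNReal.ofReal (t ^ (q - 2 - 1)) * (Iic l0).indicator (fun _ => Y) t
          = (Iic l0).indicator (fun t => ENNReal.ofReal (t ^ (q - 2 - 1)) * Y) t := by
        intro t; by_cases h : t ∈ Iic l0 <;> simp [h]
      simp_rw [this]
      rw [lintegral_indicator measurableSet_Iic, Measure.restrict_restrict measurableSet_Iic]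
      have hsub : Iic l0 ∩ Ioc 0 M ⊆ Ioc 0 l0 := fun t ht => ⟨ht.2.1, ht.1⟩
      refine (lintegral_mono_set hsub).trans ?_
      rw [lintegral_mul_const _ (by fun_prop), lay_K hq2 hl0, div_eq_inv_mul]
    have main : ENNReal.ofReal (q - 2)⁻¹ * X ≤ ENNReal.ofReal ((q - 2)⁻¹ / 2) * X +
        (ENNReal.ofReal C1 * (ENNReal.ofReal ((q - 2)⁻¹ * (c ^ (q - 2))⁻¹) * ∫⁻ x, ENNReal.ofReal (G x ^ q))
        + ENNReal.ofReal ((q - 2)⁻¹ * l0 ^ (q - 2)) * Y) := by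
      rw [i1, ← e1]
      have hmS : ∀ (H : E3 → ℝ) (b e : ℝ), Measurable H → 0 < b → Measurable fun t : ℝ =>
          ENNReal.ofReal (t ^ e) * ∫⁻ x in {x | b * t < H x}, ENNReal.ofReal (H x ^ 2) := by
        intro H b e hH hb
        refine Measurable.mul (by fun_prop) (Antitone.measurable fun t1 t2 h => lintegral_mono_set ?_)
        intro x hx; exact lt_of_le_of_lt (mul_le_mul_of_nonneg_left h hb.le) hx
      have hmS' : Measurable fun t : ℝ => ENNReal.ofReal (t ^ (q - s - 1)) *
          ∫⁻ x in {x | 1 * t < F x}, ENNReal.ofReal (F x ^ s) := by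
        refine Measurable.mul (by fun_prop) (Antitone.measurable fun t1 t2 h => lintegral_mono_set ?_)
        intro x hx; exact lt_of_le_of_lt (mul_le_mul_of_nonneg_left h zero_le_one) hx
      calc _ ≤ ∫⁻ t in Ioc 0 M, (ENNReal.ofReal κ * (ENNReal.ofReal (t ^ (q - s - 1)) *
            ∫⁻ x in {x | 1 * t < F x}, ENNReal.ofReal (F x ^ s)) +
            (ENNReal.ofReal C1 * (ENNReal.ofReal (t ^ (q - 2 - 1)) *
            ∫⁻ x in {x | c * t < G x}, ENNReal.ofReal (G x ^ 2)) +
            ENNReal.ofReal (t ^ (q - 2 - 1)) * (Iic l0).indicator (fun _ => Y) t)) := by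
            refine setLIntegral_mono_ae' measurableSet_Ioc (ae_of_all _ fun t ht => ?_)
            refine (mul_le_mul_right (hyp t ht.1) _).trans (le_of_eq ?_)
            have : ENNReal.ofReal (t ^ (q - 2 - 1)) * ENNReal.ofReal (κ * t ^ (2 - s))
                = ENNReal.ofReal κ * ENNReal.ofReal (t ^ (q - s - 1)) := by
              have := ht.1
              rw [← ENNReal.ofReal_mul (by positivity), ← ENNReal.ofReal_mul (by positivity),
                mul_left_comm, ← Real.rpow_add ht.1]
              ring_nf
            rw [mul_add, mul_add, ← mul_assoc, this]
            ring
        _ ≤ _ := by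
            rw [lintegral_add_left (hmS'.const_mul _), lintegral_const_mul _ hmS',
              lintegral_add_left ((hmS G c _ hG hc).const_mul _),
              lintegral_const_mul _ (hmS G c _ hG hc), e2, e3]
            gcongr
    have hsplit : ENNReal.ofReal (q - 2)⁻¹ * X =
        ENNReal.ofReal ((q - 2)⁻¹ / 2) * X + ENNReal.ofReal ((q - 2)⁻¹ / 2) * X := by
      rw [← add_mul, ← ENNReal.ofReal_add (by positivity) (by positivity), add_halves]
    rw [hsplit] at main
    have main2 := (ENNReal.add_le_add_iff_left (ENNReal.mul_ne_top ENNReal.ofReal_ne_top hXfin)).1 main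
    have hinv : ENNReal.ofReal (2 * (q - 2)) * ENNReal.ofReal ((q - 2)⁻¹ / 2) = 1 := by
      rw [← ENNReal.ofReal_mul (by positivity)]
      rw [show 2 * (q - 2) * ((q - 2)⁻¹ / 2) = 1 by field_simp]; simp
    calc X = ENNReal.ofReal (2 * (q - 2)) * (ENNReal.ofReal ((q - 2)⁻¹ / 2) * X) := by
          rw [← mul_assoc, hinv, one_mul]
      _ ≤ ENNReal.ofReal (2 * (q - 2)) * _ := mul_le_mul_right main2 _
      _ = _ := by
        rw [mul_add, ← mul_assoc, ← mul_assoc, ← mul_assoc, ← ENNReal.ofReal_mul (by positivity),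
          ← ENNReal.ofReal_mul (by positivity), ← ENNReal.ofReal_mul (by positivity)]
        congr 3 <;> field_simp
  set R := ENNReal.ofReal (2 * (C1 * (c ^ (q - 2))⁻¹)) * (∫⁻ x, ENNReal.ofReal (G x ^ q))
        + ENNReal.ofReal (2 * l0 ^ (q - 2)) * Y
  have hlim : ∫⁻ x, ENNReal.ofReal (F x ^ 2 * (F x / A) ^ (q - 2)) ≤ R := by
    have h1 : ∀ x, ENNReal.ofReal (F x ^ 2 * (F x / A) ^ (q - 2)) ≤ Filter.liminf (fun k : ℕ =>
        ENNReal.ofReal (F x ^ 2 * (min ((k : ℝ) + 1) (F x / A)) ^ (q - 2))) Filter.atTop := by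
      intro x
      refine Filter.le_liminf_of_le (by isBoundedDefault) ?_
      filter_upwards [Filter.eventually_ge_atTop ⌈F x / A⌉₊] with k hk
      rw [min_eq_right]
      have := (Nat.le_ceil (F x / A)).trans (Nat.cast_le.2 hk)
      linarith
    refine (lintegral_mono h1).trans ((lintegral_liminf_le fun k => by fun_prop).trans ?_)
    refine (Filter.liminf_le_liminf (Filter.Eventually.of_forall fun k : ℕ => key _ (by positivity))).trans ?_
    rw [Filter.liminf_const]
  have hF2 : ∀ x, F x ^ q = A ^ (q - 2) * (F x ^ 2 * (F x / A) ^ (q - 2)) := by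
    intro x
    have hFx := hF0 x
    rw [Real.div_rpow hFx hA0.le, mul_comm (F x ^ 2), ← mul_assoc, mul_div_cancel₀ _ (by positivity)]
    rcases hFx.eq_or_lt with h | h
    · rw [← h, Real.zero_rpow (by linarith : q ≠ 0)]; simp
    · rw [← Real.rpow_natCast, ← Real.rpow_add h]; congr 1; push_cast; ring
  calc ∫⁻ x, ENNReal.ofReal (F x ^ q) = ENNReal.ofReal (A ^ (q - 2)) *
        ∫⁻ x, ENNReal.ofReal (F x ^ 2 * (F x / A) ^ (q - 2)) := by
        rw [← lintegral_const_mul _ (by fun_prop)]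
        refine lintegral_congr fun x => ?_
        rw [← ENNReal.ofReal_mul (by positivity), ← hF2]
    _ ≤ ENNReal.ofReal (A ^ (q - 2)) * R := mul_le_mul_right hlim _
    _ ≤ _ := by
      rw [mul_add, ← mul_assoc, ← mul_assoc (ENNReal.ofReal _) _ Y, ← ENNReal.ofReal_mul (by positivity),
        ← ENNReal.ofReal_mul (by positivity)]
      refine add_le_add (mul_le_mul_left (ENNReal.ofReal_le_ofReal ?_) _)
        (mul_le_mul_left (ENNReal.ofReal_le_ofReal ?_) _)
      · exact mul_le_mul_of_nonneg_left (by linarith) (by positivity)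
      · have : 0 ≤ A ^ (q - 2) * l0 ^ (q - 2) * (2 * (C1 * (c ^ (q - 2))⁻¹)) := by positivity
        linarith
end

section
theorem vol_cb (x : E3) {r : ℝ} (hr : 0 ≤ r) :
    volume (closedBall x r) = ENNReal.ofReal (r ^ 3) * volume (closedBall (0 : E3) 1) := by
  have := Measure.addHaar_closedBall (volume : Measure E3) x hr
  rw [this, Measure.addHaar_closedBall _ (0 : E3) zero_le_one]
  simp

theorem vol_cb1 : 1 ≤ volume (closedBall (0 : E3) 1) := by
  rw [EuclideanSpace.volume_closedBall_fin_three]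
  rw [← ENNReal.ofReal_one, ← ENNReal.ofReal_pow zero_le_one, ← ENNReal.ofReal_mul (by simp)]
  refine ENNReal.ofReal_le_ofReal ?_
  have := Real.pi_gt_three
  linarith

theorem vol_cb1_top : volume (closedBall (0 : E3) 1) ≠ ∞ := measure_closedBall_lt_top.ne

theorem stopping {Φ : E3 → ℝ≥0∞} (hΦ : Measurable Φ) (hfin : ∫⁻ x, Φ x ≠ ∞) {L K : ℝ}
    (hL : 0 < L) (hK : 1 ≤ K) :
    ∃ (u : Set E3) (r : E3 → ℝ), u.Countable ∧
      (∀ x ∈ u, 0 < r x ∧ ENNReal.ofReal L < Φ x ∧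
        ENNReal.ofReal (L * r x ^ 3) ≤ ∫⁻ y in closedBall x (r x), Φ y ∧
        ∀ ρ, 2 * r x ≤ ρ → ∫⁻ y in closedBall x ρ, Φ y ≤ ENNReal.ofReal (L * ρ ^ 3)) ∧
      u.PairwiseDisjoint (fun x => closedBall x (K * r x)) ∧
      ∀ᵐ x, ENNReal.ofReal L < Φ x → ∃ z ∈ u, x ∈ closedBall z (5 * K * r z) := by
  classical
  let S : E3 → Set ℝ := fun x => {r | 0 < r ∧ ENNReal.ofReal (L * r ^ 3) ≤ ∫⁻ y in closedBall x r, Φ y}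
  let T : Set E3 := {x | ENNReal.ofReal L < Φ x ∧ (S x).Nonempty}
  set I := (∫⁻ x, Φ x).toReal with hI
  have hbd : ∀ x, ∀ r ∈ S x, r ≤ I / L + 1 := by
    intro x r hr
    have h1 : ENNReal.ofReal (L * r ^ 3) ≤ ENNReal.ofReal I := by
      rw [hI, ENNReal.ofReal_toReal hfin]
      exact hr.2.trans (setLIntegral_le_lintegral _ _)
    have hI0 : 0 ≤ I := ENNReal.toReal_nonneg
    have h2 : L * r ^ 3 ≤ I := (ENNReal.ofReal_le_ofReal_iff hI0).1 h1
    have h3 : r ^ 3 ≤ I / L := by rw [le_div_iff₀ hL]; linarith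
    by_contra hcon
    push Not at hcon
    have h4 : 0 ≤ I / L := by positivity
    have h5 : 1 < r := by linarith
    have : r ≤ r ^ 3 := le_self_pow₀ h5.le (by norm_num)
    linarith
  have hch : ∀ x, ∃ r, x ∈ T → r ∈ S x ∧ ∀ ρ ∈ S x, ρ < 2 * r := by
    intro x
    by_cases hx : x ∈ T
    · obtain ⟨r0, hr0⟩ := hx.2
      have hba : BddAbove (S x) := ⟨_, hbd x⟩
      have hpos : 0 < sSup (S x) := hr0.1.trans_le (le_csSup hba hr0)
      obtain ⟨r, hr, hlt⟩ := exists_lt_of_lt_csSup hx.2 (half_lt_self hpos)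
      exact ⟨r, fun _ => ⟨hr, fun ρ hρ => by have := le_csSup hba hρ; linarith⟩⟩
    · exact ⟨0, fun h => absurd h hx⟩
  choose r hr using hch
  obtain ⟨u, huT, hdis, hcov⟩ := Vitali.exists_disjoint_subfamily_covering_enlargement_closedBall
    T (fun x => x) (fun x => K * r x) (K * (I / L + 1))
    (fun x hx => mul_le_mul_of_nonneg_left (hbd x _ (hr x hx).1) (by linarith)) 5 (by norm_num)
  have hrp : ∀ x ∈ T, 0 < r x := fun x hx => (hr x hx).1.1
  refine ⟨u, r, ?_, ?_, hdis, ?_⟩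
  · refine hdis.countable_of_nonempty_interior fun x hx => ?_
    refine ⟨x, ball_subset_interior_closedBall (mem_ball_self ?_)⟩
    have := hrp x (huT hx)
    positivity
  · intro x hx
    have hxT := huT hx
    refine ⟨hrp x hxT, hxT.1, (hr x hxT).1.2, fun ρ hρ => ?_⟩
    by_contra hcon
    push Not at hcon
    have := (hr x hxT).2 ρ ⟨by linarith [hrp x hxT], hcon.le⟩
    linarith
  · filter_upwards [(Besicovitch.vitaliFamily (volume : Measure E3)).ae_tendsto_lintegral_div
      hΦ.aemeasurable hfin] with x hx hLx
    have h1 := hx.comp (Besicovitch.tendsto_filterAt (volume : Measure E3) x)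
    have h2 := (h1.eventually (lt_mem_nhds hLx)).and self_mem_nhdsWithin
    obtain ⟨ρ, hρ, hρ0⟩ := h2.exists
    have hρ0 : 0 < ρ := hρ0
    have hS : ρ ∈ S x := by
      refine ⟨hρ0, ?_⟩
      have hv : volume (closedBall x ρ) ≠ 0 := (measure_closedBall_pos _ _ hρ0).ne'
      have hv' : volume (closedBall x ρ) ≠ ∞ := measure_closedBall_lt_top.ne
      have h3 := (ENNReal.lt_div_iff_mul_lt (Or.inl hv) (Or.inl hv')).1 hρ
      refine le_trans ?_ h3.le
      rw [vol_cb x hρ0.le, ENNReal.ofReal_mul hL.le]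
      gcongr
      exact le_mul_of_one_le_right (zero_le) vol_cb1
    obtain ⟨z, hz, hsub⟩ := hcov x ⟨hLx, ρ, hS⟩
    refine ⟨z, hz, ?_⟩
    have h4 : x ∈ closedBall x (K * r x) := by
      have := hrp x ⟨hLx, ρ, hS⟩
      exact mem_closedBall_self (by positivity)
    have := hsub h4
    rwa [← mul_assoc] at this
end

section
theorem ofR_two (a : ℝ) : ENNReal.ofReal a * 2 = ENNReal.ofReal (a * 2) := by
  rw [ENNReal.ofReal_mul' (by norm_num)]; simp
theorem two_ofR (a : ℝ) : 2 * ENNReal.ofReal a = ENNReal.ofReal (2 * a) := by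
  rw [mul_comm, ofR_two, mul_comm]

theorem cover_sum {u : Set E3} (hu : u.Countable) {R ρ : E3 → ℝ} {S : Set E3} {f g : E3 → ℝ≥0∞}
    {a : ℝ≥0∞} (hcov : ∀ᵐ x, x ∈ S → ∃ z ∈ u, x ∈ closedBall z (R z))
    (hdis : u.PairwiseDisjoint (fun x => closedBall x (ρ x)))
    (h : ∀ z ∈ u, ∫⁻ x in S ∩ closedBall z (R z), f x ≤ a * ∫⁻ x in closedBall z (ρ z), g x) :
    ∫⁻ x in S, f x ≤ a * ∫⁻ x, g x := by
  haveI := hu.to_subtype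
  calc ∫⁻ x in S, f x ≤ ∫⁻ x in ⋃ z : u, S ∩ closedBall z.1 (R z.1), f x := by
        refine lintegral_mono' (Measure.restrict_mono_ae ?_) le_rfl
        filter_upwards [hcov] with x hx hxS
        obtain ⟨z, hz, hxz⟩ := hx hxS
        exact mem_iUnion.2 ⟨⟨z, hz⟩, hxS, hxz⟩
    _ ≤ ∑' z : u, ∫⁻ x in S ∩ closedBall z.1 (R z.1), f x := lintegral_iUnion_le _ _
    _ ≤ ∑' z : u, a * ∫⁻ x in closedBall z.1 (ρ z.1), g x := ENNReal.tsum_le_tsum fun z => h z.1 z.2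
    _ = a * ∫⁻ x in ⋃ z ∈ u, closedBall z (ρ z), g x := by
        rw [ENNReal.tsum_mul_left, lintegral_biUnion hu (fun z _ => measurableSet_closedBall) hdis]
    _ ≤ _ := by gcongr; exact Measure.restrict_le_self

def vB : ℝ := (volume (closedBall (0 : E3) 1)).toReal
theorem vB_one : 1 ≤ vB := by
  have := ENNReal.toReal_mono vol_cb1_top vol_cb1
  simpa [vB] using this
theorem vol_cb' (x : E3) {r : ℝ} (hr : 0 ≤ r) :
    volume (closedBall x r) = ENNReal.ofReal (vB * r ^ 3) := by
  rw [vol_cb x hr, mul_comm vB, ENNReal.ofReal_mul (by positivity), vB, ENNReal.ofReal_toReal vol_cb1_top]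

/-- discard the part where `f` is small -/
theorem split_small {f : E3 → ℝ≥0∞} (hf : Measurable f) {B : Set E3} (hB : MeasurableSet B) (b : ℝ≥0∞) :
    ∫⁻ x in B, f x ≤ b * volume B + ∫⁻ x in B, {x | b < f x}.indicator f x := by
  calc ∫⁻ x in B, f x ≤ ∫⁻ x in B, (b + {x | b < f x}.indicator f x) := by
        refine lintegral_mono fun x => ?_
        by_cases h : b < f x
        · simp [indicator, h]
        · exact (not_lt.1 h).trans le_self_add
    _ = _ := by rw [lintegral_add_left measurable_const, setLIntegral_const]

theorem ennabs {X Y a : ℝ≥0∞} (hX : X ≠ ∞) (ha : a * 2 ≤ X) (h : X ≤ a + Y) : X ≤ 2 * Y := by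
  have h1 : a ≠ ∞ := fun h => by simp [h] at ha; exact hX ha
  have h2 : a ≤ Y := by
    have : a + a ≤ a + Y := by rw [← mul_two]; exact ha.trans h
    exact (ENNReal.add_le_add_iff_left h1).1 this
  calc X ≤ a + Y := h
    _ ≤ Y + Y := by gcongr
    _ = 2 * Y := (two_mul Y).symm

theorem good2 {C0 q : ℝ} (hC0 : 1 ≤ C0) (hq : 2 < q) :
    ∃ C : ℝ, 0 ≤ C ∧ ∀ F G : E3 → ℝ, Measurable F → Measurable G → (∀ x, 0 ≤ F x) → (∀ x, 0 ≤ G x) →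
      (∫⁻ x, ENNReal.ofReal (F x ^ 2)) ≠ ∞ → (∫⁻ x, ENNReal.ofReal (G x ^ 2)) ≠ ∞ →
      (∀ (x : E3) (r τ : ℝ), 0 < r → 0 < τ →
        ENNReal.ofReal C0 * ∫⁻ y in closedBall x (2 * r), (ENNReal.ofReal (F y ^ 2) + ENNReal.ofReal (G y ^ 2))
          ≤ ENNReal.ofReal (τ ^ 2 * r ^ 3) →
        ∫⁻ y in {y | τ < F y} ∩ closedBall x r, ENNReal.ofReal (F y ^ 2) ≤
          ENNReal.ofReal C0 * ∫⁻ y in closedBall x (2 * r), ENNReal.ofReal (G y ^ 2)) →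
      ∫⁻ x, ENNReal.ofReal (F x ^ q) ≤ ENNReal.ofReal C * ∫⁻ x, ENNReal.ofReal (G x ^ q) := by
  have hv := vB_one
  set c' : ℝ := √(1 / (4 * vB)) with hc'
  have hc'0 : 0 < c' := Real.sqrt_pos.2 (by positivity)
  have hc'2 : c' ^ 2 = 1 / (4 * vB) := Real.sq_sqrt (by positivity)
  have hc'1 : c' ≤ 1 := by
    rw [hc']; refine Real.sqrt_le_one.2 ?_
    rw [div_le_one (by positivity)]; linarith
  set A : ℝ := 8 * C0 / c' with hA
  have hA1 : 1 ≤ A := by rw [hA, le_div_iff₀ hc'0]; linarith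
  set N : ℝ := 8000 * C0 * A ^ (q - 2) with hN
  have hAq : 1 ≤ A ^ (q - 2) := Real.one_le_rpow hA1 (by linarith)
  have hN1 : 1 ≤ N := by rw [hN]; nlinarith
  obtain ⟨C, hC, H⟩ := goodlam (q := q) (s := 2) (A := A) (κ := 4000 * C0 / N) (c := 1 / √N)
    (C1 := 4000 * C0) hq le_rfl hA1 (by positivity) (by positivity) (by positivity) (by
      rw [mul_div_assoc, div_self (by linarith), mul_one, hN]; field_simp; norm_num)
  refine ⟨C, hC, fun F G hF hG hF0 hG0 hFi hGi hyp => ?_⟩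
  refine (H F G 0 0 hF hG hF0 hG0 le_rfl hFi ?_).trans (by simp)
  intro t' ht'
  set t := t' / c' with ht
  have ht0 : 0 < t := by positivity
  have htt : t' = c' * t := by rw [ht]; field_simp
  set Φ : E3 → ℝ≥0∞ := fun x => ENNReal.ofReal (F x ^ 2) + ENNReal.ofReal (N * G x ^ 2) with hΦ
  have hΦm : Measurable Φ := by fun_prop
  have hΦi : ∫⁻ x, Φ x ≠ ∞ := by
    rw [hΦ, lintegral_add_left (by fun_prop)]
    simp_rw [ENNReal.ofReal_mul (zero_le_one.trans hN1)]
    rw [lintegral_const_mul _ (by fun_prop)]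
    exact ENNReal.add_ne_top.2 ⟨hFi, ENNReal.mul_ne_top ENNReal.ofReal_ne_top hGi⟩
  obtain ⟨u, r, huc, hu, hdis, hcov⟩ := stopping hΦm hΦi (L := t ^ 2) (K := 1) (by positivity) le_rfl
  have hAt : A * t' = 8 * C0 * t := by rw [hA, htt]; field_simp
  have step1 : ∫⁻ x in {x | A * t' < F x}, ENNReal.ofReal (F x ^ 2) ≤
      ENNReal.ofReal (2000 * C0 / N) * ∫⁻ x, {x | ENNReal.ofReal (t ^ 2 / (2 * vB)) < Φ x}.indicator Φ x := by
    refine cover_sum huc (R := fun z => 5 * 1 * r z) (ρ := fun z => 1 * r z) ?_ hdis ?_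
    · filter_upwards [hcov] with x hx hxS
      refine hx ?_
      have hxS : A * t' < F x := hxS
      have h1 : t ^ 2 < F x ^ 2 := by
        have : t < F x := by rw [hAt] at hxS; nlinarith
        nlinarith
      exact lt_of_lt_of_le ((ENNReal.ofReal_lt_ofReal_iff (by nlinarith)).2 h1) le_self_add
    · intro z hz
      obtain ⟨hr, -, hz1, hz2⟩ := hu z hz
      have h10 := hz2 (2 * (5 * 1 * r z)) (by linarith)
      have hGΦ : ∀ y, ENNReal.ofReal (G y ^ 2) ≤ ENNReal.ofReal N⁻¹ * Φ y := by
        intro y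
        rw [hΦ]; simp only
        rw [mul_add, ← ENNReal.ofReal_mul (by positivity), ← ENNReal.ofReal_mul (by positivity),
          inv_mul_cancel_left₀ (by linarith)]
        exact le_add_self
      have h1 := hyp z (5 * 1 * r z) (A * t') (by linarith) (by positivity) (by
        calc _ ≤ ENNReal.ofReal C0 * ∫⁻ y in closedBall z (2 * (5 * 1 * r z)), Φ y := by
              gcongr with y
              refine add_le_add le_rfl (ENNReal.ofReal_le_ofReal ?_)
              nlinarith [sq_nonneg (G y)]
          _ ≤ ENNReal.ofReal C0 * ENNReal.ofReal (t ^ 2 * (2 * (5 * 1 * r z)) ^ 3) := by gcongr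
          _ ≤ _ := by
              rw [← ENNReal.ofReal_mul (by linarith), hAt]
              refine ENNReal.ofReal_le_ofReal ?_
              have : 0 ≤ t ^ 2 * r z ^ 3 := by positivity
              have h2 : C0 * (t ^ 2 * r z ^ 3) ≤ C0 ^ 2 * (t ^ 2 * r z ^ 3) :=
                mul_le_mul_of_nonneg_right (by nlinarith) this
              nlinarith)
      refine h1.trans ?_
      have h3 : ∫⁻ y in closedBall z (1 * r z), Φ y ≤ 2 * ∫⁻ y in closedBall z (1 * r z),
          {x | ENNReal.ofReal (t ^ 2 / (2 * vB)) < Φ x}.indicator Φ y := by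
        refine ennabs (ne_top_of_le_ne_top hΦi (setLIntegral_le_lintegral _ _)) ?_
          (split_small hΦm measurableSet_closedBall _)
        rw [one_mul, vol_cb' _ hr.le, ← ENNReal.ofReal_mul (by positivity), ofR_two]
        refine le_trans (le_of_eq ?_) hz1
        congr 1; field_simp
      calc _ ≤ ENNReal.ofReal C0 * (ENNReal.ofReal N⁻¹ * ∫⁻ y in closedBall z (2 * (5 * 1 * r z)), Φ y) := by
            rw [← lintegral_const_mul _ hΦm]
            gcongr with y
            exact hGΦ y
        _ ≤ ENNReal.ofReal C0 * (ENNReal.ofReal N⁻¹ * ENNReal.ofReal (t ^ 2 * (2 * (5 * 1 * r z)) ^ 3)) := by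
            gcongr
        _ = ENNReal.ofReal (1000 * C0 / N) * ENNReal.ofReal (t ^ 2 * r z ^ 3) := by
            rw [← ENNReal.ofReal_mul (by positivity), ← ENNReal.ofReal_mul (by positivity),
              ← ENNReal.ofReal_mul (by positivity)]
            congr 1; field_simp; ring
        _ ≤ ENNReal.ofReal (1000 * C0 / N) * (2 * ∫⁻ y in closedBall z (1 * r z),
          {x | ENNReal.ofReal (t ^ 2 / (2 * vB)) < Φ x}.indicator Φ y) := by
            gcongr
            exact hz1.trans (by simpa using h3)
        _ = _ := by
            rw [← mul_assoc, ofR_two]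
            congr 2; ring
  have hpt : ∀ x, {x | ENNReal.ofReal (t ^ 2 / (2 * vB)) < Φ x}.indicator Φ x ≤
      2 * {x | 1 * t' < F x}.indicator (fun x => ENNReal.ofReal (F x ^ (2 : ℝ))) x +
      ENNReal.ofReal (2 * N) * {x | 1 / √N * t' < G x}.indicator (fun x => ENNReal.ofReal (G x ^ 2)) x := by
    intro x
    by_cases hx : ENNReal.ofReal (t ^ 2 / (2 * vB)) < Φ x
    swap
    · rw [indicator_of_notMem (by exact hx)]; exact zero_le
    rw [indicator_of_mem (by exact hx)]
    have hΦx : Φ x = ENNReal.ofReal (F x ^ 2 + N * G x ^ 2) := by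
      rw [hΦ, ENNReal.ofReal_add (by positivity) (by positivity)]
    rw [hΦx] at hx ⊢
    have hx' := (ENNReal.ofReal_lt_ofReal_iff_of_nonneg (by positivity)).1 hx
    have ht2 : t' ^ 2 * 2 = t ^ 2 / (2 * vB) := by rw [htt, mul_pow, hc'2]; field_simp; norm_num
    rcases le_total (N * G x ^ 2) (F x ^ 2) with h | h
    · refine le_add_of_le_of_nonneg ?_ zero_le
      rw [indicator_of_mem, two_ofR]
      · refine ENNReal.ofReal_le_ofReal ?_
        norm_num; linarith
      · show 1 * t' < F x
        rw [one_mul]; refine lt_of_pow_lt_pow_left₀ 2 (hF0 x) ?_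
        linarith
    · refine le_add_of_nonneg_of_le zero_le ?_
      rw [indicator_of_mem, ← ENNReal.ofReal_mul (by positivity)]
      · refine ENNReal.ofReal_le_ofReal ?_
        linarith
      · show 1 / √N * t' < G x
        refine lt_of_pow_lt_pow_left₀ 2 (hG0 x) ?_
        rw [mul_pow, div_pow, Real.sq_sqrt (by linarith), one_pow, div_mul_eq_mul_div, one_mul,
          div_lt_iff₀ (by linarith)]
        linarith
  refine step1.trans ?_
  calc _ ≤ ENNReal.ofReal (2000 * C0 / N) * ∫⁻ x,
      (2 * {x | 1 * t' < F x}.indicator (fun x => ENNReal.ofReal (F x ^ (2 : ℝ))) x +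
      ENNReal.ofReal (2 * N) * {x | 1 / √N * t' < G x}.indicator (fun x => ENNReal.ofReal (G x ^ 2)) x) := by
        gcongr with x; exact hpt x
    _ = _ := by
        have m1 : MeasurableSet {x | 1 * t' < F x} := measurableSet_lt measurable_const hF
        have m2 : MeasurableSet {x | 1 / √N * t' < G x} := measurableSet_lt measurable_const hG
        rw [lintegral_add_left ((Measurable.indicator (by fun_prop) m1).const_mul _),
          lintegral_const_mul _ (Measurable.indicator (by fun_prop) m1),
          lintegral_const_mul _ (Measurable.indicator (by fun_prop) m2), lintegral_indicator m1,
          lintegral_indicator m2, mul_add, ← mul_assoc, ← mul_assoc, ← ENNReal.ofReal_mul (by positivity), ofR_two]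
        have hz : (Iic (0 : ℝ)).indicator (fun _ => (0 : ℝ≥0∞)) t' = 0 := by simp
        rw [hz, add_zero, sub_self, Real.rpow_zero]
        congr 3
        · ring
        · field_simp; norm_num
end

section
theorem gehring {C0 : ℝ} (hC0 : 1 ≤ C0) : ∃ p0 : ℝ, 2 < p0 ∧ ∀ q, 2 < q → q < p0 → ∃ C : ℝ, 0 ≤ C ∧
    ∀ (F G : E3 → ℝ) (r0 E : ℝ), Measurable F → Measurable G → (∀ x, 0 ≤ F x) → (∀ x, 0 ≤ G x) →
      0 < r0 → 0 ≤ E → (∫⁻ x, (ENNReal.ofReal (F x ^ 2) + ENNReal.ofReal (G x ^ 2))) ≤ ENNReal.ofReal E →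
      (∀ (x : E3) (r : ℝ), 0 < r → r ≤ r0 → 0 < F x ^ 2 + G x ^ 2 →
        ∫⁻ y in closedBall x r, ENNReal.ofReal (F y ^ 2) ≤ ENNReal.ofReal (C0 * r⁻¹) *
          (∫⁻ y in closedBall x (5 * r), ENNReal.ofReal (F y ^ (3 / 2 : ℝ))) ^ (4 / 3 : ℝ) +
          ENNReal.ofReal C0 * ∫⁻ y in closedBall x (5 * r), ENNReal.ofReal (G y ^ 2)) →
      ∫⁻ x, ENNReal.ofReal (F x ^ q) ≤ ENNReal.ofReal C * (∫⁻ x, ENNReal.ofReal (G x ^ q))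
        + ENNReal.ofReal (C * √(E / r0 ^ 3) ^ (q - 2)) * ENNReal.ofReal E := by
  have hv := vB_one
  set C2 : ℝ := C0 * (125 * (1 + vB)) ^ (1 / 3 : ℝ) + C0 + 1 with hC2
  have hC2' : 1 ≤ C2 := by
    have : 0 ≤ C0 * (125 * (1 + vB)) ^ (1 / 3 : ℝ) := by positivity
    linarith
  set c : ℝ := 1 / (500 * C2 * vB) with hc
  have hc0 : 0 < c := by positivity
  have hc1 : c ≤ 1 := by
    rw [hc, div_le_one (by positivity)]
    nlinarith
  set κ : ℝ := 25 ^ 3 * 2 * C2 * (1 / c) ^ (1 / 2 : ℝ) with hκ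
  have hκ0 : 0 ≤ κ := by positivity
  -- choose p0
  obtain ⟨p0, hp0, hp1⟩ : ∃ p0 : ℝ, 2 < p0 ∧ ∀ q, 2 < q → q < p0 →
      κ * (1 / c) ^ (q - 2) * (q - 2) / (q - 3 / 2) ≤ 1 / 2 := by
    refine ⟨2 + min 1 (1 / (4 * (κ * (1 / c) + 1))), by
      have : 0 < min 1 (1 / (4 * (κ * (1 / c) + 1))) := lt_min one_pos (by positivity)
      linarith, fun q h2 hq => ?_⟩
    have h3 : q - 2 < 1 := by linarith [min_le_left 1 (1 / (4 * (κ * (1 / c) + 1)))]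
    have h4 : q - 2 < 1 / (4 * (κ * (1 / c) + 1)) := by
      linarith [min_le_right 1 (1 / (4 * (κ * (1 / c) + 1)))]
    have h5 : (1 / c) ^ (q - 2) ≤ 1 / c := by
      conv_rhs => rw [← Real.rpow_one (1 / c)]
      exact Real.rpow_le_rpow_of_exponent_le (by rw [le_div_iff₀ hc0]; linarith) h3.le
    rw [div_le_iff₀ (by linarith)]
    rw [lt_div_iff₀ (by positivity)] at h4
    have h6 : κ * (1 / c) ^ (q - 2) * (q - 2) ≤ κ * (1 / c) * (q - 2) := by
      apply mul_le_mul_of_nonneg_right _ (by linarith)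
      exact mul_le_mul_of_nonneg_left h5 hκ0
    nlinarith
  refine ⟨p0, hp0, fun q hq2 hqp => ?_⟩
  obtain ⟨C, hC, H⟩ := goodlam (q := q) (s := 3 / 2) (A := 1 / c) (κ := κ) (c := 1)
    (C1 := 25 ^ 3 * 2 * C2) hq2 (by norm_num) (by rw [le_div_iff₀ hc0]; linarith) hκ0 one_pos
    (by positivity) (hp1 q hq2 hqp)
  refine ⟨C, hC, fun F G r0 E hF hG hF0 hG0 hr0 hE hEi hyp => ?_⟩
  have hFE : ∫⁻ x, ENNReal.ofReal (F x ^ 2) ≤ ENNReal.ofReal E :=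
    (lintegral_mono fun x => le_self_add).trans hEi
  set Φ : E3 → ℝ≥0∞ := fun x => ENNReal.ofReal (F x ^ 2) + ENNReal.ofReal (G x ^ 2) with hΦ
  have hΦm : Measurable Φ := by fun_prop
  have hΦi : ∫⁻ x, Φ x ≠ ∞ := ne_top_of_le_ne_top ENNReal.ofReal_ne_top hEi
  refine (H F G (√(E / r0 ^ 3)) (ENNReal.ofReal E) hF hG hF0 hG0 (Real.sqrt_nonneg _)
    (ne_top_of_le_ne_top ENNReal.ofReal_ne_top hFE) ?_)
  intro t' ht'
  by_cases hsm : t' ≤ √(E / r0 ^ 3)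
  · rw [indicator_of_mem (by exact hsm)]
    exact le_add_of_nonneg_of_le zero_le ((setLIntegral_le_lintegral _ _).trans hFE)
  rw [indicator_of_notMem (by exact hsm), add_zero]
  push Not at hsm
  set t := t' / c with ht
  have ht0 : 0 < t := by positivity
  have htt : t' = c * t := by rw [ht]; field_simp
  have hAt : 1 / c * t' = t := by rw [ht]; field_simp
  have htE : E / r0 ^ 3 ≤ t ^ 2 := by
    have h1 := (Real.sqrt_lt' ht').1 hsm
    have h2 : t' ≤ t := by rw [htt]; nlinarith
    nlinarith
  have hFpos : ∀ y, 0 ≤ F y ^ (3 / 2 : ℝ) := fun y => Real.rpow_nonneg (hF0 y) _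
  obtain ⟨u, r, huc, hu, hdis, hcov⟩ := stopping hΦm hΦi (L := t ^ 2) (K := 5) (by positivity) (by norm_num)
  set g : E3 → ℝ≥0∞ := fun x => ENNReal.ofReal (t ^ (1 / 2 : ℝ)) *
    {x | 1 * t' < F x}.indicator (fun x => ENNReal.ofReal (F x ^ (3 / 2 : ℝ))) x +
    {x | 1 * t' < G x}.indicator (fun x => ENNReal.ofReal (G x ^ 2)) x with hg
  have m1 : MeasurableSet {x | 1 * t' < F x} := measurableSet_lt measurable_const hF
  have m2 : MeasurableSet {x | 1 * t' < G x} := measurableSet_lt measurable_const hG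
  have mg1 : Measurable ({x | 1 * t' < F x}.indicator (fun x => ENNReal.ofReal (F x ^ (3 / 2 : ℝ)))) :=
    Measurable.indicator (by fun_prop) m1
  have mg2 : Measurable ({x | 1 * t' < G x}.indicator (fun x => ENNReal.ofReal (G x ^ 2))) :=
    Measurable.indicator (by fun_prop) m2
  have hgi : ∫⁻ x, g x = ENNReal.ofReal (t ^ (1 / 2 : ℝ)) * (∫⁻ x in {x | 1 * t' < F x}, ENNReal.ofReal (F x ^ (3 / 2 : ℝ)))
      + ∫⁻ x in {x | 1 * t' < G x}, ENNReal.ofReal (G x ^ 2) := by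
    rw [hg, lintegral_add_left (mg1.const_mul _), lintegral_const_mul _ mg1, lintegral_indicator m1,
      lintegral_indicator m2]
  have step : ∫⁻ x in {x | 1 / c * t' < F x}, ENNReal.ofReal (F x ^ 2) ≤
      ENNReal.ofReal (25 ^ 3 * 2 * C2) * ∫⁻ x, g x := by
    refine cover_sum huc (R := fun z => 5 * 5 * r z) (ρ := fun z => 5 * r z) ?_ hdis ?_
    · filter_upwards [hcov] with x hx hxS
      refine hx ?_
      have hxS : 1 / c * t' < F x := hxS
      rw [hAt] at hxS
      exact lt_of_lt_of_le ((ENNReal.ofReal_lt_ofReal_iff (by nlinarith)).2 (by nlinarith)) le_self_add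
    · intro z hz
      obtain ⟨hr, hzp, hz1, hz2⟩ := hu z hz
      have hrr : r z ≤ r0 := by
        have h1 : t ^ 2 * r z ^ 3 ≤ E :=
          (ENNReal.ofReal_le_ofReal_iff hE).1 (hz1.trans ((setLIntegral_le_lintegral _ _).trans hEi))
        have h2 : E ≤ t ^ 2 * r0 ^ 3 := by rwa [div_le_iff₀ (by positivity)] at htE
        have h3 : r z ^ 3 ≤ r0 ^ 3 := le_of_mul_le_mul_left (h1.trans h2) (by positivity)
        exact le_of_pow_le_pow_left₀ (by norm_num) hr0.le h3
      have hpos : 0 < F z ^ 2 + G z ^ 2 := by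
        rw [hΦ] at hzp; simp only at hzp
        rw [← ENNReal.ofReal_add (by positivity) (by positivity)] at hzp
        exact ENNReal.ofReal_pos.1 (lt_of_le_of_lt zero_le hzp)
      have h0 := hyp z (r z) hr hrr hpos
      set B := closedBall z (5 * r z) with hB
      have hBv : volume B = ENNReal.ofReal (125 * vB * r z ^ 3) := by
        rw [hB, vol_cb' _ (by positivity)]; congr 1; ring
      set W := ∫⁻ y in B, ENNReal.ofReal (F y ^ (3 / 2 : ℝ)) with hW
      have h5 : ∫⁻ y in B, ENNReal.ofReal (F y ^ 2) ≤ ENNReal.ofReal (125 * t ^ 2 * r z ^ 3) := by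
        refine (lintegral_mono fun x => le_self_add).trans ((hz2 (5 * r z) (by linarith)).trans (le_of_eq ?_))
        congr 1; ring
      have hthalf : t ^ (-(1 / 2) : ℝ) * t ^ 2 = t ^ (3 / 2 : ℝ) := by
        rw [← Real.rpow_natCast, ← Real.rpow_add ht0]; norm_num
      have hW1 : W ≤ ENNReal.ofReal (125 * (1 + vB) * t ^ (3 / 2 : ℝ) * r z ^ 3) := by
        calc W ≤ ∫⁻ y in B, (ENNReal.ofReal (t ^ (-(1 / 2) : ℝ)) * ENNReal.ofReal (F y ^ 2) +
              ENNReal.ofReal (t ^ (3 / 2 : ℝ))) := by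
              refine lintegral_mono fun y => ?_
              rcases le_total (F y) t with h | h
              · exact le_add_of_nonneg_of_le zero_le (ENNReal.ofReal_le_ofReal
                  (Real.rpow_le_rpow (hF0 y) h (by norm_num)))
              · refine le_add_of_le_of_nonneg ?_ zero_le
                rw [← ENNReal.ofReal_mul (by positivity)]
                refine ENNReal.ofReal_le_ofReal ?_
                have hFy : 0 < F y := ht0.trans_le h
                have : F y ^ (3 / 2 : ℝ) = F y ^ (-(1 / 2) : ℝ) * F y ^ 2 := by
                  rw [← Real.rpow_natCast, ← Real.rpow_add hFy]; norm_num
                rw [this]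
                refine mul_le_mul_of_nonneg_right ?_ (by positivity)
                exact Real.rpow_le_rpow_of_nonpos ht0 h (by norm_num)
          _ = ENNReal.ofReal (t ^ (-(1 / 2) : ℝ)) * (∫⁻ y in B, ENNReal.ofReal (F y ^ 2)) +
              ENNReal.ofReal (t ^ (3 / 2 : ℝ)) * volume B := by
              rw [lintegral_add_right _ measurable_const, lintegral_const_mul _ (by fun_prop), setLIntegral_const]
          _ ≤ ENNReal.ofReal (t ^ (-(1 / 2) : ℝ)) * ENNReal.ofReal (125 * t ^ 2 * r z ^ 3) +
              ENNReal.ofReal (t ^ (3 / 2 : ℝ)) * ENNReal.ofReal (125 * vB * r z ^ 3) := by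
              rw [hBv]; gcongr
          _ = _ := by
              rw [← ENNReal.ofReal_mul (by positivity), ← ENNReal.ofReal_mul (by positivity),
                ← ENNReal.ofReal_add (by positivity) (by positivity)]
              congr 1
              linear_combination (125 * r z ^ 3) * hthalf
      have hW2 : ENNReal.ofReal (C0 * (r z)⁻¹) * W ^ (4 / 3 : ℝ) ≤
          ENNReal.ofReal (C0 * (125 * (1 + vB)) ^ (1 / 3 : ℝ) * t ^ (1 / 2 : ℝ)) * W := by
        have e1 : W ^ (4 / 3 : ℝ) = W ^ (1 / 3 : ℝ) * W := by
          conv_rhs => rw [← ENNReal.rpow_one W, ← ENNReal.rpow_mul]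
          rw [← ENNReal.rpow_add_of_nonneg _ _ (by norm_num) (by norm_num)]; norm_num
        rw [e1, ← mul_assoc]
        refine mul_le_mul_left ?_ _
        have e2 : W ^ (1 / 3 : ℝ) ≤ ENNReal.ofReal ((125 * (1 + vB)) ^ (1 / 3 : ℝ) * t ^ (1 / 2 : ℝ) * r z) := by
          refine (ENNReal.rpow_le_rpow hW1 (by norm_num)).trans (le_of_eq ?_)
          rw [ENNReal.ofReal_rpow_of_nonneg (by positivity) (by norm_num)]
          congr 1
          rw [Real.mul_rpow (by positivity) (by positivity), Real.mul_rpow (by positivity) (by positivity),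
            ← Real.rpow_mul ht0.le, ← Real.rpow_natCast (r z), ← Real.rpow_mul hr.le]
          norm_num
        refine (mul_le_mul_right e2 _).trans (le_of_eq ?_)
        rw [← ENNReal.ofReal_mul (by positivity)]
        congr 1; field_simp
      have hG1 : ∫⁻ y in B, Φ y ≠ ∞ := ne_top_of_le_ne_top hΦi (setLIntegral_le_lintegral _ _)
      have hX : ENNReal.ofReal (t ^ 2 * r z ^ 3) ≤ ENNReal.ofReal C2 *
          (ENNReal.ofReal (t ^ (1 / 2 : ℝ)) * W + ∫⁻ y in B, ENNReal.ofReal (G y ^ 2)) := by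
        calc _ ≤ ∫⁻ y in closedBall z (r z), Φ y := hz1
          _ = (∫⁻ y in closedBall z (r z), ENNReal.ofReal (F y ^ 2)) +
              ∫⁻ y in closedBall z (r z), ENNReal.ofReal (G y ^ 2) := lintegral_add_left (by fun_prop) _
          _ ≤ (ENNReal.ofReal (C0 * (125 * (1 + vB)) ^ (1 / 3 : ℝ) * t ^ (1 / 2 : ℝ)) * W +
              ENNReal.ofReal C0 * ∫⁻ y in B, ENNReal.ofReal (G y ^ 2)) +
              ENNReal.ofReal 1 * ∫⁻ y in B, ENNReal.ofReal (G y ^ 2) := by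
              rw [ENNReal.ofReal_one, one_mul]
              refine add_le_add (h0.trans (add_le_add hW2 le_rfl)) (lintegral_mono_set ?_)
              exact closedBall_subset_closedBall (by linarith)
          _ ≤ _ := by
              rw [mul_add (ENNReal.ofReal C2), ← mul_assoc, ← ENNReal.ofReal_mul (by positivity), add_assoc, ← add_mul,
                ← ENNReal.ofReal_add (by positivity) (by positivity)]
              refine add_le_add (mul_le_mul_left (ENNReal.ofReal_le_ofReal ?_) _)
                (mul_le_mul_left (ENNReal.ofReal_le_ofReal ?_) _)
              · exact mul_le_mul_of_nonneg_right (by linarith) (by positivity)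
              · have : 0 ≤ C0 * (125 * (1 + vB)) ^ (1 / 3 : ℝ) := by positivity
                linarith
      have hpt1 : ∀ y, ENNReal.ofReal (t ^ (1 / 2 : ℝ)) * ENNReal.ofReal (F y ^ (3 / 2 : ℝ)) +
          ENNReal.ofReal (G y ^ 2) ≤ ENNReal.ofReal (2 * c * t ^ 2) + g y := by
        intro y
        have a1 : ENNReal.ofReal (t ^ (1 / 2 : ℝ)) * ENNReal.ofReal (F y ^ (3 / 2 : ℝ)) ≤
            ENNReal.ofReal (c * t ^ 2) + ENNReal.ofReal (t ^ (1 / 2 : ℝ)) *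
            {x | 1 * t' < F x}.indicator (fun x => ENNReal.ofReal (F x ^ (3 / 2 : ℝ))) y := by
          by_cases h : 1 * t' < F y
          · rw [indicator_of_mem (by exact h)]; exact le_add_self
          · refine le_add_of_le_of_nonneg ?_ zero_le
            rw [← ENNReal.ofReal_mul (by positivity)]
            refine ENNReal.ofReal_le_ofReal ?_
            rw [not_lt, one_mul, htt] at h
            calc t ^ (1 / 2 : ℝ) * F y ^ (3 / 2 : ℝ) ≤ t ^ (1 / 2 : ℝ) * (c * t) ^ (3 / 2 : ℝ) := by
                  gcongr; exact hF0 y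
              _ = c ^ (3 / 2 : ℝ) * t ^ 2 := by
                  rw [Real.mul_rpow hc0.le ht0.le, mul_left_comm, ← Real.rpow_add ht0]; norm_num
              _ ≤ c ^ (1 : ℝ) * t ^ 2 := by
                  refine mul_le_mul_of_nonneg_right ?_ (by positivity)
                  exact Real.rpow_le_rpow_of_exponent_ge hc0 hc1 (by norm_num)
              _ = _ := by rw [Real.rpow_one]
        have a2 : ENNReal.ofReal (G y ^ 2) ≤ ENNReal.ofReal (c * t ^ 2) +
            {x | 1 * t' < G x}.indicator (fun x => ENNReal.ofReal (G x ^ 2)) y := by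
          by_cases h : 1 * t' < G y
          · rw [indicator_of_mem (by exact h)]; exact le_add_self
          · refine le_add_of_le_of_nonneg (ENNReal.ofReal_le_ofReal ?_) zero_le
            rw [not_lt, one_mul, htt] at h
            calc G y ^ 2 ≤ (c * t) ^ 2 := by gcongr; exact hG0 y
              _ = c * c * t ^ 2 := by ring
              _ ≤ _ := by gcongr; nlinarith
        refine (add_le_add a1 a2).trans (le_of_eq ?_)
        rw [hg]; simp only
        rw [add_add_add_comm, ← ENNReal.ofReal_add (by positivity) (by positivity)]
        congr 2; ring
      have hX2 : ENNReal.ofReal (t ^ 2 * r z ^ 3) ≤ 2 * (ENNReal.ofReal C2 * ∫⁻ y in B, g y) := by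
        refine ennabs ENNReal.ofReal_ne_top (a := ENNReal.ofReal C2 * (ENNReal.ofReal (2 * c * t ^ 2) * volume B)) ?_
          (hX.trans ?_)
        · rw [hBv, ← ENNReal.ofReal_mul (by positivity), ← ENNReal.ofReal_mul (by positivity), ofR_two]
          refine ENNReal.ofReal_le_ofReal (le_of_eq ?_)
          rw [hc]; field_simp; norm_num
        · rw [← mul_add]
          refine mul_le_mul_right ?_ _
          rw [hW, ← lintegral_const_mul _ (by fun_prop), ← lintegral_add_left (by fun_prop),
            ← setLIntegral_const, ← lintegral_add_left measurable_const]
          exact lintegral_mono hpt1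
      calc ∫⁻ x in {x | 1 / c * t' < F x} ∩ closedBall z (5 * 5 * r z), ENNReal.ofReal (F x ^ 2)
          ≤ ∫⁻ x in closedBall z (5 * 5 * r z), Φ x :=
            (lintegral_mono_set inter_subset_right).trans (lintegral_mono fun x => le_self_add)
        _ ≤ ENNReal.ofReal (t ^ 2 * (5 * 5 * r z) ^ 3) := hz2 _ (by linarith)
        _ = ENNReal.ofReal (25 ^ 3) * ENNReal.ofReal (t ^ 2 * r z ^ 3) := by
            rw [← ENNReal.ofReal_mul (by positivity)]; congr 1; ring
        _ ≤ ENNReal.ofReal (25 ^ 3) * (2 * (ENNReal.ofReal C2 * ∫⁻ y in B, g y)) := by gcongr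
        _ = _ := by
            rw [← mul_assoc, ← mul_assoc, ofR_two, ← ENNReal.ofReal_mul (by positivity)]
  refine step.trans (le_of_eq ?_)
  rw [hgi, mul_add, ← mul_assoc, ← ENNReal.ofReal_mul (by positivity)]
  congr 3
  rw [hκ, htt, show (2 : ℝ) - 3 / 2 = 1 / 2 by norm_num, Real.mul_rpow hc0.le ht0.le,
    Real.div_rpow zero_le_one hc0.le, Real.one_rpow]
  have : c ^ (1 / 2 : ℝ) ≠ 0 := by positivity
  field_simp
end

section
theorem pack {τ : Type} (T : Finset τ) (w : τ → E3) {S : Set E3} (hS : MeasurableSet S) {R ρ : ℝ}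
    (hR : S ⊆ closedBall 0 R) (hw : ∀ t ∈ T, ‖w t‖ ≤ ρ)
    (hd : ∀ t ∈ T, ∀ t' ∈ T, ∀ x, x - w t ∈ S → x - w t' ∈ S → t = t') :
    (T.card : ℝ≥0∞) * volume S ≤ volume (closedBall (0 : E3) (R + ρ)) := by
  have h1 : volume (⋃ t ∈ T, (fun x => x - w t) ⁻¹' S) = ∑ t ∈ T, volume ((fun x => x - w t) ⁻¹' S) := by
    refine measure_biUnion_finset ?_ fun t _ => hS.preimage (by fun_prop)
    intro t ht t' ht' hne
    rw [Function.onFun, Set.disjoint_left]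
    intro x hx hx'
    exact hne (hd t ht t' ht' x hx hx')
  have h2 : ∀ t ∈ T, volume ((fun x => x - w t) ⁻¹' S) = volume S := fun t _ => by
    simpa [sub_eq_add_neg] using measure_preimage_add_right volume (-w t) S
  rw [Finset.sum_congr rfl h2, Finset.sum_const, nsmul_eq_mul] at h1
  rw [← h1]
  apply measure_mono
  refine iUnion₂_subset fun t ht x hx => ?_
  have h3 := hR hx
  rw [mem_closedBall_zero_iff] at h3 ⊢
  calc ‖x‖ = ‖(x - w t) + w t‖ := by simp
    _ ≤ _ := (norm_add_le _ _).trans (add_le_add h3 (hw t ht))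

theorem pack_div {N : ℕ} {ε V : ℝ} {v : ℝ≥0∞} (hε : 0 < ε) (hN : 1 ≤ ε * N) (h : (N : ℝ≥0∞) * v ≤ ENNReal.ofReal V) :
    v ≤ ENNReal.ofReal (V * ε) := by
  have : ENNReal.ofReal ε * (N * v) ≤ ENNReal.ofReal ε * ENNReal.ofReal V := by gcongr
  rw [← ENNReal.ofReal_mul hε.le, ← mul_assoc, ← ENNReal.ofReal_natCast, ← ENNReal.ofReal_mul hε.le] at this
  rw [mul_comm V]
  refine le_trans ?_ this
  conv_lhs => rw [← one_mul v]
  gcongr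
  rw [ENNReal.one_le_ofReal]; exact hN

theorem int_eq_of_near {ε : ℝ} (hε : 0 < ε) {k l : ℕ} (h : |ε * k - ε * l| < ε) : k = l := by
  rw [← mul_sub, abs_mul, abs_of_pos hε] at h
  have h1 : |(k : ℝ) - l| < 1 := by
    by_contra hc; push Not at hc
    nlinarith
  have h2 : |(k : ℤ) - l| < 1 := by exact_mod_cast h1
  rw [Int.abs_lt_one_iff] at h2
  omega

theorem fl_spec {ε : ℝ} (hε : 0 < ε) : 1 ≤ ε * ((⌊1 / ε⌋₊ + 1 : ℕ) : ℝ) ∧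
    ∀ k < ⌊1 / ε⌋₊ + 1, ε * (k : ℝ) ≤ 1 := by
  constructor
  · have := Nat.lt_floor_add_one (1 / ε)
    push_cast
    rw [div_lt_iff₀ hε] at this
    linarith
  · intro k hk
    have h1 : (k : ℝ) ≤ ⌊1 / ε⌋₊ := by exact_mod_cast Nat.lt_succ_iff.1 hk
    have h2 := Nat.floor_le (one_div_pos.2 hε).le
    have h3 := h1.trans h2
    rw [le_div_iff₀ hε] at h3
    linarith

theorem ci (n : E3) : Continuous fun x : E3 => ⟪n, x⟫ := continuous_const.inner continuous_id

theorem vol_slab (R : ℝ) : ∃ C : ℝ, 0 ≤ C ∧ ∀ (n : E3) (c ε : ℝ), ‖n‖ = 1 → 0 < ε →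
    volume (closedBall 0 R ∩ {x : E3 | c < ⟪n, x⟫ ∧ ⟪n, x⟫ < c + ε}) ≤ ENNReal.ofReal (C * ε) := by
  refine ⟨(volume (closedBall (0 : E3) (R + 1))).toReal, ENNReal.toReal_nonneg, fun n c ε hn hε => ?_⟩
  obtain ⟨f1, f2⟩ := fl_spec hε
  refine pack_div hε f1 ?_
  rw [ENNReal.ofReal_toReal measure_closedBall_lt_top.ne]
  have hm : MeasurableSet (closedBall 0 R ∩ {x : E3 | c < ⟪n, x⟫ ∧ ⟪n, x⟫ < c + ε}) := by
    refine measurableSet_closedBall.inter (IsOpen.measurableSet ?_)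
    exact (isOpen_lt continuous_const (ci n)).inter (isOpen_lt (ci n) continuous_const)
  have := pack (Finset.range (⌊1 / ε⌋₊ + 1)) (fun k => (ε * (k : ℝ)) • n) hm inter_subset_left
    (ρ := 1) (fun k hk => by
      rw [norm_smul, hn, mul_one, Real.norm_eq_abs, abs_of_nonneg (by positivity)]
      exact f2 k (Finset.mem_range.1 hk)) (fun k _ l _ x hx hy => by
      have h1 := hx.2
      have h2 := hy.2
      simp only [Set.mem_ofPred_eq, inner_sub_right, inner_smul_right, real_inner_self_eq_norm_sq, hn] at h1 h2
      refine int_eq_of_near hε ?_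
      rw [abs_lt]
      constructor <;> nlinarith)
  simpa using this

theorem dual_vec {m n : E3} (hm : ‖m‖ = 1) (hn : ‖n‖ = 1) (h : LinearIndependent ℝ ![m, n]) :
    ∃ a : E3, ⟪m, a⟫ = 1 ∧ ⟪n, a⟫ = 0 := by
  have hg : 1 - ⟪m, n⟫ ^ 2 ≠ 0 := by
    intro h0
    have h1 : ‖m - ⟪m, n⟫ • n‖ ^ 2 = 0 := by
      rw [norm_sub_sq_real, norm_smul, inner_smul_right, hm, hn, Real.norm_eq_abs, mul_one, sq_abs]
      linarith
    have h2 : m - ⟪m, n⟫ • n = 0 := by simpa using h1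
    have h3 := LinearIndependent.pair_iff.1 h 1 (-⟪m, n⟫) (by rw [one_smul, neg_smul, ← sub_eq_add_neg, h2])
    exact one_ne_zero h3.1
  refine ⟨(1 - ⟪m, n⟫ ^ 2)⁻¹ • (m - ⟪m, n⟫ • n), ?_, ?_⟩
  · rw [inner_smul_right, inner_sub_right, inner_smul_right, real_inner_self_eq_norm_sq, hm]
    field_simp
  · rw [inner_smul_right, inner_sub_right, inner_smul_right, real_inner_self_eq_norm_sq, hn, real_inner_comm]
    ring

theorem vol_pair (R : ℝ) {m n : E3} (hm : ‖m‖ = 1) (hn : ‖n‖ = 1) (h : LinearIndependent ℝ ![m, n]) :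
    ∃ C : ℝ, 0 ≤ C ∧ ∀ (c d ε : ℝ), 0 < ε →
    volume (closedBall 0 R ∩ {x : E3 | c < ⟪m, x⟫ ∧ d < ⟪n, x⟫ ∧ ⟪m, x⟫ - c + (⟪n, x⟫ - d) < ε})
      ≤ ENNReal.ofReal (C * ε ^ 2) := by
  obtain ⟨a, ha1, ha2⟩ := dual_vec hm hn h
  have hsw : LinearIndependent ℝ ![n, m] := by
    rw [LinearIndependent.pair_iff] at h ⊢
    intro s t hst
    exact (h t s (by rw [add_comm]; exact hst)).symm
  obtain ⟨b, hb1, hb2⟩ := dual_vec hn hm hsw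
  refine ⟨(volume (closedBall (0 : E3) (R + (‖a‖ + ‖b‖)))).toReal, ENNReal.toReal_nonneg, fun c d ε hε => ?_⟩
  obtain ⟨f1, f2⟩ := fl_spec hε
  have f3 : 1 ≤ ε ^ 2 * (((⌊1 / ε⌋₊ + 1) * (⌊1 / ε⌋₊ + 1) : ℕ) : ℝ) := by
    rw [Nat.cast_mul]; nlinarith
  refine pack_div (by positivity) f3 ?_
  rw [ENNReal.ofReal_toReal measure_closedBall_lt_top.ne]
  have hms : MeasurableSet (closedBall 0 R ∩ {x : E3 | c < ⟪m, x⟫ ∧ d < ⟪n, x⟫ ∧ ⟪m, x⟫ - c + (⟪n, x⟫ - d) < ε}) := by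
    refine measurableSet_closedBall.inter (IsOpen.measurableSet ?_)
    exact (isOpen_lt continuous_const (ci m)).inter ((isOpen_lt continuous_const (ci n)).inter
      (isOpen_lt (((ci m).sub continuous_const).add ((ci n).sub continuous_const)) continuous_const))
  have := pack (Finset.range (⌊1 / ε⌋₊ + 1) ×ˢ Finset.range (⌊1 / ε⌋₊ + 1))
    (fun k => (ε * (k.1 : ℝ)) • a + (ε * (k.2 : ℝ)) • b) hms inter_subset_left
    (ρ := ‖a‖ + ‖b‖) (fun k hk => by
      rw [Finset.mem_product, Finset.mem_range, Finset.mem_range] at hk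
      refine (norm_add_le _ _).trans ?_
      rw [norm_smul, norm_smul, Real.norm_eq_abs, Real.norm_eq_abs, abs_of_nonneg (by positivity), abs_of_nonneg (by positivity)]
      exact add_le_add (mul_le_of_le_one_left (norm_nonneg _) (f2 _ hk.1))
        (mul_le_of_le_one_left (norm_nonneg _) (f2 _ hk.2))) (fun k _ l _ x hx hy => by
      have h1 := hx.2
      have h2 := hy.2
      simp only [Set.mem_ofPred_eq, inner_sub_right, inner_add_right, inner_smul_right, ha1, ha2, hb1, hb2] at h1 h2
      refine Prod.ext (int_eq_of_near hε ?_) (int_eq_of_near hε ?_)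
      · rw [abs_lt]
        constructor <;> nlinarith
      · rw [abs_lt]
        constructor <;> nlinarith)
  simpa using this
end

section
theorem dq_tendsto {G B : E3 → ℝ} (hG : Continuous G) (hGc : HasCompactSupport G)
    (hB : ContDiff ℝ 1 B) (hBc : HasCompactSupport B) (b : E3) :
    Filter.Tendsto (fun h : ℝ => ∫ x, G x * (h⁻¹ * (B (x + h • b) - B x)))
      (nhdsWithin 0 {0}ᶜ) (nhds (∫ x, G x * fderiv ℝ B x b)) := by
  obtain ⟨L, hL⟩ := hB.lipschitzWith_of_hasCompactSupport hBc (by norm_num)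
  apply MeasureTheory.tendsto_integral_filter_of_dominated_convergence (fun x => |G x| * (L * ‖b‖))
  · refine Filter.Eventually.of_forall fun h => Continuous.aestronglyMeasurable ?_
    have := hB.continuous
    fun_prop
  · filter_upwards [self_mem_nhdsWithin] with h hh
    have hh : h ≠ 0 := hh
    refine Filter.Eventually.of_forall fun x => ?_
    rw [norm_mul, Real.norm_eq_abs]
    refine mul_le_mul_of_nonneg_left ?_ (abs_nonneg _)
    rw [norm_mul, norm_inv]
    have h1 := hL.dist_le_mul (x + h • b) x
    rw [dist_eq_norm, dist_eq_norm, add_sub_cancel_left, norm_smul] at h1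
    have h2 : 0 < ‖h‖ := norm_pos_iff.2 hh
    rw [inv_mul_le_iff₀ h2]
    linarith
  · exact (hG.abs.integrable_of_hasCompactSupport hGc.abs).mul_const _
  · refine Filter.Eventually.of_forall fun x => ?_
    refine Filter.Tendsto.const_mul _ ?_
    have h1 : HasFDerivAt B (fderiv ℝ B x) x := (hB.differentiable (by norm_num) x).hasFDerivAt
    have h2 := (h1.hasLineDerivAt b).tendsto_slope_zero
    simpa [smul_eq_mul] using h2

theorem swap_der {A B : E3 → ℝ} (hA : ContDiff ℝ 1 A) (hAc : HasCompactSupport A)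
    (hB : ContDiff ℝ 1 B) (hBc : HasCompactSupport B) (a b : E3) :
    ∫ x, fderiv ℝ A x a * fderiv ℝ B x b = ∫ x, fderiv ℝ A x b * fderiv ℝ B x a := by
  have cA : Continuous fun x => fderiv ℝ A x a := (hA.continuous_fderiv (by norm_num)).clm_apply continuous_const
  have cB : Continuous fun x => fderiv ℝ B x a := (hB.continuous_fderiv (by norm_num)).clm_apply continuous_const
  have sA : HasCompactSupport fun x => fderiv ℝ A x a := hAc.fderiv_apply ℝ a
  have sB : HasCompactSupport fun x => fderiv ℝ B x a := hBc.fderiv_apply ℝ a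
  have t1 := dq_tendsto cA sA hB hBc b
  have t2 := dq_tendsto cB sB hA hAc (-b)
  have key : ∀ h : ℝ, ∫ x, fderiv ℝ A x a * (h⁻¹ * (B (x + h • b) - B x))
      = - ∫ x, fderiv ℝ B x a * (h⁻¹ * (A (x + h • (-b)) - A x)) := by
    intro h
    have hBh : ContDiff ℝ 1 fun x => B (x + h • b) := hB.comp (by fun_prop)
    have sBh : HasCompactSupport fun x => B (x + h • b) := hBc.comp_homeomorph (Homeomorph.addRight (h • b))
    have ibp : ∀ {B' : E3 → ℝ}, ContDiff ℝ 1 B' → HasCompactSupport B' →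
        ∫ x, fderiv ℝ A x a * B' x = - ∫ x, A x * fderiv ℝ B' x a := by
      intro B' hB' hB'c
      have cB' : Continuous fun x => fderiv ℝ B' x a := (hB'.continuous_fderiv (by norm_num)).clm_apply continuous_const
      have := integral_mul_fderiv_eq_neg_fderiv_mul_of_integrable (μ := volume) (f := A) (g := B') (v := a)
        ((cA.mul hB'.continuous).integrable_of_hasCompactSupport sA.mul_right)
        ((hA.continuous.mul cB').integrable_of_hasCompactSupport hAc.mul_right)
        ((hA.continuous.mul hB'.continuous).integrable_of_hasCompactSupport hAc.mul_right)
        (fun x _ => hA.differentiable (by norm_num) x) (fun x _ => hB'.differentiable (by norm_num) x)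
      rw [this, neg_neg]
    have e1 := ibp hBh sBh
    have e2 := ibp hB hBc
    have e3 : ∫ x, A x * fderiv ℝ (fun x => B (x + h • b)) x a = ∫ x, A (x + h • (-b)) * fderiv ℝ B x a := by
      rw [← integral_add_right_eq_self (fun x => A (x + h • (-b)) * fderiv ℝ B x a) (h • b)]
      congr 1; ext x
      rw [fderiv_comp_add_right]
      congr 2; simp
    have i1 : Integrable fun x => fderiv ℝ A x a * B (x + h • b) :=
      (cA.mul hBh.continuous).integrable_of_hasCompactSupport sA.mul_right
    have i2 : Integrable fun x => fderiv ℝ A x a * B x :=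
      (cA.mul hB.continuous).integrable_of_hasCompactSupport sA.mul_right
    have hAh : Continuous fun x => A (x + h • (-b)) := hA.continuous.comp (by fun_prop)
    have i3 : Integrable fun x => A (x + h • (-b)) * fderiv ℝ B x a :=
      (hAh.mul cB).integrable_of_hasCompactSupport sB.mul_left
    have i4 : Integrable fun x => A x * fderiv ℝ B x a :=
      (hA.continuous.mul cB).integrable_of_hasCompactSupport hAc.mul_right
    have l1 : (fun x => fderiv ℝ A x a * (h⁻¹ * (B (x + h • b) - B x))) =
      fun x => h⁻¹ * (fderiv ℝ A x a * B (x + h • b) - fderiv ℝ A x a * B x) := by ext x; ring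
    have l2 : (fun x => fderiv ℝ B x a * (h⁻¹ * (A (x + h • (-b)) - A x))) =
      fun x => h⁻¹ * (A (x + h • (-b)) * fderiv ℝ B x a - A x * fderiv ℝ B x a) := by ext x; ring
    rw [l1, l2, integral_const_mul, integral_const_mul, integral_sub i1 i2, integral_sub i3 i4, e1, e2, e3]
    ring
  have t3 := t1.congr key
  have t4 := tendsto_nhds_unique t3 t2.neg
  rw [t4, ← integral_neg]
  congr 1; ext x; simp [mul_comm]
end

section
abbrev ee (i : Fin 3) : E3 := EuclideanSpace.single i 1
abbrev BL : Type := E3 →L[ℝ] E3 →L[ℝ] ℝ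
def trc (M : BL) : ℝ := ∑ i, M (ee i) (ee i)
def hs2 (M : BL) : ℝ := ∑ i, ∑ j, (M (ee i) (ee j)) ^ 2
def XX (M : BL) (d : E3 →L[ℝ] ℝ) (w : E3) : ℝ := trc M * d w - ∑ j, M w (ee j) * d (ee j)

/-- gradient-like field with its derivative -/
structure CF (Ω : Set E3) (D : E3 → E3 →L[ℝ] ℝ) (D2 : E3 → BL) : Prop where
  c1 : ContinuousOn D (closure Ω)
  c2 : ContinuousOn D2 (closure Ω)
  der : ∀ x ∈ closure Ω, HasFDerivWithinAt D (D2 x) (closure Ω) x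
  symm : ∀ x ∈ closure Ω, ∀ a b, D2 x a b = D2 x b a

theorem CF.at {Ω : Set E3} (ho : IsOpen Ω) {D : E3 → E3 →L[ℝ] ℝ} {D2 : E3 → BL} (h : CF Ω D D2) {x : E3}
    (hx : x ∈ Ω) : HasFDerivAt D (D2 x) x :=
  (h.der x (subset_closure hx)).hasFDerivAt (Filter.mem_of_superset (ho.mem_nhds hx) subset_closure)

theorem CF.cd {Ω : Set E3} (ho : IsOpen Ω) {D : E3 → E3 →L[ℝ] ℝ} {D2 : E3 → BL} (h : CF Ω D D2) :
    ContDiffOn ℝ 1 D Ω := by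
  rw [show (1 : WithTop ℕ∞) = 0 + 1 from rfl, contDiffOn_succ_iff_fderiv_of_isOpen ho]
  refine ⟨fun x hx => (h.at ho hx).differentiableAt.differentiableWithinAt, by simp, ?_⟩
  rw [contDiffOn_zero]
  exact (h.c2.mono subset_closure).congr fun x hx => (h.at ho hx).fderiv

theorem cd_of_tsupport {f : E3 → ℝ} {n : ℕ∞} (h : ∀ x ∈ tsupport f, ContDiffAt ℝ n f x) : ContDiff ℝ n f := by
  rw [contDiff_iff_contDiffAt]
  intro x
  by_cases hx : x ∈ tsupport f
  · exact h x hx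
  · exact contDiffAt_const.congr_of_eventuallyEq (notMem_tsupport_iff_eventuallyEq.1 hx)

theorem cont_trc : Continuous trc := by unfold trc; fun_prop
theorem cont_hs2 : Continuous hs2 := by unfold hs2; fun_prop
theorem cont_XX {w : E3} : Continuous fun p : BL × (E3 →L[ℝ] ℝ) => XX p.1 p.2 w := by
  unfold XX
  have := cont_trc
  fun_prop

theorem CF.ctr {Ω : Set E3} {D : E3 → E3 →L[ℝ] ℝ} {D2 : E3 → BL} (h : CF Ω D D2) :
    ContinuousOn (fun x => trc (D2 x)) (closure Ω) := cont_trc.comp_continuousOn h.c2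
theorem CF.chs {Ω : Set E3} {D : E3 → E3 →L[ℝ] ℝ} {D2 : E3 → BL} (h : CF Ω D D2) :
    ContinuousOn (fun x => hs2 (D2 x)) (closure Ω) := cont_hs2.comp_continuousOn h.c2
theorem CF.cXX {Ω : Set E3} {D : E3 → E3 →L[ℝ] ℝ} {D2 : E3 → BL} (h : CF Ω D D2) (w : E3) :
    ContinuousOn (fun x => XX (D2 x) (D x) w) (closure Ω) :=
  cont_XX.comp_continuousOn (f := fun x => (D2 x, D x)) (h.c2.prodMk h.c1)

theorem int_loc {Ω : Set E3} (ho : IsOpen Ω) {g Q : E3 → ℝ} (hg : Continuous g) (hc : HasCompactSupport g)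
    (hs : tsupport g ⊆ Ω) (hQ : ContinuousOn Q Ω) : Integrable fun x => g x * Q x := by
  apply Continuous.integrable_of_hasCompactSupport _ hc.mul_right
  apply continuous_of_tsupport
  intro x hx
  exact hg.continuousAt.mul (hQ.continuousAt (ho.mem_nhds (hs (tsupport_mul_subset_left hx))))

theorem loc_id {Ω : Set E3} (ho : IsOpen Ω) {D : E3 → E3 →L[ℝ] ℝ} {D2 : E3 → BL} (h : CF Ω D D2)
    {θ : E3 → ℝ} (hθ : ContDiff ℝ 1 θ) (hc : HasCompactSupport θ) (hs : tsupport θ ⊆ Ω) :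
    ∫ x, θ x * (hs2 (D2 x) - trc (D2 x) ^ 2) = ∫ x, ∑ k, fderiv ℝ θ x (ee k) * XX (D2 x) (D x) (ee k) := by
  obtain ⟨L, hLc, hLθ, hLΩ⟩ := exists_compact_between hc ho hs
  obtain ⟨κ, hκ1, hκ0, -⟩ := exists_contMDiffMap_one_nhds_of_subset_interior (n := 1) (modelWithCornersSelf ℝ E3)
    (isClosed_tsupport θ) hLθ
  have hκd : ContDiff ℝ 1 κ := κ.contMDiff.contDiff
  have hκs : tsupport κ ⊆ L := by
    apply closure_minimal _ hLc.isClosed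
    intro x hx
    by_contra hxL
    exact hx (hκ0 x hxL)
  have hκc : HasCompactSupport κ := hLc.of_isClosed_subset (isClosed_tsupport _) hκs
  have hDi : ∀ i, ContDiffOn ℝ 1 (fun x => D x (ee i)) Ω := fun i => (h.cd ho).clm_apply contDiffOn_const
  have mk : ∀ {g : E3 → ℝ}, ContDiff ℝ 1 g → tsupport g ⊆ Ω → ∀ i, ContDiff ℝ 1 (fun x => g x * D x (ee i)) := by
    intro g hg hgs i
    apply cd_of_tsupport (n := 1)
    intro x hx
    have hxΩ : x ∈ Ω := hgs (tsupport_mul_subset_left hx)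
    exact hg.contDiffAt.mul ((hDi i).contDiffAt (ho.mem_nhds hxΩ))
  have hκΩ : tsupport κ ⊆ Ω := hκs.trans hLΩ
  have dv : ∀ {g : E3 → ℝ}, ContDiff ℝ 1 g → ∀ i, ∀ x ∈ Ω, ∀ w, fderiv ℝ (fun x => g x * D x (ee i)) x w
      = fderiv ℝ g x w * D x (ee i) + g x * D2 x w (ee i) := by
    intro g hg i x hx w
    have h1 : HasFDerivAt (fun x => D x (ee i)) ((D2 x).flip (ee i)) x := by
      have := (h.at ho hx).clm_apply (hasFDerivAt_const (ee i) x)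
      simpa using this
    have := ((hg.differentiable (by norm_num) x).hasFDerivAt.fun_mul h1).fderiv
    rw [this]
    simp; ring
  have z : ∀ x, x ∉ tsupport θ → θ x = 0 ∧ fderiv ℝ θ x = 0 := fun x hx =>
    ⟨image_eq_zero_of_notMem_tsupport hx, by
      by_contra hne
      exact hx (support_fderiv_subset ℝ hne)⟩
  have zA : ∀ i, ∀ x, x ∉ tsupport θ → fderiv ℝ (fun x => θ x * D x (ee i)) x = 0 := fun i x hx => by
      by_contra hne
      exact hx (tsupport_mul_subset_left (support_fderiv_subset ℝ hne))
  have val : ∀ i j a b : Fin 3, ∀ x, fderiv ℝ (fun x => θ x * D x (ee i)) x (ee a) *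
      fderiv ℝ (fun x => κ x * D x (ee j)) x (ee b) =
      (fderiv ℝ θ x (ee a) * D x (ee i) + θ x * D2 x (ee a) (ee i)) * D2 x (ee b) (ee j) := by
    intro i j a b x
    by_cases hx : x ∈ tsupport θ
    · have hxΩ := hs hx
      have hk : (κ : E3 → ℝ) =ᶠ[nhds x] fun _ => (1 : ℝ) := by
        have := hκ1.filter_mono (nhds_le_nhdsSet hx)
        exact this
      rw [dv hθ i x hxΩ, dv hκd j x hxΩ, hk.fderiv_eq, hk.eq_of_nhds]
      simp
    · rw [zA i x hx, (z x hx).1, (z x hx).2]; simp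
  have cA : ∀ i, HasCompactSupport (fun x => θ x * D x (ee i)) := fun i => hc.mul_right
  have cB : ∀ i, HasCompactSupport (fun x => κ x * D x (ee i)) := fun i => hκc.mul_right
  have sw : ∀ i j, ∫ x, (fderiv ℝ θ x (ee j) * D x (ee i) + θ x * D2 x (ee j) (ee i)) * D2 x (ee i) (ee j)
      = ∫ x, (fderiv ℝ θ x (ee i) * D x (ee i) + θ x * D2 x (ee i) (ee i)) * D2 x (ee j) (ee j) := by
    intro i j
    have := swap_der (mk hθ hs i) (cA i) (mk hκd hκΩ j) (cB j) (ee j) (ee i)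
    simpa only [val] using this
  have int : ∀ i j a b, Integrable fun x =>
      (fderiv ℝ θ x (ee a) * D x (ee i) + θ x * D2 x (ee a) (ee i)) * D2 x (ee b) (ee j) := by
    intro i j a b
    have := (((mk hθ hs i).continuous_fderiv (by norm_num)).clm_apply (continuous_const (y := ee a))).mul
      (((mk hκd hκΩ j).continuous_fderiv (by norm_num)).clm_apply (continuous_const (y := ee b)))
    have := this.integrable_of_hasCompactSupport (μ := volume) ((cA i).fderiv_apply ℝ (ee a)).mul_right
    exact this.congr (Filter.Eventually.of_forall fun x => val i j a b x)
  rw [← sub_eq_zero, ← integral_sub]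
  · have e : ∀ x, θ x * (hs2 (D2 x) - trc (D2 x) ^ 2) - ∑ k, fderiv ℝ θ x (ee k) * XX (D2 x) (D x) (ee k) =
      ∑ i, ∑ j, ((fderiv ℝ θ x (ee j) * D x (ee i) + θ x * D2 x (ee j) (ee i)) * D2 x (ee i) (ee j) -
        (fderiv ℝ θ x (ee i) * D x (ee i) + θ x * D2 x (ee i) (ee i)) * D2 x (ee j) (ee j)) := by
      intro x
      by_cases hx : x ∈ tsupport θ
      · have sy := h.symm x (subset_closure (hs hx))
        simp only [hs2, trc, XX, Fin.sum_univ_three]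
        rw [sy (ee 1) (ee 0), sy (ee 2) (ee 0), sy (ee 2) (ee 1)]
        ring
      · simp [(z x hx).1, (z x hx).2]
    simp only [e]
    rw [integral_finsetSum]
    · refine Finset.sum_eq_zero fun i _ => ?_
      rw [integral_finsetSum]
      · refine Finset.sum_eq_zero fun j _ => ?_
        rw [integral_sub (int i j j i) (int i j i j), sw, sub_self]
      · exact fun j _ => (int i j j i).sub (int i j i j)
    · exact fun i _ => integrable_finsetSum _ fun j _ => (int i j j i).sub (int i j i j)
  · exact int_loc ho hθ.continuous hc hs ((h.chs.sub (h.ctr.pow 2)).mono subset_closure)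
  · refine integrable_finsetSum _ fun k _ => ?_
    exact int_loc ho ((hθ.continuous_fderiv (by norm_num)).clm_apply continuous_const) (hc.fderiv_apply ℝ _)
      ((tsupport_fderiv_apply_subset ℝ _).trans hs) ((h.cXX _).mono subset_closure)
end

section
theorem e_sum (w : E3) : ∑ k, w k • ee k = w := by
  ext i
  fin_cases i <;> simp [Fin.sum_univ_three]

theorem inner_ee (n : E3) (k : Fin 3) : ⟪n, ee k⟫ = n k := by
  simp [ee, EuclideanSpace.inner_single_right]

theorem XX_lin (M : BL) (d : E3 →L[ℝ] ℝ) (w : E3) : ∑ k, w k * XX M d (ee k) = XX M d w := by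
  conv_rhs => rw [← e_sum w]
  simp only [XX, Fin.sum_univ_three, map_add, map_smul, ContinuousLinearMap.add_apply, ContinuousLinearMap.smul_apply, smul_eq_mul]
  ring

theorem bdd_of_zero {f : ℝ → ℝ} (hf : Continuous f) (h : ∀ s, s ∉ Icc (1:ℝ) 2 → f s = 0) : ∃ B, ∀ s, |f s| ≤ B := by
  obtain ⟨B, hB⟩ := isCompact_Icc.exists_bound_of_continuousOn (s := Icc (1:ℝ) 2) hf.continuousOn
  refine ⟨B, fun s => ?_⟩
  by_cases hs : s ∈ Icc (1:ℝ) 2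
  · exact hB s hs
  · rw [h s hs, abs_zero]
    exact (norm_nonneg _).trans (hB 1 (by norm_num))

theorem exists_chi : ∃ (χ : ℝ → ℝ) (B : ℝ), 0 ≤ B ∧ ContDiff ℝ 2 χ ∧ (∀ s ≤ 1, χ s = 0) ∧ (∀ s, 2 ≤ s → χ s = 1) ∧
    (∀ s, 0 ≤ χ s ∧ χ s ≤ 1) ∧ (∀ s, |deriv χ s| ≤ B) ∧ (∀ s, |deriv (deriv χ) s| ≤ B) ∧
    (∀ s, 2 < s → deriv χ s = 0) := by
  let χ : ℝ → ℝ := fun s => Real.smoothTransition (s - 1)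
  have hχ : ContDiff ℝ 2 χ := Real.smoothTransition.contDiff.comp (contDiff_id.sub contDiff_const)
  have h0 : ∀ s ≤ 1, χ s = 0 := fun s hs => Real.smoothTransition.zero_of_nonpos (by linarith)
  have h1 : ∀ s, 2 ≤ s → χ s = 1 := fun s hs => Real.smoothTransition.one_of_one_le (by linarith)
  have ev : ∀ s, s ∉ Icc (1:ℝ) 2 → χ =ᶠ[nhds s] (fun _ => (0:ℝ)) ∨ χ =ᶠ[nhds s] (fun _ => (1:ℝ)) := by
    intro s hs
    rw [mem_Icc, not_and_or, not_le, not_le] at hs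
    rcases hs with hs | hs
    · left; filter_upwards [Iio_mem_nhds hs] with t ht using h0 t (le_of_lt ht)
    · right; filter_upwards [Ioi_mem_nhds hs] with t ht using h1 t (le_of_lt ht)
  have d1 : ∀ s, s ∉ Icc (1:ℝ) 2 → deriv χ =ᶠ[nhds s] (fun _ => (0:ℝ)) := by
    intro s hs
    rcases ev s hs with h | h
    · simpa using h.deriv
    · simpa using h.deriv
  have c1 : ContDiff ℝ 1 (deriv χ) := (contDiff_succ_iff_deriv.1 (show ContDiff ℝ (1+1) χ by simpa [one_add_one_eq_two] using hχ)).2.2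
  obtain ⟨B1, hB1⟩ := bdd_of_zero c1.continuous fun s hs => (d1 s hs).eq_of_nhds
  obtain ⟨B2, hB2⟩ := bdd_of_zero (c1.continuous_deriv (by norm_num)) fun s hs => by
    rw [(d1 s hs).deriv_eq]; simp
  refine ⟨χ, max B1 B2, ((abs_nonneg _).trans (hB1 0)).trans (le_max_left _ _), hχ, h0, h1,
    fun s => ⟨Real.smoothTransition.nonneg _, Real.smoothTransition.le_one _⟩,
    fun s => (hB1 s).trans (le_max_left _ _), fun s => (hB2 s).trans (le_max_right _ _), ?_⟩
  intro s hs
  exact (d1 s fun h => by linarith [h.2]).eq_of_nhds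

section
variable {ι : Type} {Ω : Set E3}

theorem HPoly.compact (P : HPoly ι Ω) : IsCompact (closure Ω) := P.bdd.isCompact_closure

theorem HPoly.vfin (P : HPoly ι Ω) : volume Ω ≠ ⊤ := (P.bdd.measure_lt_top).ne

theorem HPoly.cont_int (P : HPoly ι Ω) {f : E3 → ℝ} (hf : ContinuousOn f (closure Ω)) : IntegrableOn f Ω :=
  (hf.integrableOn_compact P.compact).mono_set subset_closure

theorem HPoly.layer (P : HPoly ι Ω) : ∃ C : ℝ, 0 ≤ C ∧ ∀ i ε, 0 < ε → volume (Ω ∩ {x | P.l i x < ε}) ≤ ENNReal.ofReal (C * ε) := by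
  obtain ⟨R, hR⟩ := P.bdd.subset_closedBall 0
  obtain ⟨C, hC, h⟩ := vol_slab R
  refine ⟨C, hC, fun i ε hε => le_trans (measure_mono ?_) (h (P.n i) (P.c i) ε (P.unit i) hε)⟩
  rintro x ⟨hx, hxl⟩
  have h1 := P.mem.1 hx i
  have hxl : P.l i x < ε := hxl
  simp only [HPoly.l] at h1 hxl
  exact ⟨hR hx, by linarith, by linarith⟩

theorem HPoly.small (P : HPoly ι Ω) {f : E3 → ℝ} (hf : ContinuousOn f (closure Ω)) (i : ι)
    (h0 : ∀ y ∈ closure Ω, P.l i y = 0 → f y = 0) {η : ℝ} (hη : 0 < η) :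
    ∃ δ > 0, ∀ y ∈ closure Ω, P.l i y < δ → |f y| < η := by
  by_contra hcon
  push Not at hcon
  have hK : IsCompact (closure Ω ∩ {y | η ≤ |f y|}) := by
    have := hf.abs.preimage_isClosed_of_isClosed isClosed_closure (isClosed_Ici (a := η))
    exact P.compact.of_isClosed_subset this inter_subset_left
  obtain ⟨y1, hy1, hy1', hy1''⟩ := hcon 1 one_pos
  obtain ⟨y, hy, hmin⟩ := hK.exists_isMinOn ⟨y1, hy1, hy1''⟩ (P.l_cont i).continuousOn
  have hpos : 0 < P.l i y := by
    refine lt_of_le_of_ne (P.mem_cl.1 hy.1 i) fun h => ?_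
    have h3 : η ≤ |f y| := hy.2
    rw [h0 y hy.1 h.symm, abs_zero] at h3
    linarith
  obtain ⟨z, hz, hz1, hz2⟩ := hcon _ hpos
  exact absurd (hmin ⟨hz, hz2⟩) (not_le.2 hz1)

theorem glob_id [Fintype ι] (P : HPoly ι Ω) {D : E3 → E3 →L[ℝ] ℝ} {D2 : E3 → BL} (h : CF Ω D D2) {ω : E3 → ℝ} (hω : ContDiff ℝ 1 ω)
    (hX : ∀ i, ∀ y ∈ closure Ω, P.l i y = 0 → ω y * XX (D2 y) (D y) (P.n i) = 0) :
    ∫ x in Ω, ω x * (hs2 (D2 x) - trc (D2 x) ^ 2) =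
      ∫ x in Ω, ∑ k, fderiv ℝ ω x (ee k) * XX (D2 x) (D x) (ee k) := by
  classical
  obtain ⟨χ, B, hB0, hχ, hχ0, hχ1, hχb, hχd, -, hχz⟩ := exists_chi
  set Q : E3 → ℝ := fun x => hs2 (D2 x) - trc (D2 x) ^ 2 with hQ
  have hQc : ContinuousOn Q (closure Ω) := h.chs.sub (h.ctr.pow 2)
  have hωc : ContinuousOn ω (closure Ω) := hω.continuous.continuousOn
  set W : E3 → ℝ := fun x => ∑ k, fderiv ℝ ω x (ee k) * XX (D2 x) (D x) (ee k) with hW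
  have hWc : ContinuousOn W (closure Ω) := by
    refine continuousOn_finsetSum _ fun k _ => ?_
    exact (((hω.continuous_fderiv (by norm_num)).clm_apply continuous_const).continuousOn).mul (h.cXX _)
  let ζ : ℝ → E3 → ℝ := fun ε x => ∏ i, χ (P.l i x / ε)
  let ζi : ι → ℝ → E3 → ℝ := fun i ε x => (∏ j ∈ Finset.univ.erase i, χ (P.l j x / ε)) * (deriv χ (P.l i x / ε) * ε⁻¹)
  have hζ : ∀ ε, ContDiff ℝ 1 (ζ ε) := fun ε => contDiff_prod fun i _ =>
    (hχ.of_le (by norm_num)).comp ((P.cont_diff_l i).div_const ε)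
  have hζd : ∀ ε x w, fderiv ℝ (ζ ε) x w = ∑ i, ζi i ε x * ⟪P.n i, w⟫ := by
    intro ε x w
    have h1 : ∀ i, HasFDerivAt (fun x => χ (P.l i x / ε)) ((deriv χ (P.l i x / ε) * ε⁻¹) • innerSL ℝ (P.n i)) x := by
      intro i
      have h2 : HasDerivAt χ (deriv χ (P.l i x / ε)) (P.l i x / ε) :=
        (hχ.differentiable (by norm_num) _).hasDerivAt
      have h3 : HasFDerivAt (fun x => P.l i x / ε) (ε⁻¹ • innerSL ℝ (P.n i)) x := by
        simpa [div_eq_mul_inv] using (P.hasFDeriv_l i x).mul_const ε⁻¹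
      have := h2.comp_hasFDerivAt x h3
      rw [smul_smul] at this
      exact this
    have h2 := (HasFDerivAt.finsetProd (u := Finset.univ) fun i _ => h1 i).fderiv
    rw [show ζ ε = fun x => ∏ i, χ (P.l i x / ε) from rfl, h2]
    simp [ζi, mul_assoc]
  have hbd : ∀ i ε x, 0 < ε → |ζi i ε x| ≤ B * ε⁻¹ ∧ (2 * ε < P.l i x → ζi i ε x = 0) := by
    intro i ε x hε
    constructor
    · rw [abs_mul, abs_mul, abs_of_pos (inv_pos.2 hε), abs_of_nonneg (Finset.prod_nonneg fun j _ => (hχb _).1)]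
      have h1 : ∏ j ∈ Finset.univ.erase i, χ (P.l j x / ε) ≤ 1 := Finset.prod_le_one (fun j _ => (hχb _).1) fun j _ => (hχb _).2
      have h2 := hχd (P.l i x / ε)
      have h3 := inv_pos.2 hε
      calc _ ≤ 1 * (|deriv χ (P.l i x / ε)| * ε⁻¹) := by gcongr
        _ ≤ _ := by rw [one_mul]; gcongr
    · intro hx
      simp only [ζi]
      rw [hχz _ (by rw [lt_div_iff₀ hε]; exact hx)]; simp
  have hid : ∀ ε, 0 < ε → ∫ x in Ω, ζ ε x * (ω x * Q x - W x) =
      ∫ x in Ω, ∑ i, ζi i ε x * (ω x * XX (D2 x) (D x) (P.n i)) := by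
    intro ε hε
    have hθ : ContDiff ℝ 1 fun x => ζ ε x * ω x := (hζ ε).mul hω
    have hts : tsupport (fun x => ζ ε x * ω x) ⊆ {x | ∀ i, ε ≤ P.l i x} := by
      refine closure_minimal ?_ ?_
      · intro x hx i
        by_contra hc
        push Not at hc
        apply hx
        have : ζ ε x = 0 := Finset.prod_eq_zero (Finset.mem_univ i) (hχ0 _ (by rw [div_le_one hε]; exact hc.le))
        simp [this]
      · simp only [Set.ofPred_forall]
        exact isClosed_iInter fun i => isClosed_le continuous_const (P.l_cont i)
    have hsub : {x | ∀ i, ε ≤ P.l i x} ⊆ Ω := fun x hx => P.mem.2 fun i => hε.trans_le (hx i)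
    have hcs : HasCompactSupport fun x => ζ ε x * ω x :=
      P.compact.of_isClosed_subset (isClosed_tsupport _) ((hts.trans hsub).trans subset_closure)
    have key := loc_id P.op h hθ hcs (hts.trans hsub)
    have z : ∀ x, x ∉ Ω → ζ ε x * ω x = 0 ∧ fderiv ℝ (fun x => ζ ε x * ω x) x = 0 := fun x hx =>
      ⟨image_eq_zero_of_notMem_tsupport (f := fun x => ζ ε x * ω x) fun h' => hx (hsub (hts h')), by
        by_contra hne
        exact hx (hsub (hts (support_fderiv_subset ℝ hne)))⟩
    rw [← setIntegral_eq_integral_of_forall_compl_eq_zero (s := Ω) (f := fun x => ζ ε x * ω x * (hs2 (D2 x) - trc (D2 x) ^ 2))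
        (fun x hx => by rw [(z x hx).1, zero_mul]),
      ← setIntegral_eq_integral_of_forall_compl_eq_zero (s := Ω)
        (f := fun x => ∑ k, fderiv ℝ (fun x => ζ ε x * ω x) x (ee k) * XX (D2 x) (D x) (ee k))
        (fun x hx => by rw [(z x hx).2]; simp)] at key
    have e1 : ∀ x, ∑ k, fderiv ℝ (fun x => ζ ε x * ω x) x (ee k) * XX (D2 x) (D x) (ee k) =
        (∑ i, ζi i ε x * (ω x * XX (D2 x) (D x) (P.n i))) + ζ ε x * W x := by
      intro x
      have hf : ∀ w, fderiv ℝ (fun x => ζ ε x * ω x) x w = (∑ i, ζi i ε x * ⟪P.n i, w⟫) * ω x + ζ ε x * fderiv ℝ ω x w := by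
        intro w
        rw [fderiv_fun_mul ((hζ ε).differentiable (by norm_num) x) (hω.differentiable (by norm_num) x)]
        simp [hζd]; ring
      simp only [hf, inner_ee, ← XX_lin _ _ (P.n _), add_mul, Finset.sum_add_distrib, hW, Finset.mul_sum, Finset.sum_mul]
      congr 1
      · rw [Finset.sum_comm]
        refine Finset.sum_congr rfl fun i _ => Finset.sum_congr rfl fun k _ => by ring
      · refine Finset.sum_congr rfl fun k _ => by ring
    simp only [e1] at key
    have hcz : ContinuousOn (ζ ε) (closure Ω) := (hζ ε).continuous.continuousOn
    have i1 : IntegrableOn (fun x => ζ ε x * ω x * Q x) Ω := P.cont_int ((hcz.mul hωc).mul hQc)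
    have i2 : IntegrableOn (fun x => ζ ε x * W x) Ω := P.cont_int (hcz.mul hWc)
    have i3 : IntegrableOn (fun x => ∑ i, ζi i ε x * (ω x * XX (D2 x) (D x) (P.n i))) Ω := by
      apply P.cont_int
      refine continuousOn_finsetSum _ fun i _ => ContinuousOn.mul (Continuous.continuousOn ?_) (hωc.mul (h.cXX _))
      refine Continuous.mul (continuous_finset_prod _ fun j _ => hχ.continuous.comp ((P.l_cont j).div_const _)) ?_
      exact ((hχ.continuous_deriv (by norm_num)).comp ((P.l_cont i).div_const _)).mul continuous_const
    rw [integral_add i3 i2] at key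
    have e2 : (fun x => ζ ε x * (ω x * Q x - W x)) = fun x => ζ ε x * ω x * Q x - ζ ε x * W x := by ext x; ring
    rw [e2, integral_sub i1 i2]
    linarith
  have iT : IntegrableOn (fun x => ω x * Q x - W x) Ω := P.cont_int ((hωc.mul hQc).sub hWc)
  have hseq : Filter.Tendsto (fun n : ℕ => 1 / ((n : ℝ) + 1)) Filter.atTop (nhds 0) := tendsto_one_div_add_atTop_nhds_zero_nat
  have L1 : Filter.Tendsto (fun n : ℕ => ∫ x in Ω, ζ (1 / ((n : ℝ) + 1)) x * (ω x * Q x - W x)) Filter.atTop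
      (nhds (∫ x in Ω, (ω x * Q x - W x))) := by
    refine tendsto_integral_of_dominated_convergence (fun x => |ω x * Q x - W x|) ?_ iT.abs ?_ ?_
    · intro n
      exact (hζ _).continuous.aestronglyMeasurable.mul iT.aestronglyMeasurable
    · intro n
      refine Filter.Eventually.of_forall fun x => ?_
      rw [norm_mul, Real.norm_eq_abs, Real.norm_eq_abs, abs_of_nonneg (Finset.prod_nonneg fun j _ => (hχb _).1)]
      exact mul_le_of_le_one_left (abs_nonneg _) (Finset.prod_le_one (fun j _ => (hχb _).1) fun j _ => (hχb _).2)
    · filter_upwards [ae_restrict_mem P.op.measurableSet] with x hx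
      refine tendsto_const_nhds.congr' ?_
      have : ∀ i, ∀ᶠ n : ℕ in Filter.atTop, 1 / ((n : ℝ) + 1) < P.l i x / 2 := fun i =>
        hseq.eventually_lt_const (by linarith [P.mem.1 hx i])
      filter_upwards [Filter.eventually_all.2 this] with n hn
      have : ζ (1 / ((n : ℝ) + 1)) x = 1 := Finset.prod_eq_one fun i _ => hχ1 _ (by
        rw [le_div_iff₀ (by positivity)]; linarith [hn i])
      rw [this, one_mul]
  have L2 : Filter.Tendsto (fun n : ℕ => ∫ x in Ω, ζ (1 / ((n : ℝ) + 1)) x * (ω x * Q x - W x)) Filter.atTop (nhds 0) := by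
    obtain ⟨C, hC, hlay⟩ := P.layer
    rw [Metric.tendsto_atTop]
    intro η hη
    set K : ℝ := (Fintype.card ι) * (B * (C * 3)) + 1 with hK
    have hKp : 0 < K := by positivity
    have hsm := fun i => P.small (hωc.mul (h.cXX (P.n i))) i (hX i) (div_pos hη hKp)
    choose δ hδ hδs using hsm
    have : ∀ i, ∀ᶠ n : ℕ in Filter.atTop, 1 / ((n : ℝ) + 1) < δ i / 3 := fun i =>
        hseq.eventually_lt_const (by linarith [hδ i])
    obtain ⟨N, hN⟩ := Filter.eventually_atTop.1 (Filter.eventually_all.2 this)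
    refine ⟨N, fun n hn => ?_⟩
    set ε := 1 / ((n : ℝ) + 1) with hε
    have hεp : 0 < ε := by positivity
    rw [dist_zero_right, hid ε hεp]
    have hmeas : ∀ i, MeasurableSet {x | P.l i x < 3 * ε} := fun i => (isOpen_lt (P.l_cont i) continuous_const).measurableSet
    have ibd : ∀ i, IntegrableOn (({x | P.l i x < 3 * ε}).indicator fun _ => B * ε⁻¹ * (η / K)) Ω := fun i =>
      (integrableOn_const P.vfin).indicator (hmeas i)
    have hle : ‖∫ x in Ω, ∑ i, ζi i ε x * (ω x * XX (D2 x) (D x) (P.n i))‖ ≤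
        ∫ x in Ω, ∑ i, ({x | P.l i x < 3 * ε}).indicator (fun _ => B * ε⁻¹ * (η / K)) x := by
      refine norm_integral_le_of_norm_le (integrable_finsetSum _ fun i _ => ibd i) ?_
      filter_upwards [ae_restrict_mem P.op.measurableSet] with x hx
      refine (norm_sum_le _ _).trans (Finset.sum_le_sum fun i _ => ?_)
      by_cases hxi : P.l i x < 3 * ε
      · rw [indicator_of_mem (by exact hxi), norm_mul]
        have h1 := (hbd i ε x hεp).1
        have h2 := hδs i x (subset_closure hx) (by linarith [hN n hn i])
        exact mul_le_mul h1 h2.le (norm_nonneg _) (by positivity)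
      · rw [indicator_of_notMem (by exact hxi), (hbd i ε x hεp).2 (by linarith)]; simp
    refine hle.trans_lt ?_
    rw [integral_finsetSum _ fun i _ => ibd i]
    have each : ∀ i ∈ (Finset.univ : Finset ι), ∫ x in Ω, ({x | P.l i x < 3 * ε}).indicator (fun _ => B * ε⁻¹ * (η / K)) x ≤ B * (C * 3) * (η / K) := by
      intro i _
      rw [setIntegral_indicator (hmeas i), setIntegral_const, smul_eq_mul]
      have h1 := hlay i (3 * ε) (by positivity)
      have h2 : volume.real (Ω ∩ {x | P.l i x < 3 * ε}) ≤ C * (3 * ε) := by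
        refine ENNReal.toReal_le_of_le_ofReal (by positivity) h1
      calc _ ≤ (C * (3 * ε)) * (B * ε⁻¹ * (η / K)) := by gcongr
        _ = _ := by field_simp
    refine (Finset.sum_le_sum each).trans_lt ?_
    rw [Finset.sum_const, nsmul_eq_mul, Finset.card_univ]
    calc _ = (K - 1) * (η / K) := by rw [hK]; ring
      _ < K * (η / K) := by have := div_pos hη hKp; nlinarith
      _ = η := by field_simp
  have L3 := tendsto_nhds_unique L1 L2
  have iQ : IntegrableOn (fun x => ω x * Q x) Ω := P.cont_int (hωc.mul hQc)
  rw [integral_sub iQ (P.cont_int hWc)] at L3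
  linarith
end
end

section
theorem pos_pow_deriv {k : ℕ} (hk : 1 ≤ k) (s : ℝ) :
    HasDerivAt (fun s : ℝ => (max s 0) ^ (k + 1)) (((k + 1 : ℕ) : ℝ) * (max s 0) ^ k) s := by
  rcases lt_trichotomy s 0 with h | h | h
  · rw [max_eq_right h.le, zero_pow (by omega), mul_zero]
    refine (hasDerivAt_const s (0:ℝ)).congr_of_eventuallyEq ?_
    filter_upwards [Iio_mem_nhds h] with t ht
    rw [max_eq_right (le_of_lt ht), zero_pow (by omega)]
  · subst h
    rw [max_self, zero_pow (by omega), mul_zero, hasDerivAt_iff_isLittleO_nhds_zero]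
    simp only [zero_add, max_self, smul_zero, sub_zero]
    rw [zero_pow (by omega)]
    simp only [sub_zero]
    have h1 : (fun h : ℝ => (max h 0) ^ (k+1)) =O[nhds 0] fun h : ℝ => h ^ (k+1) := by
      refine Asymptotics.IsBigO.of_bound 1 (Filter.Eventually.of_forall fun x => ?_)
      rw [one_mul, norm_pow, norm_pow, Real.norm_eq_abs, Real.norm_eq_abs]
      refine pow_le_pow_left₀ (abs_nonneg _) ?_ _
      rcases le_total x 0 with h | h
      · rw [max_eq_right h]; simp
      · rw [max_eq_left h]
    refine h1.trans_isLittleO ?_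
    simpa using Asymptotics.isLittleO_pow_pow (𝕜 := ℝ) (show 1 < k + 1 by omega)
  · rw [max_eq_left h.le]
    refine HasDerivAt.congr_of_eventuallyEq (f := fun s : ℝ => s ^ (k+1)) ?_ ?_
    · simpa using hasDerivAt_pow (k+1) s
    · filter_upwards [Ioi_mem_nhds h] with t ht
      rw [max_eq_left (le_of_lt ht)]

theorem pos_pow_cd1 {k : ℕ} (hk : 1 ≤ k) : ContDiff ℝ 1 (fun s : ℝ => (max s 0) ^ (k + 1)) := by
  rw [contDiff_one_iff_deriv]
  refine ⟨fun s => (pos_pow_deriv hk s).differentiableAt, ?_⟩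
  rw [show deriv (fun s : ℝ => (max s 0) ^ (k + 1)) = fun s => ((k + 1 : ℕ) : ℝ) * (max s 0) ^ k from
    funext fun s => (pos_pow_deriv hk s).deriv]
  fun_prop

theorem pos_pow_cd2 {k : ℕ} (hk : 1 ≤ k) : ContDiff ℝ 2 (fun s : ℝ => (max s 0) ^ (k + 2)) := by
  rw [show (2 : WithTop ℕ∞) = 1 + 1 by norm_num, contDiff_succ_iff_deriv]
  refine ⟨fun s => (pos_pow_deriv (by omega) s).differentiableAt, by simp, ?_⟩
  rw [show deriv (fun s : ℝ => (max s 0) ^ (k + 2)) = fun s => ((k + 1 + 1 : ℕ) : ℝ) * (max s 0) ^ (k + 1) from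
    funext fun s => (pos_pow_deriv (by omega) s).deriv]
  exact contDiff_const.mul (pos_pow_cd1 hk)

section
variable {ι : Type} {Ω : Set E3}

/-- tangential part vanishes on face `i` -/
def Tan (P : HPoly ι Ω) (D : E3 → E3 →L[ℝ] ℝ) (i : ι) : Prop :=
  ∀ y ∈ closure Ω, P.l i y = 0 → ∀ t, ⟪P.n i, t⟫ = 0 → D y t = 0

theorem HPoly.face_nhd [Fintype ι] (P : HPoly ι Ω) (i : ι) (t : E3) (ht : ⟪P.n i, t⟫ = 0) :
    ∃ s : ℝ, s > 0 ∧ P.a i + s • t ∈ closure Ω ∧ P.l i (P.a i + s • t) = 0 := by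
  have hl : ∀ s : ℝ, P.l i (P.a i + s • t) = 0 := fun s => by
    rw [P.l_add, P.l_a, inner_smul_right, ht]; simp
  have : ∀ j, ∀ᶠ s : ℝ in nhds 0, j ≠ i → 0 < P.l j (P.a i + s • t) := by
    intro j
    by_cases hj : j = i
    · simp [hj]
    · have hc : Continuous fun s : ℝ => P.l j (P.a i + s • t) := (P.l_cont j).comp (by fun_prop)
      have := hc.continuousAt.eventually (lt_mem_nhds (a := 0) (show 0 < P.l j (P.a i + (0:ℝ) • t) by
        simpa using P.l_a_pos i j hj))
      filter_upwards [this] with s hs _ using hs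
  obtain ⟨s, hs, hs0⟩ := (((Filter.eventually_all.2 this).filter_mono nhdsWithin_le_nhds).and
    (self_mem_nhdsWithin (s := Ioi (0:ℝ)))).exists
  refine ⟨s, hs0, P.mem_cl.2 fun j => ?_, hl s⟩
  by_cases hj : j = i
  · rw [hj, hl]
  · exact (hs j hj).le

theorem face_der [Fintype ι] (P : HPoly ι Ω) {f : E3 → ℝ} {L : E3 →L[ℝ] ℝ} {y : E3} (hd : HasFDerivWithinAt f L (closure Ω) y) {i : ι}
    (hf : ∀ z ∈ closure Ω, P.l i z = 0 → f z = 0) (hy : y ∈ closure Ω) (hyi : P.l i y = 0) {t : E3} (ht : ⟪P.n i, t⟫ = 0) : L t = 0 := by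
  have key : ∀ z ∈ closure Ω, P.l i z = 0 → L (z - y) = 0 := by
    intro z hz hzi
    have hline : ∀ s ∈ Icc (0:ℝ) 1, y + s • (z - y) ∈ closure Ω ∧ P.l i (y + s • (z - y)) = 0 := by
      intro s hs
      refine ⟨P.mem_cl.2 fun j => ?_, by rw [P.l_comb, hyi, hzi]; simp⟩
      rw [P.l_comb]
      have := P.mem_cl.1 hy j
      have := P.mem_cl.1 hz j
      have := hs.1
      have := hs.2
      exact add_nonneg (mul_nonneg (by linarith) (by assumption)) (mul_nonneg (by assumption) (by assumption))
    have h1 : HasDerivWithinAt (fun s : ℝ => y + s • (z - y)) (z - y) (Icc (0:ℝ) 1) 0 := by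
      simpa using (((hasDerivAt_id (0:ℝ)).smul_const (z - y)).const_add y).hasDerivWithinAt
    have h3 : HasDerivWithinAt (fun s : ℝ => f (y + s • (z - y))) (L (z - y)) (Icc (0:ℝ) 1) 0 :=
      HasFDerivWithinAt.comp_hasDerivWithinAt_of_eq (0:ℝ) hd h1 (fun s hs => (hline s hs).1) (by simp)
    have h4 : HasDerivWithinAt (fun s : ℝ => f (y + s • (z - y))) 0 (Icc (0:ℝ) 1) 0 := by
      refine (hasDerivWithinAt_const (0:ℝ) (Icc (0:ℝ) 1) (0:ℝ)).congr (fun s hs => ?_) ?_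
      · exact hf _ (hline s hs).1 (hline s hs).2
      · exact hf _ (hline 0 (by simp)).1 (hline 0 (by simp)).2
    exact (uniqueDiffOn_Icc zero_lt_one 0 (by simp)).eq_deriv _ h3 h4
  obtain ⟨s, hs, hs1, hs2⟩ := P.face_nhd i t ht
  obtain ⟨s0, hs0, hs01, hs02⟩ := P.face_nhd i 0 (by simp)
  have e1 := key _ hs1 hs2
  have e2 := key _ hs01 hs02
  simp only [smul_zero, add_zero] at e2
  have : P.a i + s • t - y = (P.a i - y) + s • t := by abel
  rw [this, map_add, e2, zero_add, map_smul, smul_eq_mul, mul_eq_zero] at e1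
  exact e1.resolve_left hs.ne'

theorem tan_D2 [Fintype ι] (P : HPoly ι Ω) {D : E3 → E3 →L[ℝ] ℝ} {D2 : E3 → BL} (h : CF Ω D D2) {i : ι}
    (hT : Tan P D i) {y : E3} (hy : y ∈ closure Ω) (hyi : P.l i y = 0) {t t' : E3} (ht : ⟪P.n i, t⟫ = 0)
    (ht' : ⟪P.n i, t'⟫ = 0) : D2 y t' t = 0 := by
  have h1 := (h.der y hy).clm_apply (hasFDerivWithinAt_const t y (closure Ω))
  simpa using face_der P h1 (fun z hz hzi => hT z hz hzi t ht) hy hyi ht'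

theorem tan_XX [Fintype ι] (P : HPoly ι Ω) {D : E3 → E3 →L[ℝ] ℝ} {D2 : E3 → BL} (h : CF Ω D D2) {i : ι}
    (hT : Tan P D i) {y : E3} (hy : y ∈ closure Ω) (hyi : P.l i y = 0) : XX (D2 y) (D y) (P.n i) = 0 := by
  set n := P.n i with hn
  have nn : ⟪n, n⟫ = 1 := by rw [real_inner_self_eq_norm_sq, P.unit]; norm_num
  have n2 : ∑ k, n k * n k = 1 := by
    rw [← nn, PiLp.inner_apply]; simp [sq]
  have tk : ∀ k, ⟪n, ee k - n k • n⟫ = 0 := fun k => by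
    rw [inner_sub_right, inner_smul_right, nn, inner_ee]; ring
  have d1 : ∀ k, D y (ee k) = n k * D y n := by
    intro k
    have := hT y hy hyi _ (tk k)
    rw [map_sub, map_smul, smul_eq_mul] at this
    linarith
  have d2 : ∀ k, D2 y (ee k) (ee k) = 2 * (n k * D2 y n (ee k)) - n k * n k * D2 y n n := by
    intro k
    have := tan_D2 P h hT hy hyi (tk k) (tk k)
    have sy := h.symm y hy (ee k) n
    simp only [map_sub, map_smul, sub_apply, smul_apply, smul_eq_mul] at this
    rw [sy] at this
    linarith
  have d3 : ∑ k, n k * D2 y n (ee k) = D2 y n n := by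
    have : D2 y n n = D2 y n (∑ k, n k • ee k) := by rw [e_sum]
    rw [this, map_sum]; simp
  have tr : trc (D2 y) = D2 y n n := by
    simp only [trc, d2, Finset.sum_sub_distrib, ← Finset.mul_sum, ← Finset.sum_mul, d3, n2]
    ring
  rw [XX, tr]
  simp only [d1]
  have : ∑ j, D2 y n (ee j) * (n j * D y n) = (∑ k, n k * D2 y n (ee k)) * D y n := by
    rw [Finset.sum_mul]; exact Finset.sum_congr rfl fun k _ => by ring
  rw [this, d3, sub_self]

theorem l2_id [Fintype ι] (P : HPoly ι Ω) {D : E3 → E3 →L[ℝ] ℝ} {D2 : E3 → BL} (h : CF Ω D D2)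
    (hT : ∀ i, Tan P D i) : ∫ x in Ω, hs2 (D2 x) = ∫ x in Ω, trc (D2 x) ^ 2 := by
  have := glob_id P h (ω := fun _ => 1) contDiff_const fun i y hy hyi => by
    rw [tan_XX P h (hT i) hy hyi, mul_zero]
  simp only [one_mul, fderiv_fun_const, Pi.zero_apply, zero_apply, zero_mul, Finset.sum_const_zero,
    integral_zero] at this
  have i2 : IntegrableOn (fun x => trc (D2 x) ^ 2) Ω := P.cont_int (h.ctr.pow 2)
  rw [integral_sub (P.cont_int h.chs) i2] at this
  linarith
end
end

section
section
variable {ι : Type} {Ω : Set E3}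

def dd2 (d : E3 →L[ℝ] ℝ) : ℝ := ∑ j, (d (ee j)) ^ 2

theorem cont_dd2 : Continuous dd2 := by unfold dd2; fun_prop

theorem cacc_pt (M : BL) (d : E3 →L[ℝ] ℝ) (η : ℝ) (g : Fin 3 → ℝ) {L : ℝ} (hg : ∀ k, |g k| ≤ L) :
    ∑ k, (2 * η * g k) * XX M d (ee k) ≤ 3 * (η ^ 2 * trc M ^ 2) + 1 / 2 * (η ^ 2 * hs2 M) + 10 * L ^ 2 * dd2 d := by
  have h1 : ∀ k j, 2 * η * g k * (- (M (ee k) (ee j) * d (ee j))) ≤ 1 / 2 * (η ^ 2 * M (ee k) (ee j) ^ 2) + 2 * L ^ 2 * d (ee j) ^ 2 := by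
    intro k j
    have : g k ^ 2 ≤ L ^ 2 := sq_le_sq.2 ((hg k).trans (le_abs_self _))
    nlinarith [sq_nonneg (η * M (ee k) (ee j) + 2 * g k * d (ee j)), mul_le_mul_of_nonneg_right this (sq_nonneg (d (ee j)))]
  have h2 : ∀ k, 2 * η * g k * (trc M * d (ee k)) ≤ η ^ 2 * trc M ^ 2 + L ^ 2 * d (ee k) ^ 2 := by
    intro k
    have : g k ^ 2 ≤ L ^ 2 := sq_le_sq.2 ((hg k).trans (le_abs_self _))
    nlinarith [sq_nonneg (η * trc M - g k * d (ee k)), mul_le_mul_of_nonneg_right this (sq_nonneg (d (ee k)))]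
  have h3 : 0 ≤ L ^ 2 * dd2 d := mul_nonneg (sq_nonneg _) (Finset.sum_nonneg fun _ _ => sq_nonneg _)
  have a00 := h1 0 0
  have a01 := h1 0 1
  have a02 := h1 0 2
  have a10 := h1 1 0
  have a11 := h1 1 1
  have a12 := h1 1 2
  have a20 := h1 2 0
  have a21 := h1 2 1
  have a22 := h1 2 2
  have b0 := h2 0
  have b1 := h2 1
  have b2 := h2 2
  simp only [XX, hs2, dd2, Fin.sum_univ_three] at *
  linarith

/-- cut-off profile -/
def cutq (x0 : E3) (r : ℝ) (x : E3) : ℝ := 1 - ‖x - x0‖ ^ 2 / (4 * r ^ 2)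

theorem cutq_der (x0 : E3) (r : ℝ) (x : E3) :
    HasFDerivAt (cutq x0 r) (-((2 / (4 * r ^ 2)) • innerSL ℝ (x - x0))) x := by
  have h1 : HasFDerivAt (fun x : E3 => ‖x - x0‖ ^ 2) (2 • (innerSL ℝ (x - x0))) x := by
    have := ((hasFDerivAt_id x).sub_const x0).norm_sq
    simpa using this
  have h2 := ((h1.mul_const ((4 * r ^ 2)⁻¹)).const_sub 1)
  simp only [← div_eq_mul_inv] at h2
  have h3 : (-((2 / (4 * r ^ 2)) • innerSL ℝ (x - x0))) = -((4 * r ^ 2)⁻¹ • (2 • innerSL ℝ (x - x0))) := by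
    ext w
    simp only [ContinuousLinearMap.neg_apply, smul_apply, nsmul_eq_mul, smul_eq_mul]
    ring
  rw [h3]
  exact h2

theorem cacc [Fintype ι] (P : HPoly ι Ω) {D : E3 → E3 →L[ℝ] ℝ} {D2 : E3 → BL} (h : CF Ω D D2) (x0 : E3) {r : ℝ}
    (hr : 0 < r) (hT : ∀ i, (∃ y ∈ closure Ω ∩ ball x0 (2 * r), P.l i y = 0) → Tan P D i) :
    ∫ x in Ω ∩ closedBall x0 r, hs2 (D2 x) ≤ 32 * (∫ x in Ω ∩ closedBall x0 (2 * r), trc (D2 x) ^ 2)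
      + 320 / r ^ 2 * ∫ x in Ω ∩ closedBall x0 (2 * r), dd2 (D x) := by
  let q := cutq x0 r
  have hqd := cutq_der x0 r
  have hqc : ContDiff ℝ 1 q := by
    refine contDiff_const.sub (ContDiff.div_const ?_ _)
    exact (contDiff_id.sub contDiff_const).norm_sq ℝ
  let ω : E3 → ℝ := fun x => (max (q x) 0) ^ 4
  have hω : ContDiff ℝ 1 ω := (pos_pow_cd1 (k := 3) (by norm_num)).comp hqc
  have hr2 : 0 < 4 * r ^ 2 := by positivity
  have hout : ∀ x, x ∉ ball x0 (2 * r) → max (q x) 0 = 0 := by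
    intro x hx
    rw [mem_ball, dist_eq_norm, not_lt] at hx
    apply max_eq_right
    have : (2 * r) ^ 2 ≤ ‖x - x0‖ ^ 2 := pow_le_pow_left₀ (by positivity) hx 2
    have : 1 ≤ ‖x - x0‖ ^ 2 / (4 * r ^ 2) := by rw [le_div_iff₀ hr2]; linarith
    show 1 - ‖x - x0‖ ^ 2 / (4 * r ^ 2) ≤ 0
    linarith
  have key := glob_id P h hω fun i y hy hyi => by
    by_cases hyb : y ∈ ball x0 (2 * r)
    · rw [tan_XX P h (hT i ⟨y, ⟨hy, hyb⟩, hyi⟩) hy hyi, mul_zero]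
    · simp [ω, hout y hyb]
  have hq1 : ∀ x, max (q x) 0 ≤ 1 := fun x => max_le (by
    have : 0 ≤ ‖x - x0‖ ^ 2 / (4 * r ^ 2) := by positivity
    show 1 - ‖x - x0‖ ^ 2 / (4 * r ^ 2) ≤ 1
    linarith) zero_le_one
  have hin : ∀ x ∈ closedBall x0 r, 3 / 4 ≤ max (q x) 0 := by
    intro x hx
    rw [mem_closedBall, dist_eq_norm] at hx
    refine le_max_of_le_left ?_
    have : ‖x - x0‖ ^ 2 ≤ r ^ 2 := pow_le_pow_left₀ (norm_nonneg _) hx 2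
    have : ‖x - x0‖ ^ 2 / (4 * r ^ 2) ≤ 1 / 4 := by rw [div_le_iff₀ hr2]; linarith
    show 3 / 4 ≤ 1 - ‖x - x0‖ ^ 2 / (4 * r ^ 2)
    linarith
  let S := closedBall x0 (2 * r)
  have hS : MeasurableSet S := measurableSet_closedBall
  have pt : ∀ x, ∑ k, fderiv ℝ ω x (ee k) * XX (D2 x) (D x) (ee k) ≤
      3 * (ω x * trc (D2 x) ^ 2) + 1 / 2 * (ω x * hs2 (D2 x)) + 40 / r ^ 2 * S.indicator (fun x => dd2 (D x)) x := by
    intro x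
    have hd : ∀ w, fderiv ℝ ω x w = 2 * (max (q x) 0) ^ 2 * (-(max (q x) 0) * (⟪x - x0, w⟫ / r ^ 2)) := by
      intro w
      have h1 := ((pos_pow_deriv (k := 3) (by norm_num) (q x)).comp_hasFDerivAt x (hqd x)).fderiv
      have h1' : fderiv ℝ ω x = _ := h1
      rw [h1']
      simp
      rw [inner_sub_left]
      field_simp
      try ring
    by_cases hx : x ∈ S
    · rw [indicator_of_mem hx]
      simp only [hd]
      have := cacc_pt (D2 x) (D x) ((max (q x) 0) ^ 2) (fun k => -(max (q x) 0) * (⟪x - x0, ee k⟫ / r ^ 2)) (L := 2 / r) (by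
        intro k
        rw [abs_mul, abs_neg, abs_of_nonneg (le_max_right _ _), abs_div, abs_of_pos (by positivity : 0 < r ^ 2)]
        have h1 : |⟪x - x0, ee k⟫| ≤ 2 * r := by
          refine (abs_real_inner_le_norm _ _).trans ?_
          have := hx
          rw [mem_closedBall, dist_eq_norm] at this
          simpa using this
        calc _ ≤ 1 * (2 * r / r ^ 2) := by
              gcongr
              exact hq1 x
          _ = 2 / r := by field_simp)
      refine this.trans (le_of_eq ?_)
      simp only [ω]
      ring
    · have : max (q x) 0 = 0 := hout x fun h' => hx (ball_subset_closedBall h')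
      rw [indicator_of_notMem hx]
      simp only [hd, ω, this]
      simp
  have cω : ContinuousOn ω (closure Ω) := hω.continuous.continuousOn
  have cdd : ContinuousOn (fun x => dd2 (D x)) (closure Ω) := cont_dd2.comp_continuousOn h.c1
  have i1 : IntegrableOn (fun x => ω x * trc (D2 x) ^ 2) Ω := P.cont_int (cω.mul (h.ctr.pow 2))
  have i2 : IntegrableOn (fun x => ω x * hs2 (D2 x)) Ω := P.cont_int (cω.mul h.chs)
  have i3 : IntegrableOn (S.indicator fun x => dd2 (D x)) Ω := (P.cont_int cdd).indicator hS
  have i4 : IntegrableOn (fun x => ∑ k, fderiv ℝ ω x (ee k) * XX (D2 x) (D x) (ee k)) Ω := by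
    refine P.cont_int (continuousOn_finsetSum _ fun k _ => ?_)
    exact (((hω.continuous_fderiv (by norm_num)).clm_apply continuous_const).continuousOn).mul (h.cXX _)
  have le1 := setIntegral_mono i4 (((i1.const_mul 3).add (i2.const_mul (1/2))).add (i3.const_mul (40 / r ^ 2))) pt
  rw [← key] at le1
  have e1 : ∫ x in Ω, (3 * (ω x * trc (D2 x) ^ 2) + 1 / 2 * (ω x * hs2 (D2 x)) + 40 / r ^ 2 * S.indicator (fun x => dd2 (D x)) x)
      = 3 * (∫ x in Ω, ω x * trc (D2 x) ^ 2) + 1 / 2 * (∫ x in Ω, ω x * hs2 (D2 x)) + 40 / r ^ 2 * ∫ x in Ω ∩ S, dd2 (D x) := by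
    have i12 : IntegrableOn (fun x => 3 * (ω x * trc (D2 x) ^ 2) + 1 / 2 * (ω x * hs2 (D2 x))) Ω :=
      (i1.const_mul 3).add (i2.const_mul (1/2))
    rw [integral_add i12 (i3.const_mul (40 / r ^ 2)),
      integral_add (i1.const_mul 3) (i2.const_mul (1/2)), integral_const_mul, integral_const_mul, integral_const_mul,
      setIntegral_indicator hS]
  have e2 : ∫ x in Ω, ω x * (hs2 (D2 x) - trc (D2 x) ^ 2) = (∫ x in Ω, ω x * hs2 (D2 x)) - ∫ x in Ω, ω x * trc (D2 x) ^ 2 := by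
    rw [← integral_sub i2 i1]
    congr 1; ext x; ring
  have hs0 : ∀ x, 0 ≤ hs2 (D2 x) := fun x => Finset.sum_nonneg fun _ _ => Finset.sum_nonneg fun _ _ => sq_nonneg _
  have ω0 : ∀ x, 0 ≤ ω x := fun x => pow_nonneg (le_max_right _ _) _
  have b1 : ∫ x in Ω ∩ closedBall x0 r, hs2 (D2 x) ≤ 4 * ∫ x in Ω, ω x * hs2 (D2 x) := by
    rw [← setIntegral_indicator measurableSet_closedBall, ← integral_const_mul]
    refine setIntegral_mono ((P.cont_int h.chs).indicator measurableSet_closedBall) (i2.const_mul 4) fun x => ?_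
    by_cases hx : x ∈ closedBall x0 r
    · rw [indicator_of_mem hx]
      have : (3/4:ℝ) ^ 4 ≤ ω x := pow_le_pow_left₀ (by norm_num) (hin x hx) 4
      norm_num at this
      show hs2 (D2 x) ≤ 4 * (ω x * hs2 (D2 x))
      nlinarith [hs0 x]
    · rw [indicator_of_notMem hx]
      have := mul_nonneg (ω0 x) (hs0 x)
      show 0 ≤ 4 * (ω x * hs2 (D2 x))
      linarith
  have b2 : ∫ x in Ω, ω x * trc (D2 x) ^ 2 ≤ ∫ x in Ω ∩ S, trc (D2 x) ^ 2 := by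
    rw [← setIntegral_indicator hS]
    refine setIntegral_mono i1 (IntegrableOn.indicator (P.cont_int (h.ctr.pow 2)) hS) fun x => ?_
    by_cases hx : x ∈ S
    · rw [indicator_of_mem hx]
      exact mul_le_of_le_one_left (sq_nonneg _) (pow_le_one₀ (le_max_right _ _) (hq1 x))
    · rw [indicator_of_notMem hx]
      have : max (q x) 0 = 0 := hout x fun h' => hx (ball_subset_closedBall h')
      simp [ω, this]
  rw [e2] at le1
  have le2 := le1.trans_eq e1
  have : 320 / r ^ 2 * ∫ x in Ω ∩ S, dd2 (D x) = 8 * (40 / r ^ 2 * ∫ x in Ω ∩ S, dd2 (D x)) := by ring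
  show _ ≤ 32 * (∫ x in Ω ∩ S, trc (D2 x) ^ 2) + 320 / r ^ 2 * ∫ x in Ω ∩ S, dd2 (D x)
  linarith
end
end

section
theorem lin_scale {t : ℝ} (ht : 0 < t) (a : E3) (g : E3 → ℝ≥0∞) :
    ∫⁻ y, g (a + t • y) = ENNReal.ofReal (t ^ 3)⁻¹ * ∫⁻ y, g y := by
  have h1 : ∫⁻ y, g y = ∫⁻ y, g (a + y) := (lintegral_add_left_eq_self _ a).symm
  have h2 := Measure.map_addHaar_smul (volume : Measure E3) ht.ne'
  have hm : MeasurableEmbedding (fun y : E3 => t • y) := (Homeomorph.smulOfNeZero t ht.ne').measurableEmbedding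
  have h3 : ∫⁻ y, g (a + t • y) = ∫⁻ y, g (a + y) ∂(Measure.map (fun y : E3 => t • y) volume) :=
    (hm.lintegral_map (μ := (volume : Measure E3)) (fun y => g (a + y))).symm
  rw [h3, h2, lintegral_smul_measure, h1, smul_eq_mul, show Module.finrank ℝ E3 = 3 from by simp [E3], abs_of_pos (by positivity)]

theorem ps_core {f : E3 → ℝ≥0∞} (hf : Measurable f) {S : Set E3} :
    ∫⁻ x in S, (∫⁻ t in Ioo (0:ℝ) 1, ∫⁻ y in S, f (x + t • (y - x))) ^ (2:ℝ) ≤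
      32 * (volume S) ^ (5 / 3 : ℝ) * (∫⁻ x, f x ^ (3 / 2 : ℝ)) ^ (4 / 3 : ℝ) := by
  set V := volume S with hVd
  set I := ∫⁻ x, f x ^ (3 / 2 : ℝ) with hId
  set g : E3 → ℝ≥0∞ := fun x => f x ^ (3 / 2 : ℝ) with hg
  have hgm : Measurable g := hf.pow_const _
  have hcm : Continuous fun p : (E3 × ℝ) × E3 => p.1.1 + p.1.2 • (p.2 - p.1.1) := by fun_prop
  have hfm : Measurable fun p : (E3 × ℝ) × E3 => f (p.1.1 + p.1.2 • (p.2 - p.1.1)) := hf.comp hcm.measurable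
  have hgm3 : Measurable fun p : (E3 × ℝ) × E3 => g (p.1.1 + p.1.2 • (p.2 - p.1.1)) := hgm.comp hcm.measurable
  let A : E3 → ℝ → ℝ≥0∞ := fun x t => ∫⁻ y in S, f (x + t • (y - x))
  let B : E3 → ℝ → ℝ≥0∞ := fun x t => ∫⁻ y in S, g (x + t • (y - x))
  have hA : Measurable fun p : E3 × ℝ => A p.1 p.2 := hfm.lintegral_prod_right'
  have hB : Measurable fun p : E3 × ℝ => B p.1 p.2 := hgm3.lintegral_prod_right'
  have hAx : ∀ x, Measurable (A x) := fun x => hA.comp (by fun_prop : Measurable fun t : ℝ => (x, t))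
  -- Jensen
  have hAB : ∀ x t, A x t ^ (2:ℝ) ≤ V ^ (2 / 3 : ℝ) * B x t ^ (4 / 3 : ℝ) := by
    intro x t
    have := ENNReal.lintegral_mul_le_Lp_mul_Lq (volume.restrict S) (p := 3 / 2) (q := 3)
      (Real.holderConjugate_iff.2 ⟨by norm_num, by norm_num⟩)
      (f := fun y => f (x + t • (y - x))) (g := fun _ => 1) (by
        apply Measurable.aemeasurable
        exact hf.comp (by fun_prop : Continuous fun y : E3 => x + t • (y - x)).measurable) aemeasurable_const
    simp only [Pi.mul_apply, mul_one, ENNReal.one_rpow, lintegral_const, one_mul, Measure.restrict_apply_univ] at this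
    calc A x t ^ (2:ℝ) ≤ (B x t ^ (1 / (3/2:ℝ)) * V ^ (1/3:ℝ)) ^ (2:ℝ) := ENNReal.rpow_le_rpow this (by norm_num)
      _ = _ := by
        rw [ENNReal.mul_rpow_of_nonneg _ _ (by norm_num), ← ENNReal.rpow_mul, ← ENNReal.rpow_mul, mul_comm]
        norm_num
  have hB1 : ∀ x t, 0 < t → B x t ≤ ENNReal.ofReal (t ^ 3)⁻¹ * I := by
    intro x t ht
    rw [hId, ← lin_scale ht (x - t • x)]
    refine (setLIntegral_le_lintegral _ _).trans (le_of_eq (lintegral_congr fun y => ?_))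
    congr 1
    rw [smul_sub]; abel_nf
  have hB2 : ∀ t ∈ Ioo (0:ℝ) 1, ∫⁻ x in S, B x t ≤ 8 * V * I := by
    intro t ht
    have h8 : ∀ s : ℝ, 1 / 2 ≤ s → ENNReal.ofReal (s ^ 3)⁻¹ ≤ 8 := by
      intro s hs
      rw [show (8:ℝ≥0∞) = ENNReal.ofReal 8 by simp]
      apply ENNReal.ofReal_le_ofReal
      have : (1/2:ℝ) ^ 3 ≤ s ^ 3 := pow_le_pow_left₀ (by norm_num) hs 3
      calc (s ^ 3)⁻¹ ≤ ((1/2:ℝ) ^ 3)⁻¹ := by gcongr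
        _ = 8 := by norm_num
    rcases le_total (1/2) t with h | h
    · calc ∫⁻ x in S, B x t ≤ ∫⁻ x in S, 8 * I := lintegral_mono fun x =>
            (hB1 x t ht.1).trans (mul_le_mul_left (h8 t h) _)
        _ = 8 * V * I := by rw [lintegral_const, Measure.restrict_apply_univ]; ring
    · have hm2 : Measurable fun p : E3 × E3 => g (p.1 + t • (p.2 - p.1)) :=
        hgm.comp (by fun_prop : Continuous fun p : E3 × E3 => p.1 + t • (p.2 - p.1)).measurable
      have hsw : ∫⁻ x in S, B x t = ∫⁻ y in S, ∫⁻ x in S, g (x + t • (y - x)) :=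
        lintegral_lintegral_swap hm2.aemeasurable
      rw [hsw]
      calc _ ≤ ∫⁻ y in S, 8 * I := by
            refine lintegral_mono fun y => ?_
            refine (setLIntegral_le_lintegral _ _).trans ?_
            have : ∀ x : E3, x + t • (y - x) = t • y + (1 - t) • x := fun x => by
              rw [smul_sub, sub_smul, one_smul]; abel
            simp only [this]
            rw [lin_scale (by linarith [ht.2])]
            exact mul_le_mul_left (h8 (1 - t) (by linarith)) _
        _ = 8 * V * I := by rw [lintegral_const, Measure.restrict_apply_univ]; ring
  have hA2 : ∀ t ∈ Ioo (0:ℝ) 1, ∫⁻ x in S, A x t ^ (2:ℝ) ≤ ENNReal.ofReal t⁻¹ * (8 * V ^ (5/3:ℝ) * I ^ (4/3:ℝ)) := by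
    intro t ht
    have e1 : ∀ a : ℝ≥0∞, a ^ (4/3:ℝ) = a * a ^ (1/3:ℝ) := fun a => by
      rw [show (4/3:ℝ) = 1 + 1/3 by norm_num, ENNReal.rpow_add_of_nonneg _ _ (by norm_num) (by norm_num), ENNReal.rpow_one]
    have e2 : ENNReal.ofReal (t ^ 3)⁻¹ ^ (1/3:ℝ) = ENNReal.ofReal t⁻¹ := by
      rw [ENNReal.ofReal_rpow_of_pos (by have := ht.1; positivity), ← inv_pow, ← Real.rpow_natCast,
        ← Real.rpow_mul (inv_nonneg.2 ht.1.le)]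
      norm_num
    have hpt : ∀ x, A x t ^ (2:ℝ) ≤ (V ^ (2/3:ℝ) * (ENNReal.ofReal t⁻¹ * I ^ (1/3:ℝ))) * B x t := by
      intro x
      refine (hAB x t).trans ?_
      rw [e1, mul_assoc, mul_comm (B x t)]
      refine mul_le_mul_right (mul_le_mul_left ?_ _) _
      refine (ENNReal.rpow_le_rpow (hB1 x t ht.1) (by norm_num)).trans_eq ?_
      rw [ENNReal.mul_rpow_of_nonneg _ _ (by norm_num), e2]
    calc _ ≤ ∫⁻ x in S, (V ^ (2/3:ℝ) * (ENNReal.ofReal t⁻¹ * I ^ (1/3:ℝ))) * B x t := lintegral_mono hpt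
      _ = (V ^ (2/3:ℝ) * (ENNReal.ofReal t⁻¹ * I ^ (1/3:ℝ))) * ∫⁻ x in S, B x t :=
          lintegral_const_mul _ (hB.comp (by fun_prop : Measurable fun x : E3 => (x, t)))
      _ ≤ _ := mul_le_mul_right (hB2 t ht) _
      _ = _ := by
        rw [e1 I, show (5/3:ℝ) = 2/3 + 1 by norm_num, ENNReal.rpow_add_of_nonneg _ _ (by norm_num) (by norm_num), ENNReal.rpow_one]
        ring
  -- Cauchy-Schwarz in t
  have hint : ∀ a : ℝ, -1 < a → ∫⁻ t in Ioo (0:ℝ) 1, ENNReal.ofReal (t ^ a) = ENNReal.ofReal (1 / (a + 1)) := by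
    intro a ha
    have h1 := (intervalIntegral.intervalIntegrable_rpow' (a := 0) (b := 1) ha)
    rw [intervalIntegrable_iff_integrableOn_Ioo_of_le zero_le_one] at h1
    rw [← ofReal_integral_eq_lintegral_ofReal h1 ((ae_restrict_mem measurableSet_Ioo).mono fun t ht => Real.rpow_nonneg ht.1.le _),
      ← integral_Ioc_eq_integral_Ioo, ← intervalIntegral.integral_of_le zero_le_one, integral_rpow (Or.inl ha)]
    simp [Real.zero_rpow (by linarith : a + 1 ≠ 0)]
  have hCS : ∀ x, (∫⁻ t in Ioo (0:ℝ) 1, A x t) ^ (2:ℝ) ≤ 2 * ∫⁻ t in Ioo (0:ℝ) 1, ENNReal.ofReal (t ^ (1/2:ℝ)) * A x t ^ (2:ℝ) := by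
    intro x
    have := ENNReal.lintegral_mul_le_Lp_mul_Lq (volume.restrict (Ioo (0:ℝ) 1)) (p := 2) (q := 2)
      (Real.holderConjugate_iff.2 ⟨by norm_num, by norm_num⟩)
      (f := fun t => ENNReal.ofReal (t ^ (-(1/4):ℝ))) (g := fun t => ENNReal.ofReal (t ^ (1/4:ℝ)) * A x t) (by fun_prop)
      (by have := hAx x; fun_prop)
    have e : ∫⁻ t in Ioo (0:ℝ) 1, A x t = ∫⁻ t in Ioo (0:ℝ) 1, ((fun t => ENNReal.ofReal (t ^ (-(1/4):ℝ))) *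
        (fun t => ENNReal.ofReal (t ^ (1/4:ℝ)) * A x t)) t := by
      refine setLIntegral_congr_fun measurableSet_Ioo fun t ht => ?_
      simp only [Pi.mul_apply]
      rw [← mul_assoc, ← ENNReal.ofReal_mul (Real.rpow_nonneg ht.1.le _), ← Real.rpow_add ht.1]
      simp
    have e1 : ∫⁻ t in Ioo (0:ℝ) 1, ENNReal.ofReal (t ^ (-(1/4):ℝ)) ^ (2:ℝ) = 2 := by
      have : ∫⁻ t in Ioo (0:ℝ) 1, ENNReal.ofReal (t ^ (-(1/4):ℝ)) ^ (2:ℝ) = ∫⁻ t in Ioo (0:ℝ) 1, ENNReal.ofReal (t ^ (-(1/2):ℝ)) := by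
        refine setLIntegral_congr_fun measurableSet_Ioo fun t ht => ?_
        rw [ENNReal.ofReal_rpow_of_pos (Real.rpow_pos_of_pos ht.1 _), ← Real.rpow_mul ht.1.le]
        norm_num
      rw [this, hint _ (by norm_num)]
      norm_num
    have e2 : ∫⁻ t in Ioo (0:ℝ) 1, (ENNReal.ofReal (t ^ (1/4:ℝ)) * A x t) ^ (2:ℝ) =
        ∫⁻ t in Ioo (0:ℝ) 1, ENNReal.ofReal (t ^ (1/2:ℝ)) * A x t ^ (2:ℝ) := by
      refine setLIntegral_congr_fun measurableSet_Ioo fun t ht => ?_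
      rw [ENNReal.mul_rpow_of_nonneg _ _ (by norm_num), ENNReal.ofReal_rpow_of_pos (Real.rpow_pos_of_pos ht.1 _), ← Real.rpow_mul ht.1.le]
      norm_num
    rw [← e, e1, e2] at this
    refine (ENNReal.rpow_le_rpow this (by norm_num : (0:ℝ) ≤ 2)).trans_eq ?_
    rw [ENNReal.mul_rpow_of_nonneg _ _ (by norm_num), ← ENNReal.rpow_mul, ← ENNReal.rpow_mul]
    norm_num
  have hmm : Measurable fun p : E3 × ℝ => ENNReal.ofReal (p.2 ^ (1/2:ℝ)) * A p.1 p.2 ^ (2:ℝ) := by fun_prop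
  calc _ ≤ ∫⁻ x in S, 2 * ∫⁻ t in Ioo (0:ℝ) 1, ENNReal.ofReal (t ^ (1/2:ℝ)) * A x t ^ (2:ℝ) := lintegral_mono hCS
    _ = 2 * ∫⁻ t in Ioo (0:ℝ) 1, ∫⁻ x in S, ENNReal.ofReal (t ^ (1/2:ℝ)) * A x t ^ (2:ℝ) := by
      rw [lintegral_const_mul _ hmm.lintegral_prod_right', lintegral_lintegral_swap hmm.aemeasurable]
    _ ≤ 2 * ∫⁻ t in Ioo (0:ℝ) 1, ENNReal.ofReal (t ^ (-(1/2):ℝ)) * (8 * V ^ (5/3:ℝ) * I ^ (4/3:ℝ)) := by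
      refine mul_le_mul_right (setLIntegral_mono' measurableSet_Ioo fun t ht => ?_) _
      rw [lintegral_const_mul' _ _ ENNReal.ofReal_ne_top]
      refine (mul_le_mul_right (hA2 t ht) _).trans_eq ?_
      rw [← mul_assoc, ← ENNReal.ofReal_mul (Real.rpow_nonneg ht.1.le _), ← Real.rpow_neg_one, ← Real.rpow_add ht.1]
      norm_num
    _ = _ := by
      rw [lintegral_mul_const _ (by fun_prop), hint _ (by norm_num)]
      norm_num
      ring
end

section
theorem ps_avg {f : E3 → ℝ≥0∞} (hf : Measurable f) {S S' : Set E3} (hS : MeasurableSet S)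
    (hSS : S' ⊆ S) (h0 : volume S' ≠ 0) (hV : volume S ≠ ⊤) {κ : ℝ≥0∞} (hκ : volume S ≤ κ * volume S')
    {h : E3 → ℝ} (hi : IntegrableOn h S') (hS' : MeasurableSet S')
    (hh : ∀ x ∈ S, ∀ y ∈ S', ENNReal.ofReal |h x - h y| ≤ ∫⁻ t in Ioo (0:ℝ) 1, f (x + t • (y - x))) :
    ∫⁻ x in S, ENNReal.ofReal ((h x - ⨍ y in S', h y) ^ 2) ≤
      κ ^ 2 * 32 * (volume S) ^ (-(1 / 3) : ℝ) * (∫⁻ x, f x ^ (3 / 2 : ℝ)) ^ (4 / 3 : ℝ) := by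
  set c := ⨍ y in S', h y with hc
  set V := volume S
  have hV0 : V ≠ 0 := fun h => h0 (measure_mono_null hSS h)
  have hT' : volume S' ≠ ⊤ := ne_top_of_le_ne_top hV (measure_mono hSS)
  have hfin : IsFiniteMeasure (volume.restrict S') := ⟨by simpa using hT'.lt_top⟩
  have hinv : (volume S')⁻¹ ≤ κ * V⁻¹ := by
    rw [ENNReal.inv_le_iff_inv_le, ENNReal.mul_inv (Or.inr (ENNReal.inv_ne_top.2 hV0)) (Or.inr (ENNReal.inv_ne_zero.2 hV)), inv_inv]
    by_cases hk : κ = ⊤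
    · simp [hk]
    · have hk0 : κ ≠ 0 := fun h => hV0 (by simpa [h] using hκ)
      calc κ⁻¹ * V ≤ κ⁻¹ * (κ * volume S') := mul_le_mul_right hκ _
        _ = volume S' := by rw [← mul_assoc, ENNReal.inv_mul_cancel hk0 hk, one_mul]
  have hcm : Continuous fun p : (E3 × ℝ) × E3 => p.1.1 + p.1.2 • (p.2 - p.1.1) := by fun_prop
  have hfm : Measurable fun p : (E3 × ℝ) × E3 => f (p.1.1 + p.1.2 • (p.2 - p.1.1)) := hf.comp hcm.measurable
  have hpt : ∀ x ∈ S, ENNReal.ofReal ((h x - c) ^ 2) ≤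
      (κ * V⁻¹) ^ 2 * (∫⁻ t in Ioo (0:ℝ) 1, ∫⁻ y in S, f (x + t • (y - x))) ^ (2:ℝ) := by
    intro x hx
    have h1 : ENNReal.ofReal |h x - c| ≤ (volume S')⁻¹ * ∫⁻ y in S', ENNReal.ofReal |h x - h y| := by
      have e1 : h x - c = (volume S').toReal⁻¹ * ∫ y in S', (h x - h y) := by
        rw [integral_sub (integrable_const _) hi, hc, setAverage_eq, integral_const]
        have : (volume S').toReal ≠ 0 := ENNReal.toReal_ne_zero.2 ⟨h0, hT'⟩
        simp only [Measure.real, Measure.restrict_apply_univ, smul_eq_mul]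
        field_simp
      rw [e1, abs_mul, abs_of_nonneg (by positivity), ENNReal.ofReal_mul (by positivity),
        ENNReal.ofReal_inv_of_pos (ENNReal.toReal_pos h0 hT'), ENNReal.ofReal_toReal hT']
      refine mul_le_mul_right ?_ _
      have := enorm_integral_le_lintegral_enorm (μ := volume.restrict S') fun y => h x - h y
      simpa only [Real.enorm_eq_ofReal_abs] using this
    have h2 : ∫⁻ y in S', ENNReal.ofReal |h x - h y| ≤ ∫⁻ t in Ioo (0:ℝ) 1, ∫⁻ y in S, f (x + t • (y - x)) := by
      calc _ ≤ ∫⁻ y in S', ∫⁻ t in Ioo (0:ℝ) 1, f (x + t • (y - x)) := setLIntegral_mono' hS' (hh x hx)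
        _ ≤ ∫⁻ y in S, ∫⁻ t in Ioo (0:ℝ) 1, f (x + t • (y - x)) := lintegral_mono_set hSS
        _ = _ := lintegral_lintegral_swap (Measurable.aemeasurable (hfm.comp
            (by fun_prop : Measurable fun p : E3 × ℝ => ((x, p.2), p.1))))
    calc ENNReal.ofReal ((h x - c) ^ 2) = ENNReal.ofReal |h x - c| ^ 2 := by
          rw [← ENNReal.ofReal_pow (abs_nonneg _), sq_abs]
      _ ≤ (κ * V⁻¹ * ∫⁻ t in Ioo (0:ℝ) 1, ∫⁻ y in S, f (x + t • (y - x))) ^ 2 :=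
          pow_le_pow_left' (h1.trans (mul_le_mul' hinv h2)) 2
      _ = _ := by rw [mul_pow, ENNReal.rpow_two]
  calc _ ≤ ∫⁻ x in S, (κ * V⁻¹) ^ 2 * (∫⁻ t in Ioo (0:ℝ) 1, ∫⁻ y in S, f (x + t • (y - x))) ^ (2:ℝ) :=
        setLIntegral_mono' hS hpt
    _ = (κ * V⁻¹) ^ 2 * ∫⁻ x in S, (∫⁻ t in Ioo (0:ℝ) 1, ∫⁻ y in S, f (x + t • (y - x))) ^ (2:ℝ) := by
        refine lintegral_const_mul _ (Measurable.pow_const ?_ _)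
        have hA : Measurable fun p : E3 × ℝ => ∫⁻ y in S, f (p.1 + p.2 • (y - p.1)) := hfm.lintegral_prod_right'
        exact hA.lintegral_prod_right'
    _ ≤ (κ * V⁻¹) ^ 2 * (32 * V ^ (5 / 3 : ℝ) * (∫⁻ x, f x ^ (3 / 2 : ℝ)) ^ (4 / 3 : ℝ)) :=
        mul_le_mul_right (ps_core hf) _
    _ = _ := by
        rw [mul_pow, show (-(1/3):ℝ) = -2 + 5/3 by norm_num, ENNReal.rpow_add _ _ hV0 hV, ENNReal.rpow_neg, ENNReal.rpow_two,
          ENNReal.inv_pow]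
        ring

theorem ps_zero {f : E3 → ℝ≥0∞} (hf : Measurable f) {S S' : Set E3} (hS : MeasurableSet S)
    (hSS : S' ⊆ S) (h0 : volume S' ≠ 0) (hV : volume S ≠ ⊤) {κ : ℝ≥0∞} (hκ : volume S ≤ κ * volume S')
    {h : E3 → ℝ} (hi : IntegrableOn h S') (hS' : MeasurableSet S')
    (hh : ∀ x ∈ S, ∀ y ∈ S', ENNReal.ofReal |h x - h y| ≤ ∫⁻ t in Ioo (0:ℝ) 1, f (x + t • (y - x)))
    (hz : ∫⁻ y in S', ENNReal.ofReal |h y| ≤ ∫⁻ x in S, f x) :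
    ∫⁻ x in S, ENNReal.ofReal (h x ^ 2) ≤
      κ ^ 2 * 66 * (volume S) ^ (-(1 / 3) : ℝ) * (∫⁻ x, f x ^ (3 / 2 : ℝ)) ^ (4 / 3 : ℝ) := by
  have key := ps_avg hf hS hSS h0 hV hκ hi hS' hh
  set c := ⨍ y in S', h y with hc
  set V := volume S with hVd
  have hV0 : V ≠ 0 := fun h => h0 (measure_mono_null hSS h)
  have hT' : volume S' ≠ ⊤ := ne_top_of_le_ne_top hV (measure_mono hSS)
  have hinv : (volume S')⁻¹ ≤ κ * V⁻¹ := by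
    rw [ENNReal.inv_le_iff_inv_le, ENNReal.mul_inv (Or.inr (ENNReal.inv_ne_top.2 hV0)) (Or.inr (ENNReal.inv_ne_zero.2 hV)), inv_inv]
    by_cases hk : κ = ⊤
    · simp [hk]
    · have hk0 : κ ≠ 0 := fun h => hV0 (by simpa [h] using hκ)
      calc κ⁻¹ * V ≤ κ⁻¹ * (κ * volume S') := mul_le_mul_right hκ _
        _ = volume S' := by rw [← mul_assoc, ENNReal.inv_mul_cancel hk0 hk, one_mul]
  set I := ∫⁻ x, f x ^ (3 / 2 : ℝ) with hI
  have hold : ∫⁻ x in S, f x ≤ I ^ (2/3:ℝ) * V ^ (1/3:ℝ) := by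
    have := ENNReal.lintegral_mul_le_Lp_mul_Lq (volume.restrict S) (p := 3 / 2) (q := 3)
      (Real.holderConjugate_iff.2 ⟨by norm_num, by norm_num⟩) (f := f) (g := fun _ => 1) hf.aemeasurable aemeasurable_const
    simp only [Pi.mul_apply, mul_one, ENNReal.one_rpow, lintegral_const, one_mul, Measure.restrict_apply_univ] at this
    refine this.trans (mul_le_mul_left ?_ _)
    rw [show (1 / (3/2) : ℝ) = 2/3 by norm_num]
    exact ENNReal.rpow_le_rpow (setLIntegral_le_lintegral _ _) (by norm_num)
  have h1 : ENNReal.ofReal |c| ≤ κ * V⁻¹ * (I ^ (2/3:ℝ) * V ^ (1/3:ℝ)) := by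
    rw [hc, setAverage_eq, smul_eq_mul, abs_mul, abs_of_nonneg (by positivity), ENNReal.ofReal_mul (by positivity), Measure.real,
        ENNReal.ofReal_inv_of_pos (ENNReal.toReal_pos h0 hT'), ENNReal.ofReal_toReal hT']
    refine mul_le_mul' hinv (le_trans ?_ (hz.trans hold))
    have := enorm_integral_le_lintegral_enorm (μ := volume.restrict S') h
    simpa only [Real.enorm_eq_ofReal_abs] using this
  have h2 : ENNReal.ofReal (c ^ 2) * V ≤ κ ^ 2 * V ^ (-(1 / 3) : ℝ) * I ^ (4 / 3 : ℝ) := by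
    calc _ = ENNReal.ofReal |c| ^ 2 * V := by rw [← ENNReal.ofReal_pow (abs_nonneg _), sq_abs]
      _ ≤ (κ * V⁻¹ * (I ^ (2/3:ℝ) * V ^ (1/3:ℝ))) ^ 2 * V := mul_le_mul_left (pow_le_pow_left' h1 2) _
      _ = _ := by
        simp only [mul_pow]
        rw [← ENNReal.rpow_two (I ^ _), ← ENNReal.rpow_mul, ← ENNReal.rpow_two (V ^ _), ← ENNReal.rpow_mul,
          show (-(1/3):ℝ) = -2 + (1/3*2 + 1) by norm_num, ENNReal.rpow_add _ _ hV0 hV, ENNReal.rpow_add _ _ hV0 hV,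
          ENNReal.rpow_neg, ENNReal.rpow_two, ENNReal.rpow_one, ENNReal.inv_pow]
        norm_num
        ring
  calc _ ≤ ∫⁻ x in S, (2 * ENNReal.ofReal ((h x - c) ^ 2) + 2 * ENNReal.ofReal (c ^ 2)) := by
        refine lintegral_mono fun x => ?_
        rw [two_ofR, two_ofR, ← ENNReal.ofReal_add (by positivity) (by positivity)]
        apply ENNReal.ofReal_le_ofReal
        nlinarith [sq_nonneg (h x - 2 * c)]
    _ = 2 * (∫⁻ x in S, ENNReal.ofReal ((h x - c) ^ 2)) + 2 * (ENNReal.ofReal (c ^ 2) * V) := by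
        rw [lintegral_add_right _ measurable_const, lintegral_const, Measure.restrict_apply_univ, lintegral_const_mul' _ _ (by norm_num), mul_assoc]
    _ ≤ 2 * (κ ^ 2 * 32 * V ^ (-(1 / 3) : ℝ) * I ^ (4 / 3 : ℝ)) + 2 * (κ ^ 2 * V ^ (-(1 / 3) : ℝ) * I ^ (4 / 3 : ℝ)) := by gcongr
    _ = _ := by ring
end

section
section
variable {ι : Type} {Ω : Set E3}

theorem hs2_nn (M : BL) : 0 ≤ hs2 M := Finset.sum_nonneg fun _ _ => Finset.sum_nonneg fun _ _ => sq_nonneg _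

theorem hs2_bd (M : BL) (u w : E3) : |M u w| ≤ ‖u‖ * ‖w‖ * √(hs2 M) := by
  have hn : ∀ u : E3, ‖u‖ ^ 2 = ∑ i, u i ^ 2 := fun u => by
    rw [EuclideanSpace.norm_sq_eq]; simp
  have e1 : M u w = ∑ i, u i * M (ee i) w := by
    conv_lhs => rw [← e_sum u]
    simp [map_sum]
  have e2 : ∀ i, M (ee i) w = ∑ j, w j * M (ee i) (ee j) := fun i => by
    conv_lhs => rw [← e_sum w]
    simp [map_sum]
  have h1 : (M u w) ^ 2 ≤ ‖u‖ ^ 2 * (‖w‖ ^ 2 * hs2 M) := by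
    rw [e1, hn u]
    refine (Finset.sum_mul_sq_le_sq_mul_sq _ _ _).trans (mul_le_mul_of_nonneg_left ?_ (by positivity))
    rw [hs2, Finset.mul_sum]
    refine Finset.sum_le_sum fun i _ => ?_
    rw [e2, hn w]
    exact Finset.sum_mul_sq_le_sq_mul_sq _ _ _
  apply abs_le_of_sq_le_sq _ (by positivity)
  calc _ ≤ _ := h1
    _ = _ := by rw [mul_pow, Real.sq_sqrt (hs2_nn M)]; ring

theorem meas_ind {S : Set E3} (hS : MeasurableSet S) {f : E3 → ℝ} (hf : ContinuousOn f S) : Measurable (S.indicator f) := by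
  classical
  rw [← Set.piecewise_eq_indicator]
  exact hf.measurable_piecewise continuousOn_const hS

theorem path_bd (P : HPoly ι Ω) {D : E3 → E3 →L[ℝ] ℝ} {D2 : E3 → BL} (h : CF Ω D D2) {x e : E3} (w : E3)
    (hx : x ∈ Ω) {L : ℝ} (hL : 0 < L) (hy : x + L • e ∈ closure Ω) :
    (∀ s ∈ Ico (0:ℝ) L, x + s • e ∈ Ω) ∧ ENNReal.ofReal |D x w - D (x + L • e) w| ≤
      ∫⁻ s in Ioo (0:ℝ) L, ENNReal.ofReal (‖e‖ * ‖w‖ * √(hs2 (D2 (x + s • e)))) := by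
  have hin : ∀ s ∈ Ico (0:ℝ) L, x + s • e ∈ Ω := by
    intro s hs
    rw [P.mem]
    intro i
    have h1 := P.mem.1 hx i
    have h2 := P.mem_cl.1 hy i
    rw [P.l_add, inner_smul_right] at *
    have := hs.1
    have := hs.2
    by_contra hc
    nlinarith
  refine ⟨hin, ?_⟩
  have hcl : ∀ s ∈ Icc (0:ℝ) L, x + s • e ∈ closure Ω := by
    intro s hs
    rcases hs.2.lt_or_eq with h' | h'
    · exact subset_closure (hin s ⟨hs.1, h'⟩)
    · rwa [h']
  have hlc : Continuous fun s : ℝ => x + s • e := by fun_prop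
  have hc1 : ContinuousOn (fun s : ℝ => D (x + s • e) w) (Icc 0 L) :=
    (h.c1.comp hlc.continuousOn hcl).clm_apply continuousOn_const
  have hc2 : ContinuousOn (fun s : ℝ => D2 (x + s • e) e w) (Icc 0 L) :=
    ((h.c2.comp hlc.continuousOn hcl).clm_apply continuousOn_const).clm_apply continuousOn_const
  have hd : ∀ s ∈ Ioo (0:ℝ) L, HasDerivAt (fun s : ℝ => D (x + s • e) w) (D2 (x + s • e) e w) s := by
    intro s hs
    have h1 : HasDerivAt (fun s : ℝ => x + s • e) e s := by
      simpa using ((hasDerivAt_id s).smul_const e).const_add x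
    have h2 := HasFDerivAt.comp_hasDerivAt s (h.at P.op (hin s ⟨hs.1.le, hs.2⟩)) h1
    have := h2.clm_apply (hasDerivAt_const s w)
    simpa using this
  have hint : IntervalIntegrable (fun s : ℝ => D2 (x + s • e) e w) volume 0 L := by
    apply ContinuousOn.intervalIntegrable
    rwa [uIcc_of_le hL.le]
  have key := intervalIntegral.integral_eq_sub_of_hasDerivAt_of_le hL.le hc1 hd hint
  simp only [zero_smul, add_zero] at key
  rw [abs_sub_comm, ← key, intervalIntegral.integral_of_le hL.le, integral_Ioc_eq_integral_Ioo]
  have := enorm_integral_le_lintegral_enorm (μ := volume.restrict (Ioo 0 L)) fun s : ℝ => D2 (x + s • e) e w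
  simp only [Real.enorm_eq_ofReal_abs] at this
  refine this.trans (lintegral_mono fun s => ENNReal.ofReal_le_ofReal ?_)
  exact hs2_bd _ _ _

theorem HPoly.geoA (P : HPoly ι Ω) : ∃ σ > 0, ∃ r0 > 0, ∀ x0 ∈ Ω, ∀ r : ℝ, 0 < r → r ≤ r0 →
    ∃ p, closedBall p (σ * r) ⊆ Ω ∩ closedBall x0 (5 * r) := by
  obtain ⟨ρ, hρ, hball⟩ := Metric.nhds_basis_closedBall.mem_iff.1 (P.op.mem_nhds P.ho)
  obtain ⟨d0, hd0⟩ := Metric.isBounded_iff.1 P.bdd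
  set d := max d0 1
  have hd : 0 < d := by positivity
  refine ⟨ρ / d, by positivity, d, hd, fun x0 hx0 r hr hrd => ⟨x0 + (r / d) • (P.o - x0), fun x hx => ?_⟩⟩
  set τ := r / d with hτd
  have hτ : 0 < τ := by positivity
  have hτ1 : τ ≤ 1 := (div_le_one hd).2 hrd
  set z := P.o + τ⁻¹ • (x - (x0 + τ • (P.o - x0))) with hz
  have hxz : x = x0 + τ • (z - x0) := by
    rw [hz, smul_sub, smul_add, smul_smul, mul_inv_cancel₀ hτ.ne', one_smul, smul_sub]
    abel
  have hzΩ : z ∈ Ω := hball (by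
    rw [mem_closedBall, dist_eq_norm, hz, add_sub_cancel_left, norm_smul, norm_inv, Real.norm_of_nonneg hτ.le]
    rw [mem_closedBall, dist_eq_norm] at hx
    rw [inv_mul_le_iff₀ hτ]
    calc _ ≤ _ := hx
      _ = _ := by rw [hτd]; ring)
  rw [hxz]
  constructor
  · rw [P.mem]
    intro i
    rw [P.l_comb]
    have := P.mem.1 hx0 i
    have := P.mem.1 hzΩ i
    nlinarith
  · rw [mem_closedBall, dist_eq_norm, add_sub_cancel_left, norm_smul, Real.norm_of_nonneg hτ.le]
    have h1 := (hd0 hzΩ hx0).trans (le_max_left d0 1)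
    rw [dist_eq_norm] at h1
    calc _ ≤ τ * d := by gcongr
      _ = r := by rw [hτd]; field_simp
      _ ≤ 5 * r := by linarith

theorem HPoly.geoF [Fintype ι] (P : HPoly ι Ω) : ∃ σ > 0, ∃ r0 > 0, ∀ i x0 y, ∀ r : ℝ, 0 < r → r ≤ r0 →
    y ∈ closure Ω → P.l i y = 0 → y ∈ ball x0 (2 * r) →
    ∃ p, ∀ x ∈ closedBall p (σ * r), 0 < P.l i x ∧ P.l i x ≤ r ∧ ∀ s, 0 ≤ s → s ≤ P.l i x →
      x + s • (-P.n i) ∈ closedBall x0 (5 * r) ∧ x + s • (-P.n i) ∈ closure Ω ∧ (s < P.l i x → x + s • (-P.n i) ∈ Ω) := by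
  obtain ⟨θ, hθ, hθl⟩ : ∃ θ : ℝ, 0 < θ ∧ ∀ i j, j ≠ i → 2 * θ ≤ P.l j (P.a i) := by
    have : ∀ᶠ θ : ℝ in nhdsWithin 0 (Ioi 0), ∀ i j, j ≠ i → 2 * θ ≤ P.l j (P.a i) := by
      refine Filter.Eventually.filter_mono nhdsWithin_le_nhds ?_
      refine Filter.eventually_all.2 fun i => Filter.eventually_all.2 fun j => ?_
      by_cases hj : j = i
      · simp [hj]
      · have hc : Continuous fun s : ℝ => 2 * s := by fun_prop
        have := (hc.continuousAt (x := 0)).eventually_lt continuousAt_const (show 2 * (0:ℝ) < P.l j (P.a i) by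
          simpa using P.l_a_pos i j hj)
        filter_upwards [this] with s hs _ using hs.le
    obtain ⟨θ, h1, h2⟩ := (this.and (self_mem_nhdsWithin (s := Ioi (0:ℝ)))).exists
    exact ⟨θ, h2, h1⟩
  obtain ⟨d0, hd0⟩ := Metric.isBounded_iff.1 P.bdd.closure
  have hacl : ∀ i, P.a i ∈ closure Ω := fun i => P.mem_cl.2 fun j => by
    by_cases hj : j = i
    · rw [hj, P.l_a]
    · exact (P.l_a_pos i j hj).le
  set d := max d0 0 + 2 * θ with hdd
  have hd : 0 < d := by positivity
  refine ⟨θ / (4 * d), by positivity, d, hd, fun i x0 y r hr hrd hy hyi hyb => ?_⟩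
  set τ := r / d with hτd
  have hτ : 0 < τ := by positivity
  have hτ1 : τ ≤ 1 := (div_le_one hd).2 hrd
  have hτr : τ * d = r := by rw [hτd]; field_simp
  set n := P.n i with hn
  have nn : ⟪n, n⟫ = 1 := by rw [real_inner_self_eq_norm_sq, P.unit]; norm_num
  set p := y + τ • (P.a i + (θ / 2) • n - y) with hp
  refine ⟨p, fun x hx => ?_⟩
  set z := τ⁻¹ • (x - p) with hz
  have hzn : ‖z‖ ≤ θ / 4 := by
    rw [hz, norm_smul, norm_inv, Real.norm_of_nonneg hτ.le, inv_mul_le_iff₀ hτ]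
    rw [mem_closedBall, dist_eq_norm] at hx
    calc _ ≤ _ := hx
      _ = _ := by rw [hτd]; field_simp
  have hxz : x = y + τ • (P.a i + ((θ / 2) • n + z) - y) := by
    have : τ • z = x - p := by rw [hz, smul_smul, mul_inv_cancel₀ hτ.ne', one_smul]
    have h2 : τ • (P.a i + ((θ / 2) • n + z) - y) = τ • (P.a i + (θ / 2) • n - y) + τ • z := by
      rw [← smul_add]; congr 1; abel
    rw [h2, this, hp]; abel
  have hzi : |⟪n, z⟫| ≤ θ / 4 := by
    refine (abs_real_inner_le_norm _ _).trans ?_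
    rw [P.unit, one_mul]; exact hzn
  have hl : P.l i x = τ * (θ / 2 + ⟪n, z⟫) := by
    rw [hxz, P.l_comb, hyi, P.l_add, P.l_a, inner_add_right, inner_smul_right, ← hn, nn]; ring
  have hz1 := abs_le.1 hzi
  have hl2 : P.l i x ≤ τ * (3 / 4 * θ) := by rw [hl]; gcongr; linarith
  have hθd : 3 / 4 * θ ≤ d := by
    have := le_max_right d0 0
    linarith
  refine ⟨by rw [hl]; apply mul_pos hτ; linarith, hl2.trans (by rw [← hτr]; gcongr), fun s hs0 hs1 => ?_⟩
  set q := P.a i + ((θ / 2) • n + z + (-(s / τ)) • n) with hq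
  have hxs : x + s • (-n) = y + τ • (q - y) := by
    have h2 : τ • (q - y) = τ • (P.a i + ((θ / 2) • n + z) - y) + τ • ((-(s / τ)) • n) := by
      rw [← smul_add, hq]; congr 1; abel
    rw [h2, hxz, smul_smul, show τ * -(s / τ) = -s by field_simp, neg_smul, smul_neg]; abel
  have hsτ : s / τ ≤ 3 / 4 * θ := by rw [div_le_iff₀ hτ]; linarith
  have hqa : ‖q - P.a i‖ ≤ 3 / 2 * θ := by
    rw [hq, add_sub_cancel_left]
    refine (norm_add_le _ _).trans ?_
    have h1 : ‖(θ / 2) • n + z‖ ≤ θ / 2 + θ / 4 := by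
      refine (norm_add_le _ _).trans (add_le_add ?_ hzn)
      rw [norm_smul, P.unit, mul_one, Real.norm_of_nonneg (by positivity)]
    have h2 : ‖(-(s / τ)) • n‖ ≤ 3 / 4 * θ := by
      rw [norm_smul, P.unit, mul_one, norm_neg, Real.norm_of_nonneg (by positivity)]; exact hsτ
    linarith
  have hlj : ∀ j, j ≠ i → 0 < P.l j (x + s • (-n)) := by
    intro j hj
    rw [hxs, P.l_comb]
    have h1 := P.mem_cl.1 hy j
    have h2 : 0 < P.l j q := by
      have := abs_le.1 ((P.l_lip j q (P.a i)).trans hqa)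
      have := hθl i j hj
      linarith
    nlinarith
  have hli : P.l i (x + s • (-n)) = P.l i x - s := by
    rw [P.l_add, inner_smul_right, inner_neg_right, ← hn, nn]; ring
  refine ⟨?_, P.mem_cl.2 fun j => ?_, fun hs => P.mem.2 fun j => ?_⟩
  · rw [mem_closedBall, dist_eq_norm, hxs]
    have h1 : ‖τ • (q - y)‖ ≤ r := by
      rw [norm_smul, Real.norm_of_nonneg hτ.le, ← hτr]
      gcongr
      have h2 : ‖P.a i - y‖ ≤ d0 := by rw [← dist_eq_norm]; exact hd0 (hacl i) hy
      calc ‖q - y‖ = ‖(q - P.a i) + (P.a i - y)‖ := by congr 1; abel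
        _ ≤ 3 / 2 * θ + d0 := (norm_add_le _ _).trans (add_le_add hqa h2)
        _ ≤ d := by have := le_max_left d0 0; linarith
    rw [mem_ball, dist_eq_norm] at hyb
    calc _ = ‖(y - x0) + τ • (q - y)‖ := by congr 1; abel
      _ ≤ _ := norm_add_le _ _
      _ ≤ _ := by linarith
  · by_cases hj : j = i
    · rw [hj, hli]; linarith
    · exact (hlj j hj).le
  · by_cases hj : j = i
    · rw [hj, hli]; linarith
    · exact hlj j hj
end
end

section
section
variable {ι : Type} {Ω : Set E3}

def KK (σ W : ℝ) : ℝ := 66 * (125 / σ ^ 3) ^ 2 * (100 * W ^ 2) / σ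

theorem ps_cf (P : HPoly ι Ω) {D : E3 → E3 →L[ℝ] ℝ} {D2 : E3 → BL} (h : CF Ω D D2) {x0 p w : E3} {r σ W : ℝ}
    (hr : 0 < r) (hσ : 0 < σ) (hp : closedBall p (σ * r) ⊆ Ω ∩ closedBall x0 (5 * r)) (hw : ‖w‖ ≤ W) :
    (∃ c, ∫⁻ x in Ω ∩ closedBall x0 (5 * r), ENNReal.ofReal ((D x w - c) ^ 2) ≤ ENNReal.ofReal (KK σ W * r) *
      (∫⁻ x in Ω ∩ closedBall x0 (5 * r), ENNReal.ofReal (√(hs2 (D2 x)) ^ (3 / 2 : ℝ))) ^ (4 / 3 : ℝ)) ∧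
    ∀ i, (∀ x ∈ closedBall p (σ * r), 0 < P.l i x ∧ P.l i x ≤ r ∧ ∀ s, 0 ≤ s → s ≤ P.l i x →
      x + s • (-P.n i) ∈ closedBall x0 (5 * r) ∧ x + s • (-P.n i) ∈ closure Ω ∧ (s < P.l i x → x + s • (-P.n i) ∈ Ω)) →
      (∀ y ∈ closure Ω, P.l i y = 0 → D y w = 0) →
      ∫⁻ x in Ω ∩ closedBall x0 (5 * r), ENNReal.ofReal (D x w ^ 2) ≤ ENNReal.ofReal (KK σ W * r) *
      (∫⁻ x in Ω ∩ closedBall x0 (5 * r), ENNReal.ofReal (√(hs2 (D2 x)) ^ (3 / 2 : ℝ))) ^ (4 / 3 : ℝ) := by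
  set S := Ω ∩ closedBall x0 (5 * r) with hS
  set S' := closedBall p (σ * r) with hS'
  have hSm : MeasurableSet S := P.op.measurableSet.inter measurableSet_closedBall
  have hSm' : MeasurableSet S' := measurableSet_closedBall
  have hW : 0 ≤ W := (norm_nonneg w).trans hw
  let N : E3 → ℝ := fun x => √(hs2 (D2 x))
  have hN0 : ∀ x, 0 ≤ N x := fun x => Real.sqrt_nonneg _
  have hNc : ContinuousOn N S := (h.chs.sqrt).mono (inter_subset_left.trans subset_closure)
  let g : E3 → ℝ≥0∞ := fun x => ENNReal.ofReal (W * S.indicator N x)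
  have hgm : Measurable g := ((meas_ind hSm hNc).const_mul W).ennreal_ofReal
  let f : E3 → ℝ≥0∞ := fun x => ENNReal.ofReal (10 * r) * g x
  have hfm : Measurable f := hgm.const_mul _
  have hVS' : volume S' = ENNReal.ofReal (vB * (σ * r) ^ 3) := vol_cb' _ (by positivity)
  have hvB := vB_one
  have h0 : volume S' ≠ 0 := by rw [hVS']; simp; positivity
  have hV5 : volume S ≤ ENNReal.ofReal (vB * (5 * r) ^ 3) := by
    rw [← vol_cb' x0 (by positivity)]; exact measure_mono inter_subset_right
  have hV : volume S ≠ ⊤ := ne_top_of_le_ne_top ENNReal.ofReal_ne_top hV5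
  have hκ : volume S ≤ ENNReal.ofReal (125 / σ ^ 3) * volume S' := by
    refine hV5.trans_eq ?_
    rw [hVS', ← ENNReal.ofReal_mul (by positivity)]
    congr 1; field_simp; norm_num
  have hi : IntegrableOn (fun x => D x w) S' := by
    refine (P.cont_int (h.c1.clm_apply continuousOn_const)).mono_set (hp.trans inter_subset_left)
  have hh : ∀ x ∈ S, ∀ y ∈ S', ENNReal.ofReal |D x w - D y w| ≤ ∫⁻ t in Ioo (0:ℝ) 1, f (x + t • (y - x)) := by
    intro x hx y hy
    have hyS := hp hy
    obtain ⟨h1, h2⟩ := path_bd P h w hx.1 one_pos (e := y - x) (by simpa using subset_closure hyS.1)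
    simp only [one_smul, add_sub_cancel] at h2
    refine h2.trans (setLIntegral_mono' measurableSet_Ioo fun t ht => ?_)
    have hm : x + t • (y - x) ∈ S := ⟨h1 t ⟨ht.1.le, ht.2⟩, by
      have := (convex_closedBall x0 (5 * r)).add_smul_sub_mem hx.2 hyS.2 ⟨ht.1.le, ht.2.le⟩
      exact this⟩
    simp only [f, g, indicator_of_mem hm]
    rw [← ENNReal.ofReal_mul (by positivity), ← mul_assoc]
    apply ENNReal.ofReal_le_ofReal
    have hd : ‖y - x‖ ≤ 10 * r := by
      have e1 := hx.2
      have e2 := hyS.2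
      rw [mem_closedBall] at e1 e2
      rw [← dist_eq_norm]
      have := dist_triangle_right y x x0
      linarith
    have := hN0 (x + t • (y - x))
    simp only [N] at *
    gcongr
  have hfin : (ENNReal.ofReal (125 / σ ^ 3)) ^ 2 * 66 * (volume S) ^ (-(1 / 3) : ℝ) * (∫⁻ x, f x ^ (3 / 2 : ℝ)) ^ (4 / 3 : ℝ) ≤
      ENNReal.ofReal (KK σ W * r) * (∫⁻ x in S, ENNReal.ofReal (N x ^ (3 / 2 : ℝ))) ^ (4 / 3 : ℝ) := by
    have e1 : ∫⁻ x, f x ^ (3 / 2 : ℝ) = ENNReal.ofReal (10 * r * W) ^ (3 / 2 : ℝ) * ∫⁻ x in S, ENNReal.ofReal (N x ^ (3 / 2 : ℝ)) := by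
      rw [← lintegral_indicator hSm, ← lintegral_const_mul' _ _ (ENNReal.rpow_ne_top_of_nonneg (by norm_num) ENNReal.ofReal_ne_top)]
      refine lintegral_congr fun x => ?_
      by_cases hx : x ∈ S
      · simp only [f, g, indicator_of_mem hx]
        rw [← ENNReal.ofReal_mul (by positivity), ← mul_assoc, ENNReal.ofReal_mul (by positivity),
          ENNReal.mul_rpow_of_nonneg _ _ (by norm_num), ENNReal.ofReal_rpow_of_nonneg (hN0 x) (by norm_num)]
      · simp [f, g, hx]
    have e2 : (ENNReal.ofReal (10 * r * W) ^ (3 / 2 : ℝ)) ^ (4 / 3 : ℝ) = ENNReal.ofReal (100 * W ^ 2 * r ^ 2) := by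
      rw [← ENNReal.rpow_mul, show (3/2 * (4/3) : ℝ) = 2 by norm_num, ENNReal.rpow_two, ← ENNReal.ofReal_pow (by positivity)]
      congr 1; ring
    have e3 : (volume S) ^ (-(1 / 3) : ℝ) ≤ ENNReal.ofReal (1 / (σ * r)) := by
      rw [ENNReal.rpow_neg, one_div (σ * r), ENNReal.ofReal_inv_of_pos (by positivity), ENNReal.inv_le_inv]
      have : ENNReal.ofReal (σ * r) = ENNReal.ofReal ((σ * r) ^ 3) ^ (1/3:ℝ) := by
        rw [ENNReal.ofReal_rpow_of_nonneg (by positivity) (by norm_num), ← Real.rpow_natCast, ← Real.rpow_mul (by positivity)]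
        norm_num
      rw [this]
      refine ENNReal.rpow_le_rpow (le_trans ?_ (measure_mono hp)) (by norm_num)
      rw [hVS']
      apply ENNReal.ofReal_le_ofReal
      have : 0 < (σ * r) ^ 3 := by positivity
      nlinarith
    rw [e1, ENNReal.mul_rpow_of_nonneg _ _ (by norm_num), e2, ← mul_assoc]
    refine mul_le_mul_left ?_ _
    calc _ ≤ ENNReal.ofReal (125 / σ ^ 3) ^ 2 * ENNReal.ofReal 66 * ENNReal.ofReal (1 / (σ * r)) * ENNReal.ofReal (100 * W ^ 2 * r ^ 2) := by
          gcongr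
          simp
      _ = _ := by
          rw [← ENNReal.ofReal_pow (by positivity), ← ENNReal.ofReal_mul (by positivity), ← ENNReal.ofReal_mul (by positivity),
            ← ENNReal.ofReal_mul (by positivity)]
          congr 1
          rw [KK]; field_simp
  constructor
  · refine ⟨⨍ y in S', D y w, (ps_avg hfm hSm hp h0 hV hκ hi hSm' hh).trans (le_trans ?_ hfin)⟩
    gcongr
    norm_num
  · intro i hface hz
    refine (ps_zero hfm hSm hp h0 hV hκ hi hSm' hh ?_).trans hfin
    have hcm : Continuous fun q : E3 × ℝ => q.1 + q.2 • (-P.n i) := by fun_prop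
    calc ∫⁻ y in S', ENNReal.ofReal |D y w| ≤ ∫⁻ x in S', ∫⁻ s in Ioo (0:ℝ) r, g (x + s • (-P.n i)) := by
          refine setLIntegral_mono' hSm' fun x hx => ?_
          obtain ⟨hl0, hlr, hseg⟩ := hface x hx
          obtain ⟨-, hcl, -⟩ := hseg _ hl0.le le_rfl
          have h2 := (path_bd P h w (hp hx).1 hl0 hcl).2
          rw [hz _ hcl (by rw [P.l_add, inner_smul_right, inner_neg_right, real_inner_self_eq_norm_sq, P.unit]; ring), sub_zero] at h2
          refine h2.trans ((setLIntegral_mono' measurableSet_Ioo fun s hs => ?_).trans (lintegral_mono_set (Ioo_subset_Ioo_right hlr)))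
          obtain ⟨q1, -, q3⟩ := hseg s hs.1.le hs.2.le
          have hm : x + s • (-P.n i) ∈ S := ⟨q3 hs.2, q1⟩
          simp only [g, indicator_of_mem hm]
          apply ENNReal.ofReal_le_ofReal
          rw [norm_neg, P.unit, one_mul]
          have := hN0 (x + s • (-P.n i))
          simp only [N] at *
          gcongr
      _ ≤ ∫⁻ x, ∫⁻ s in Ioo (0:ℝ) r, g (x + s • (-P.n i)) := setLIntegral_le_lintegral _ _
      _ = ∫⁻ s in Ioo (0:ℝ) r, ∫⁻ x, g (x + s • (-P.n i)) :=
          lintegral_lintegral_swap (hgm.comp hcm.measurable).aemeasurable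
      _ = ENNReal.ofReal r * ∫⁻ x, g x := by
          simp only [lintegral_add_right_eq_self g]
          rw [lintegral_const, Measure.restrict_apply_univ, Real.volume_Ioo, sub_zero, mul_comm]
      _ ≤ ENNReal.ofReal (10 * r) * ∫⁻ x in S, g x := by
          have : ∫⁻ x, g x = ∫⁻ x in S, g x := by
            rw [← lintegral_indicator hSm]
            refine lintegral_congr fun x => ?_
            by_cases hx : x ∈ S
            · rw [indicator_of_mem hx]
            · rw [indicator_of_notMem hx]; simp [g, hx]
          rw [this]
          gcongr
          linarith
      _ = _ := (lintegral_const_mul _ hgm).symm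
end
end

section
section
variable {ι : Type} {Ω : Set E3}

theorem good_m [Fintype ι] (P : HPoly ι Ω) : ∃ K : ℝ, 0 ≤ K ∧ ∃ r0 > 0, ∀ (D : E3 → E3 →L[ℝ] ℝ) (D2 : E3 → BL), CF Ω D D2 →
    (∀ i, Tan P D i) → ∀ x0 ∈ Ω, ∀ r : ℝ, 0 < r → r ≤ r0 → ∃ m : E3 →L[ℝ] ℝ,
    (∀ i, (∃ y ∈ closure Ω ∩ ball x0 (2 * r), P.l i y = 0) → ∀ t, ⟪P.n i, t⟫ = 0 → m t = 0) ∧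
    ∫⁻ x in Ω ∩ closedBall x0 (5 * r), ENNReal.ofReal (dd2 (D x - m)) ≤ ENNReal.ofReal (K * r) *
      (∫⁻ x in Ω ∩ closedBall x0 (5 * r), ENNReal.ofReal (√(hs2 (D2 x)) ^ (3 / 2 : ℝ))) ^ (4 / 3 : ℝ) := by
  classical
  obtain ⟨σA, hσA, rA, hrA, hA⟩ := P.geoA
  obtain ⟨σF, hσF, rF, hrF, hF⟩ := P.geoF
  obtain ⟨δ, hδ, hδi⟩ : ∃ δ : ℝ, 0 < δ ∧ ∀ i j, i ≠ j → LinearIndependent ℝ ![P.n i, P.n j] ∨ ∀ x, δ ≤ P.l i x + P.l j x := by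
    have : ∀ᶠ δ : ℝ in nhdsWithin 0 (Ioi 0), ∀ i j, i ≠ j → LinearIndependent ℝ ![P.n i, P.n j] ∨ ∀ x, δ ≤ P.l i x + P.l j x := by
      refine Filter.Eventually.filter_mono nhdsWithin_le_nhds ?_
      refine Filter.eventually_all.2 fun i => Filter.eventually_all.2 fun j => ?_
      by_cases hj : i = j
      · simp [hj]
      · rcases P.indep_or i j hj with h | ⟨d, hd, hd2⟩
        · simp [h]
        · filter_upwards [Iio_mem_nhds hd] with s hs _
          exact Or.inr fun x => (hd2 x).symm ▸ hs.le
    obtain ⟨θ, h1, h2⟩ := (this.and (self_mem_nhdsWithin (s := Ioi (0:ℝ)))).exists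
    exact ⟨θ, h2, h1⟩
  have hdec : ∀ i j, ∃ a : E3, LinearIndependent ℝ ![P.n i, P.n j] → ⟪P.n i, a⟫ = 1 ∧ ⟪P.n j, a⟫ = 0 := by
    intro i j
    by_cases h : LinearIndependent ℝ ![P.n i, P.n j]
    · obtain ⟨a, ha⟩ := dual_vec (P.unit i) (P.unit j) h
      exact ⟨a, fun _ => ha⟩
    · exact ⟨0, fun h' => absurd h' h⟩
  choose a ha using hdec
  set σ := min σA σF with hσd
  have hσ : 0 < σ := lt_min hσA hσF
  set W : ℝ := 2 + ∑ i, ∑ j, ‖a i j‖ with hWd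
  have hWa : ∀ i j, ‖a i j‖ + 2 ≤ W := by
    intro i j
    have h1 : ‖a i j‖ ≤ ∑ j, ‖a i j‖ := Finset.single_le_sum (f := fun j => ‖a i j‖) (fun _ _ => norm_nonneg _) (Finset.mem_univ j)
    have h2 : ∑ j, ‖a i j‖ ≤ ∑ i, ∑ j, ‖a i j‖ := Finset.single_le_sum (f := fun i => ∑ j, ‖a i j‖)
      (fun _ _ => Finset.sum_nonneg fun _ _ => norm_nonneg _) (Finset.mem_univ i)
    linarith
  have hW2 : 2 ≤ W := by
    have : 0 ≤ ∑ i, ∑ j, ‖a i j‖ := Finset.sum_nonneg fun _ _ => Finset.sum_nonneg fun _ _ => norm_nonneg _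
    linarith
  have hK0 : 0 ≤ KK σ W := by rw [KK]; positivity
  refine ⟨12 * KK σ W, by positivity, min (min rA rF) (δ / 4), by positivity, fun D D2 h hT x0 hx0 r hr hr0 => ?_⟩
  have hr1 : r ≤ rA := hr0.trans ((min_le_left _ _).trans (min_le_left _ _))
  have hr2 : r ≤ rF := hr0.trans ((min_le_left _ _).trans (min_le_right _ _))
  have hr3 : r ≤ δ / 4 := hr0.trans (min_le_right _ _)
  set S := Ω ∩ closedBall x0 (5 * r) with hS
  set J := ENNReal.ofReal (KK σ W * r) * (∫⁻ x in S, ENNReal.ofReal (√(hs2 (D2 x)) ^ (3 / 2 : ℝ))) ^ (4 / 3 : ℝ) with hJ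
  have e12 : ENNReal.ofReal (12 * KK σ W * r) * (∫⁻ x in S, ENNReal.ofReal (√(hs2 (D2 x)) ^ (3 / 2 : ℝ))) ^ (4 / 3 : ℝ) = 12 * J := by
    rw [hJ, mul_assoc 12, ENNReal.ofReal_mul (by norm_num), mul_assoc]; simp
  rw [e12]
  -- summation helper
  have hsum : ∀ (m : E3 →L[ℝ] ℝ) (u v : Fin 3 → E3) (c e : Fin 3 → ℝ),
      (∀ k, ∫⁻ x in S, ENNReal.ofReal ((D x (u k) - c k) ^ 2) ≤ J) → (∀ k, ∫⁻ x in S, ENNReal.ofReal ((D x (v k) - e k) ^ 2) ≤ J) →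
      (∀ x, dd2 (D x - m) ≤ ∑ k, (2 * (D x (u k) - c k) ^ 2 + 2 * (D x (v k) - e k) ^ 2)) →
      ∫⁻ x in S, ENNReal.ofReal (dd2 (D x - m)) ≤ 12 * J := by
    intro m u v c e h1 h2 h3
    have hms : ∀ (w : E3) (c : ℝ), AEMeasurable (fun x => ENNReal.ofReal ((D x w - c) ^ 2)) (volume.restrict S) := by
      intro w c
      apply AEMeasurable.ennreal_ofReal
      apply ContinuousOn.aemeasurable _ (P.op.measurableSet.inter measurableSet_closedBall)
      exact (((h.c1.mono (inter_subset_left.trans subset_closure)).clm_apply continuousOn_const).sub continuousOn_const).pow 2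
    calc _ ≤ ∫⁻ x in S, ∑ k, (2 * ENNReal.ofReal ((D x (u k) - c k) ^ 2) + 2 * ENNReal.ofReal ((D x (v k) - e k) ^ 2)) := by
          refine lintegral_mono fun x => (ENNReal.ofReal_le_ofReal (h3 x)).trans_eq ?_
          rw [ENNReal.ofReal_sum_of_nonneg fun _ _ => by positivity]
          refine Finset.sum_congr rfl fun k _ => ?_
          rw [two_ofR, two_ofR, ENNReal.ofReal_add (by positivity) (by positivity)]
      _ = ∑ k, (2 * (∫⁻ x in S, ENNReal.ofReal ((D x (u k) - c k) ^ 2)) + 2 * ∫⁻ x in S, ENNReal.ofReal ((D x (v k) - e k) ^ 2)) := by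
          have hadd : ∀ k ∈ (Finset.univ : Finset (Fin 3)), AEMeasurable (fun x => 2 * ENNReal.ofReal ((D x (u k) - c k) ^ 2) + 2 * ENNReal.ofReal ((D x (v k) - e k) ^ 2)) (volume.restrict S) :=
            fun k _ => ((hms _ _).const_mul 2).add ((hms _ _).const_mul 2)
          rw [lintegral_finsetSum' _ hadd]
          refine Finset.sum_congr rfl fun k _ => ?_
          rw [lintegral_add_left' ((hms _ _).const_mul 2), lintegral_const_mul' _ _ (by norm_num), lintegral_const_mul' _ _ (by norm_num)]
      _ ≤ ∑ k : Fin 3, (2 * J + 2 * J) := Finset.sum_le_sum fun k _ => add_le_add (mul_le_mul_right (h1 k) _) (mul_le_mul_right (h2 k) _)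
      _ = 12 * J := by rw [Finset.sum_const, Finset.card_univ, Fintype.card_fin, nsmul_eq_mul]; push_cast; ring
  have hee : ∀ k, ‖ee k‖ ≤ W := fun k => by
    have : ‖ee k‖ = 1 := by simp [ee]
    linarith
  have hface : ∀ i, (∃ y ∈ closure Ω ∩ ball x0 (2 * r), P.l i y = 0) → ∃ p, closedBall p (σ * r) ⊆ S ∧
      (∀ x ∈ closedBall p (σ * r), 0 < P.l i x ∧ P.l i x ≤ r ∧ ∀ s, 0 ≤ s → s ≤ P.l i x →
      x + s • (-P.n i) ∈ closedBall x0 (5 * r) ∧ x + s • (-P.n i) ∈ closure Ω ∧ (s < P.l i x → x + s • (-P.n i) ∈ Ω)) := by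
    rintro i ⟨y, ⟨hy, hyb⟩, hyi⟩
    obtain ⟨p, hp⟩ := hF i x0 y r hr hr2 hy hyi hyb
    have hsub : closedBall p (σ * r) ⊆ closedBall p (σF * r) := closedBall_subset_closedBall (by gcongr; exact min_le_right _ _)
    refine ⟨p, fun x hx => ?_, fun x hx => hp x (hsub hx)⟩
    obtain ⟨h1, h2, h3⟩ := hp x (hsub hx)
    obtain ⟨h4, -, h5⟩ := h3 0 le_rfl h1.le
    have := h5 h1
    simp only [zero_smul, add_zero] at this h4
    exact ⟨this, h4⟩
  by_cases hJ1 : ∃ i, ∃ y ∈ closure Ω ∩ ball x0 (2 * r), P.l i y = 0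
  · obtain ⟨i, hi⟩ := hJ1
    obtain ⟨p, hp1, hp2⟩ := hface i hi
    have tang : ∀ t, ⟪P.n i, t⟫ = 0 → ‖t‖ ≤ W → ∫⁻ x in S, ENNReal.ofReal (D x t ^ 2) ≤ J := fun t ht htW =>
      (ps_cf P h hr hσ hp1 htW).2 i hp2 fun y hy hyi => hT i y hy hyi t ht
    by_cases hJ2 : ∃ j, j ≠ i ∧ ∃ y ∈ closure Ω ∩ ball x0 (2 * r), P.l j y = 0
    · obtain ⟨j, hji, hj⟩ := hJ2
      obtain ⟨p', hp1', hp2'⟩ := hface j hj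
      have tang' : ∀ t, ⟪P.n j, t⟫ = 0 → ‖t‖ ≤ W → ∫⁻ x in S, ENNReal.ofReal (D x t ^ 2) ≤ J := fun t ht htW =>
        (ps_cf P h hr hσ hp1' htW).2 j hp2' fun y hy hyi => hT j y hy hyi t ht
      have hli : LinearIndependent ℝ ![P.n i, P.n j] := by
        rcases hδi i j hji.symm with h' | h'
        · exact h'
        · exfalso
          obtain ⟨y, ⟨-, hy⟩, hyi⟩ := hi
          obtain ⟨z, ⟨-, hz⟩, hzj⟩ := hj
          have h1 := h' y
          have h2 := (abs_le.1 (P.l_lip j y z)).2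
          rw [← dist_eq_norm] at h2
          rw [mem_ball] at hy hz
          have h3 := dist_triangle_right y z x0
          linarith
      obtain ⟨ha1, ha2⟩ := ha i j hli
      refine ⟨0, fun _ _ _ _ => rfl, hsum 0 (fun k => ee k - ⟪P.n i, ee k⟫ • a i j) (fun k => ⟪P.n i, ee k⟫ • a i j) 0 0 ?_ ?_ ?_⟩
      all_goals have hin : ∀ k, ‖⟪P.n i, ee k⟫ • a i j‖ ≤ ‖a i j‖ := fun k => by
                  rw [norm_smul]
                  have := norm_inner_le_norm (𝕜 := ℝ) (P.n i) (ee k)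
                  rw [P.unit, show ‖ee k‖ = 1 by simp [ee], mul_one] at this
                  exact mul_le_of_le_one_left (norm_nonneg _) this
      · intro k
        simp only [Pi.zero_apply, sub_zero]
        refine tang _ (by rw [inner_sub_right, inner_smul_right, ha1]; ring) ((norm_sub_le _ _).trans ?_)
        have h1 := hin k
        have h2 := hWa i j
        have : ‖ee k‖ = 1 := by simp [ee]
        linarith
      · intro k
        simp only [Pi.zero_apply, sub_zero]
        refine tang' _ (by rw [inner_smul_right, ha2]; ring) ?_
        have h1 := hin k
        have h2 := hWa i j
        linarith
      · intro x
        simp only [dd2, sub_zero, Pi.zero_apply]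
        refine Finset.sum_le_sum fun k _ => ?_
        have : D x (ee k) = D x (ee k - ⟪P.n i, ee k⟫ • a i j) + D x (⟪P.n i, ee k⟫ • a i j) := by rw [← map_add]; simp
        rw [this]
        nlinarith [sq_nonneg (D x (ee k - ⟪P.n i, ee k⟫ • a i j) - D x (⟪P.n i, ee k⟫ • a i j))]
    · push Not at hJ2
      obtain ⟨c, hc⟩ := (ps_cf P h hr hσ hp1 (w := P.n i) (W := W) (by rw [P.unit]; linarith)).1
      have nn : ⟪P.n i, P.n i⟫ = 1 := by rw [real_inner_self_eq_norm_sq, P.unit]; norm_num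
      have hin : ∀ k, |(P.n i) k| ≤ 1 := fun k => by
        have := norm_inner_le_norm (𝕜 := ℝ) (P.n i) (ee k)
        rwa [P.unit, show ‖ee k‖ = 1 by simp [ee], mul_one, inner_ee] at this
      refine ⟨c • innerSL ℝ (P.n i), ?_, hsum _ (fun k => ee k - (P.n i k) • P.n i) (fun _ => P.n i) 0 (fun _ => c) ?_ (fun _ => hc) ?_⟩
      · rintro j ⟨y, hy, hyj⟩ t ht
        have : j = i := by
          by_contra hne
          exact hJ2 j hne y hy hyj
        rw [this] at ht
        simp [ht]
      · intro k
        simp only [Pi.zero_apply, sub_zero]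
        refine tang _ (by rw [inner_sub_right, inner_smul_right, nn, inner_ee]; ring) ((norm_sub_le _ _).trans ?_)
        rw [norm_smul, P.unit, Real.norm_eq_abs]
        have : ‖ee k‖ = 1 := by simp [ee]
        linarith [hin k]
      · intro x
        refine Finset.sum_le_sum fun k _ => ?_
        simp only [Pi.zero_apply, sub_zero, sub_apply, smul_apply, innerSL_apply_apply, smul_eq_mul, inner_ee]
        have e1 : D x (ee k) = D x (ee k - P.n i k • P.n i) + P.n i k * D x (P.n i) := by
          rw [map_sub, map_smul, smul_eq_mul]; ring
        rw [e1]
        have := hin k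
        have h2 : (P.n i k) ^ 2 ≤ 1 := by rw [sq_le_one_iff_abs_le_one]; exact this
        set A := D x (ee k - P.n i k • P.n i)
        set B := D x (P.n i) - c with hB
        have : A + P.n i k * D x (P.n i) - c * P.n i k = A + P.n i k * B := by rw [hB]; ring
        rw [this]
        nlinarith [sq_nonneg (A - P.n i k * B), mul_le_mul_of_nonneg_right h2 (sq_nonneg B)]
  · push Not at hJ1
    obtain ⟨p, hp⟩ := hA x0 hx0 r hr hr1
    have hp1 : closedBall p (σ * r) ⊆ S := (closedBall_subset_closedBall (by gcongr; exact min_le_left _ _)).trans hp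
    have hcs : ∀ k, ∃ c, ∫⁻ x in S, ENNReal.ofReal ((D x (ee k) - c) ^ 2) ≤ J := fun k => (ps_cf P h hr hσ hp1 (hee k)).1
    choose c hc using hcs
    have hmk : ∀ k, (∑ j, c j • innerSL ℝ (ee j)) (ee k) = c k := by
      intro k
      simp only [ContinuousLinearMap.sum_apply, smul_apply, innerSL_apply_apply, inner_ee, smul_eq_mul]
      simp [ee]
    refine ⟨∑ j, c j • innerSL ℝ (ee j), ?_, hsum _ ee ee c c hc hc ?_⟩
    · rintro j ⟨y, hy, hyj⟩
      exact absurd hyj (hJ1 j y hy)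
    · intro x
      refine Finset.sum_le_sum fun k _ => ?_
      rw [sub_apply, hmk]
      nlinarith [sq_nonneg (D x (ee k) - c k)]

theorem rh [Fintype ι] (P : HPoly ι Ω) : ∃ C : ℝ, 1 ≤ C ∧ ∃ r0 > 0, ∀ (D : E3 → E3 →L[ℝ] ℝ) (D2 : E3 → BL), CF Ω D D2 →
    (∀ i, Tan P D i) → ∀ x0 ∈ Ω, ∀ r : ℝ, 0 < r → r ≤ r0 →
    ∫⁻ x in Ω ∩ closedBall x0 r, ENNReal.ofReal (hs2 (D2 x)) ≤ ENNReal.ofReal (C * r⁻¹) *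
      (∫⁻ x in Ω ∩ closedBall x0 (5 * r), ENNReal.ofReal (√(hs2 (D2 x)) ^ (3 / 2 : ℝ))) ^ (4 / 3 : ℝ) +
      ENNReal.ofReal C * ∫⁻ x in Ω ∩ closedBall x0 (5 * r), ENNReal.ofReal (trc (D2 x) ^ 2) := by
  obtain ⟨K, hK, r0, hr0, hm⟩ := good_m P
  refine ⟨32 + 320 * K, by linarith, r0, hr0, fun D D2 h hT x0 hx0 r hr hrr => ?_⟩
  obtain ⟨m, hm1, hm2⟩ := hm D D2 h hT x0 hx0 r hr hrr
  have h' : CF Ω (fun x => D x - m) D2 := ⟨h.c1.sub continuousOn_const, h.c2, fun x hx => (h.der x hx).sub_const m, h.symm⟩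
  have key := cacc P h' x0 hr fun i hi y hy hyi t ht => by rw [sub_apply, hT i y hy hyi t ht, hm1 i hi t ht, sub_zero]
  have conv : ∀ (f : E3 → ℝ) (s : ℝ), ContinuousOn f (closure Ω) → (∀ x, 0 ≤ f x) →
      ENNReal.ofReal (∫ x in Ω ∩ closedBall x0 s, f x) = ∫⁻ x in Ω ∩ closedBall x0 s, ENNReal.ofReal (f x) := fun f s hf h0 =>
    ofReal_integral_eq_lintegral_ofReal ((P.cont_int hf).mono_set inter_subset_left) (Filter.Eventually.of_forall h0)
  have hd0 : ∀ d, 0 ≤ dd2 d := fun d => Finset.sum_nonneg fun _ _ => sq_nonneg _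
  have cdd : ContinuousOn (fun x => dd2 (D x - m)) (closure Ω) := cont_dd2.comp_continuousOn h'.c1
  have key2 := ENNReal.ofReal_le_ofReal key
  have hsub : Ω ∩ closedBall x0 (2 * r) ⊆ Ω ∩ closedBall x0 (5 * r) :=
    inter_subset_inter_right _ (closedBall_subset_closedBall (by linarith))
  have n1 : 0 ≤ ∫ x in Ω ∩ closedBall x0 (2 * r), trc (D2 x) ^ 2 := integral_nonneg fun _ => sq_nonneg _
  have n2 : 0 ≤ ∫ x in Ω ∩ closedBall x0 (2 * r), dd2 (D x - m) := integral_nonneg fun _ => hd0 _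
  rw [conv _ _ h.chs fun x => hs2_nn _, ENNReal.ofReal_add (by positivity) (by positivity), ENNReal.ofReal_mul (by norm_num),
    ENNReal.ofReal_mul (by positivity), conv (fun x => trc (D2 x) ^ 2) _ (h.ctr.pow 2) fun _ => sq_nonneg _, conv _ _ cdd fun _ => hd0 _] at key2
  refine key2.trans ?_
  rw [add_comm]
  refine add_le_add ?_ ?_
  · refine (mul_le_mul_right ((lintegral_mono_set hsub).trans hm2) _).trans ?_
    rw [← mul_assoc, ← ENNReal.ofReal_mul (by positivity)]
    refine mul_le_mul_left (ENNReal.ofReal_le_ofReal ?_) _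
    have : 320 / r ^ 2 * (K * r) = 320 * K * r⁻¹ := by field_simp
    rw [this]
    gcongr
    linarith
  · exact mul_le_mul' (ENNReal.ofReal_le_ofReal (by linarith)) (lintegral_mono_set hsub)
end
end

section
theorem jens {α : Type*} [MeasurableSpace α] (μ : Measure α) {s : ℝ} (hs : 1 < s) {f : α → ℝ≥0∞} (hf : AEMeasurable f μ) :
    (∫⁻ x, f x ∂μ) ^ s ≤ μ univ ^ (s - 1) * ∫⁻ x, f x ^ s ∂μ := by
  have hc := Real.HolderConjugate.conjExponent hs
  have := ENNReal.lintegral_mul_le_Lp_mul_Lq μ hc hf (aemeasurable_const (b := (1 : ℝ≥0∞)))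
  simp only [Pi.mul_apply, mul_one, ENNReal.one_rpow, lintegral_const, one_mul] at this
  calc _ ≤ ((∫⁻ x, f x ^ s ∂μ) ^ (1 / s) * μ univ ^ (1 / s.conjExponent)) ^ s := ENNReal.rpow_le_rpow this (by linarith)
    _ = _ := by
      rw [ENNReal.mul_rpow_of_nonneg _ _ (by linarith), ← ENNReal.rpow_mul, ← ENNReal.rpow_mul, mul_comm]
      have : (0:ℝ) < s - 1 := by linarith
      congr 2
      · rw [Real.conjExponent]; field_simp
      · rw [one_div, inv_mul_cancel₀ (by linarith), ENNReal.rpow_one]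

section
variable {ι : Type} {Ω : Set E3}

theorem ind_ball (hΩ : MeasurableSet Ω) (f : E3 → ℝ) (g : ℝ → ℝ) (hg : g 0 = 0) (x : E3) (r : ℝ) :
    ∫⁻ y in closedBall x r, ENNReal.ofReal (g (Ω.indicator f y)) = ∫⁻ y in Ω ∩ closedBall x r, ENNReal.ofReal (g (f y)) := by
  have : (fun y => ENNReal.ofReal (g (Ω.indicator f y))) = Ω.indicator fun y => ENNReal.ofReal (g (f y)) := by
    ext y
    by_cases hy : y ∈ Ω <;> simp [hy, hg]
  rw [this, setLIntegral_indicator hΩ]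

theorem ind_all (hΩ : MeasurableSet Ω) (f : E3 → ℝ) (g : ℝ → ℝ) (hg : g 0 = 0) :
    ∫⁻ y, ENNReal.ofReal (g (Ω.indicator f y)) = ∫⁻ y in Ω, ENNReal.ofReal (g (f y)) := by
  have : (fun y => ENNReal.ofReal (g (Ω.indicator f y))) = Ω.indicator fun y => ENNReal.ofReal (g (f y)) := by
    ext y
    by_cases hy : y ∈ Ω <;> simp [hy, hg]
  rw [this, lintegral_indicator hΩ]

theorem p_gt2 [Fintype ι] (P : HPoly ι Ω) : ∃ p0 : ℝ, 2 < p0 ∧ ∀ q, 2 < q → q < p0 → ∃ C : ℝ, 0 ≤ C ∧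
    ∀ (D : E3 → E3 →L[ℝ] ℝ) (D2 : E3 → BL), CF Ω D D2 → (∀ i, Tan P D i) →
    ∫⁻ x in Ω, ENNReal.ofReal (√(hs2 (D2 x)) ^ q) ≤ ENNReal.ofReal C * ∫⁻ x in Ω, ENNReal.ofReal (|trc (D2 x)| ^ q) := by
  obtain ⟨C0, hC0, r0, hr0, hrh⟩ := rh P
  obtain ⟨p0, hp0, hg⟩ := gehring hC0
  refine ⟨p0, hp0, fun q hq hqp => ?_⟩
  obtain ⟨C, hC, hg⟩ := hg q hq hqp
  have hm := P.op.measurableSet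
  have hvol : volume Ω ≠ ∞ := (P.bdd.measure_lt_top).ne
  set V := (volume Ω).toReal with hV
  refine ⟨C + C * (r0 ^ 3)⁻¹ ^ ((q - 2) / 2) * 2 ^ (q / 2) * V ^ (q / 2 - 1), by positivity, fun D D2 h hT => ?_⟩
  set T := ∫ x in Ω, trc (D2 x) ^ 2 with hTd
  have hT0 : 0 ≤ T := integral_nonneg fun _ => sq_nonneg _
  have hid := l2_id P h hT
  have hch : ContinuousOn (fun x => √(hs2 (D2 x))) (closure Ω) := h.chs.sqrt
  have hct : ContinuousOn (fun x => |trc (D2 x)|) (closure Ω) := h.ctr.abs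
  have e1 : ∫⁻ x in Ω, ENNReal.ofReal (√(hs2 (D2 x)) ^ 2) = ENNReal.ofReal T := by
    rw [hTd, ← hid, ofReal_integral_eq_lintegral_ofReal (P.cont_int h.chs) (Filter.Eventually.of_forall fun x => hs2_nn _)]
    simp only [Real.sq_sqrt (hs2_nn _)]
  have e2 : ∫⁻ x in Ω, ENNReal.ofReal (|trc (D2 x)| ^ 2) = ENNReal.ofReal T := by
    have i2 : IntegrableOn (fun x => trc (D2 x) ^ 2) Ω := P.cont_int (h.ctr.pow 2)
    rw [hTd, ofReal_integral_eq_lintegral_ofReal i2 (Filter.Eventually.of_forall fun x => sq_nonneg _)]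
    simp only [sq_abs]
  have mF := meas_ind hm (hch.mono subset_closure)
  have mG := meas_ind hm (hct.mono subset_closure)
  have z2 : (fun s : ℝ => s ^ 2) 0 = 0 := by simp
  have zr : ∀ t : ℝ, 0 < t → (fun s : ℝ => s ^ t) 0 = 0 := fun t ht => Real.zero_rpow ht.ne'
  have a2 := ind_all hm (fun x => √(hs2 (D2 x))) (fun s => s ^ 2) z2
  have b2 := ind_all hm (fun x => |trc (D2 x)|) (fun s => s ^ 2) z2
  have aq := ind_all hm (fun x => √(hs2 (D2 x))) (fun s => s ^ q) (zr q (by linarith))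
  have bq := ind_all hm (fun x => |trc (D2 x)|) (fun s => s ^ q) (zr q (by linarith))
  have key := hg (Ω.indicator fun x => √(hs2 (D2 x))) (Ω.indicator fun x => |trc (D2 x)|) r0 (2 * T) mF mG
    (fun x => indicator_nonneg (fun _ _ => Real.sqrt_nonneg _) x) (fun x => indicator_nonneg (fun _ _ => abs_nonneg _) x) hr0
    (by positivity) (by
      rw [lintegral_add_left (mF.pow_const 2).ennreal_ofReal, a2, b2, e1, e2, ← ENNReal.ofReal_add hT0 hT0, two_mul]) (by
      intro x r hr hrr hx
      have hxΩ : x ∈ Ω := by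
        by_contra hxn
        simp [hxn] at hx
      have := hrh D D2 h hT x hxΩ r hr hrr
      have i1 := ind_ball hm (fun x => √(hs2 (D2 x))) (fun s => s ^ 2) z2 x r
      have i2 := ind_ball hm (fun x => √(hs2 (D2 x))) (fun s => s ^ (3 / 2 : ℝ)) (zr (3 / 2) (by norm_num)) x (5 * r)
      have i3 := ind_ball hm (fun x => |trc (D2 x)|) (fun s => s ^ 2) z2 x (5 * r)
      rw [i1, i2, i3]
      simpa only [Real.sq_sqrt (hs2_nn _), sq_abs] using this)
  rw [aq, bq] at key
  refine key.trans ?_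
  rw [ENNReal.ofReal_add hC (by positivity), add_mul]
  refine add_le_add le_rfl ?_
  have hJ := jens (volume.restrict Ω) (s := q / 2) (by linarith) (f := fun x => ENNReal.ofReal (|trc (D2 x)| ^ 2))
    ((ContinuousOn.aemeasurable ((hct.mono subset_closure).pow 2) hm).ennreal_ofReal)
  have e3 : ∀ x, ENNReal.ofReal (|trc (D2 x)| ^ 2) ^ (q / 2) = ENNReal.ofReal (|trc (D2 x)| ^ q) := fun x => by
    rw [ENNReal.ofReal_rpow_of_nonneg (by positivity) (by linarith), ← Real.rpow_natCast, ← Real.rpow_mul (abs_nonneg _)]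
    congr 2
    push_cast
    ring
  simp only [e3] at hJ
  rw [e2, Measure.restrict_apply_univ, ENNReal.ofReal_rpow_of_nonneg hT0 (by linarith), ← ENNReal.ofReal_toReal hvol,
    ENNReal.ofReal_rpow_of_nonneg ENNReal.toReal_nonneg (by linarith)] at hJ
  rw [← ENNReal.ofReal_mul (by positivity)]
  have e4 : C * √(2 * T / r0 ^ 3) ^ (q - 2) * (2 * T) = (C * (r0 ^ 3)⁻¹ ^ ((q - 2) / 2) * 2 ^ (q / 2)) * T ^ (q / 2) := by
    rw [Real.sqrt_eq_rpow, ← Real.rpow_mul (by positivity), div_eq_mul_inv, Real.mul_rpow (by positivity) (by positivity),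
      Real.mul_rpow (by norm_num) hT0]
    rcases hT0.eq_or_lt with h0 | h0
    · rw [← h0]
      simp [Real.zero_rpow (show q / 2 ≠ 0 by linarith)]
    · have e5 : q / 2 = (q - 2) / 2 + 1 := by ring
      have e6 : 1 / 2 * (q - 2) = (q - 2) / 2 := by ring
      rw [e6, e5, Real.rpow_add_one (by norm_num), Real.rpow_add_one h0.ne']
      ring_nf
  rw [e4, ENNReal.ofReal_mul (by positivity), ENNReal.ofReal_mul (p := _ * _ * _) (by positivity), mul_assoc (ENNReal.ofReal _)]
  exact mul_le_mul_right hJ _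
end
end

section
structure T2 (φ : E3 → ℝ) (D : E3 → E3 →L[ℝ] ℝ) (D2 : E3 → BL) : Prop where
  d1 : ∀ x, HasFDerivAt φ (D x) x
  d2 : ∀ x, HasFDerivAt D (D2 x) x
  c : Continuous D2

def pp (x : E3) (t : ℝ) (y : E3) : ℝ := max (1 - ‖y - x‖ ^ 2 / t ^ 2) 0
def bb (x : E3) (t : ℝ) (y : E3) : ℝ := pp x t y ^ 3
def lb (x : E3) (t : ℝ) (y : E3) : ℝ := -18 * pp x t y ^ 2 / t ^ 2 + 24 * pp x t y * ‖y - x‖ ^ 2 / t ^ 4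
def rr (x : E3) (t : ℝ) (y : E3) : ℝ := 6 * pp x t y ^ 2 / t ^ 3

theorem cont_pp (x : E3) (t : ℝ) : Continuous (pp x t) := by unfold pp; fun_prop
theorem cont_bb (x : E3) (t : ℝ) : Continuous (bb x t) := (cont_pp x t).pow 3
theorem cont_lb (x : E3) (t : ℝ) : Continuous (lb x t) := by have := cont_pp x t; unfold lb; fun_prop
theorem cont_rr (x : E3) (t : ℝ) : Continuous (rr x t) := by have := cont_pp x t; unfold rr; fun_prop
theorem pp_nn (x : E3) (t : ℝ) (y : E3) : 0 ≤ pp x t y := le_max_right _ _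
theorem pp_le (x : E3) (t : ℝ) (y : E3) : pp x t y ≤ 1 := max_le (by simp only [sub_le_self_iff]; positivity) zero_le_one
theorem pp_zero {x : E3} {t : ℝ} {y : E3} (ht : 0 < t) (h : t ≤ dist y x) : pp x t y = 0 := by
  rw [dist_eq_norm] at h
  refine max_eq_right ?_
  rw [sub_nonpos, le_div_iff₀ (by positivity)]
  nlinarith
theorem bb_zero {x : E3} {t : ℝ} {y : E3} (ht : 0 < t) (h : t ≤ dist y x) : bb x t y = 0 := by rw [bb, pp_zero ht h]; norm_num
theorem rr_zero {x : E3} {t : ℝ} {y : E3} (ht : 0 < t) (h : t ≤ dist y x) : rr x t y = 0 := by rw [rr, pp_zero ht h]; norm_num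
theorem bb_nn (x : E3) (t : ℝ) (y : E3) : 0 ≤ bb x t y := pow_nonneg (pp_nn _ _ _) 3
theorem rr_nn (x : E3) {t : ℝ} (ht : 0 < t) (y : E3) : 0 ≤ rr x t y := by have := pp_nn x t y; unfold rr; positivity
theorem rr_le (x : E3) {t : ℝ} (ht : 0 < t) (y : E3) : rr x t y ≤ 6 / t ^ 3 := by
  unfold rr
  gcongr
  nlinarith [pp_nn x t y, pp_le x t y]
theorem bb_ts {x : E3} {t : ℝ} (ht : 0 < t) : tsupport (bb x t) ⊆ closedBall x t :=
  closure_minimal (fun y hy => by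
    by_contra h
    rw [mem_closedBall, not_le] at h
    exact hy (bb_zero ht h.le)) isClosed_closedBall
theorem bb_cs {x : E3} {t : ℝ} (ht : 0 < t) : HasCompactSupport (bb x t) :=
  (isCompact_closedBall x t).of_isClosed_subset (isClosed_tsupport _) (bb_ts ht)

theorem lb_bd (x : E3) {t : ℝ} (ht : 0 < t) (y : E3) : |lb x t y| ≤ 42 / t ^ 2 := by
  have h0 := pp_nn x t y
  have h1 := pp_le x t y
  have h2 : pp x t y * ‖y - x‖ ^ 2 ≤ t ^ 2 := by
    by_cases h : t ≤ dist y x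
    · rw [pp_zero ht h]; nlinarith
    · rw [dist_eq_norm, not_le] at h
      have : ‖y - x‖ ^ 2 ≤ t ^ 2 := by gcongr
      nlinarith [sq_nonneg ‖y - x‖]
  have e : lb x t y = (-18 * pp x t y ^ 2) / t ^ 2 + 24 * ((pp x t y * ‖y - x‖ ^ 2) / t ^ 2) / t ^ 2 := by
    rw [lb]; field_simp
  have h3 : (pp x t y * ‖y - x‖ ^ 2) / t ^ 2 ≤ 1 := by rw [div_le_one (by positivity)]; exact h2
  have h4 : 0 ≤ (pp x t y * ‖y - x‖ ^ 2) / t ^ 2 := by positivity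
  rw [e, ← add_div, abs_div, abs_of_pos (show 0 < t ^ 2 by positivity)]
  gcongr
  rw [abs_le]
  constructor <;> nlinarith

theorem rr_der (x : E3) {t : ℝ} (ht : t ≠ 0) (y : E3) : HasDerivAt (fun t => rr x t y) (lb x t y / t ^ 2) t := by
  have h1 : HasDerivAt (fun t : ℝ => 1 - ‖y - x‖ ^ 2 / t ^ 2) (2 * ‖y - x‖ ^ 2 / t ^ 3) t := by
    have := ((hasDerivAt_const t (‖y - x‖ ^ 2)).div (hasDerivAt_pow 2 t) (by positivity)).const_sub 1
    refine this.congr_deriv ?_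
    field_simp
    simp
    ring
  have h2 : HasDerivAt (fun t => pp x t y ^ 2) (2 * pp x t y * (2 * ‖y - x‖ ^ 2 / t ^ 3)) t := by
    have := (pos_pow_deriv (k := 1) le_rfl (1 - ‖y - x‖ ^ 2 / t ^ 2)).comp t h1
    simpa [pp, Function.comp_def] using this
  have h3 := (h2.const_mul 6).div (hasDerivAt_pow 3 t) (by positivity)
  refine h3.congr_deriv ?_
  rw [lb]
  field_simp
  push_cast
  ring

theorem bb_T2 (x : E3) {t : ℝ} (ht : 0 < t) : ∃ D D2, T2 (bb x t) D D2 ∧ ∀ y, trc (D2 y) = lb x t y := by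
  obtain ⟨I, hI⟩ : ∃ I : BL, ∀ a b, I a b = ⟪a, b⟫ := ⟨innerSL ℝ, fun _ _ => rfl⟩
  have hn : ∀ y, HasFDerivAt (fun y : E3 => 1 - ‖y - x‖ ^ 2 / t ^ 2) ((-2 / t ^ 2) • I (y - x)) y := by
    intro y
    have h := (((hasFDerivAt_id y).sub_const x).norm_sq.mul_const (t ^ 2)⁻¹).const_sub 1
    simp only [← div_eq_mul_inv] at h
    refine h.congr_fderiv ?_
    ext z
    simp [div_eq_mul_inv, hI]
    ring
  have hp : ∀ (k : ℕ), 1 ≤ k → ∀ y, HasFDerivAt (fun y => pp x t y ^ (k + 1)) (((k + 1 : ℕ) * pp x t y ^ k) • ((-2 / t ^ 2) • I (y - x))) y := by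
    intro k hk y
    exact (pos_pow_deriv hk (1 - ‖y - x‖ ^ 2 / t ^ 2)).comp_hasFDerivAt y (hn y)
  have hi : ∀ y : E3, HasFDerivAt (fun y : E3 => I (y - x)) I y := by
    intro y
    have := I.hasFDerivAt.comp y ((hasFDerivAt_id y).sub_const x)
    exact this
  refine ⟨fun y => (-6 / t ^ 2 * pp x t y ^ 2) • I (y - x), fun y => (-6 / t ^ 2 * pp x t y ^ 2) • I +
    ((-6 / t ^ 2) • (((1 + 1 : ℕ) * pp x t y ^ 1) • ((-2 / t ^ 2) • I (y - x)))).smulRight (I (y - x)), ⟨?_, ?_, ?_⟩, ?_⟩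
  · intro y
    refine (hp 2 (by norm_num) y).congr_fderiv ?_
    rw [smul_smul]
    congr 1
    push_cast
    ring
  · intro y
    exact ((hp 1 le_rfl y).const_mul (-6 / t ^ 2)).smul (hi y)
  · have := cont_pp x t
    rw [continuous_clm_apply]; intro a
    rw [continuous_clm_apply]; intro b
    simp only [add_apply, smul_apply, ContinuousLinearMap.smulRight_apply, hI, smul_eq_mul]
    fun_prop
  · intro y
    have e : ∑ i, (y i - x i) ^ 2 = ‖y - x‖ ^ 2 := by rw [EuclideanSpace.norm_sq_eq]; simp
    have e1 : ∀ i, ⟪ee i, ee i⟫ = 1 := fun i => by simp [ee]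
    have e2 : ∀ i, ⟪y - x, ee i⟫ = y i - x i := fun i => by rw [inner_ee]; rfl
    simp only [trc, add_apply, smul_apply, ContinuousLinearMap.smulRight_apply, hI, smul_eq_mul]
    simp only [e1, e2, Finset.sum_add_distrib]
    rw [lb, ← e]
    simp only [Fin.sum_univ_three]
    push_cast
    field_simp
    ring

theorem mv_der {w : E3 → ℝ} (hw : Integrable w) (x : E3) {t : ℝ} (ht : 0 < t) :
    HasDerivAt (fun t => ∫ y, w y * rr x t y) ((∫ y, w y * lb x t y) / t ^ 2) t := by
  have hI : ∀ {f : E3 → ℝ} (C : ℝ), Continuous f → (∀ y, |f y| ≤ C) → Integrable (fun y => w y * f y) := fun {f} C hf hb =>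
    hw.mul_bdd (c := C) hf.aestronglyMeasurable (Filter.Eventually.of_forall hb)
  have h := (hasDerivAt_integral_of_dominated_loc_of_deriv_le (μ := volume) (F := fun t y => w y * rr x t y)
    (F' := fun t y => w y * (lb x t y / t ^ 2)) (x₀ := t) (s := Ioi (t / 2)) (bound := fun y => |w y| * (42 / (t / 2) ^ 2 / (t / 2) ^ 2)) (Ioi_mem_nhds (by linarith))
    (Filter.Eventually.of_forall fun s => hw.aestronglyMeasurable.mul (cont_rr x s).aestronglyMeasurable)
    (hI (6 / t ^ 3) (cont_rr x t) fun y => by rw [abs_of_nonneg (rr_nn x ht y)]; exact rr_le x ht y)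
    (hw.aestronglyMeasurable.mul ((cont_lb x t).div_const _).aestronglyMeasurable)
    (Filter.Eventually.of_forall fun y s hs => ?_) (hw.abs.mul_const _)
    (Filter.Eventually.of_forall fun y s hs => (rr_der x (by have := mem_Ioi.1 hs; linarith) y).const_mul _)).2
  · refine h.congr_deriv ?_
    rw [← integral_div]
    simp only [mul_div_assoc]
  · have hs' : t / 2 < s := hs
    have h0 : 0 < s := by linarith
    rw [Real.norm_eq_abs, abs_mul, abs_div, abs_of_pos (show 0 < s ^ 2 by positivity)]
    have : 42 / s ^ 2 ≤ 42 / (t / 2) ^ 2 := by gcongr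
    have := (lb_bd x h0 y).trans this
    gcongr

def c00 : ℝ := ∫ y, rr 0 1 y
def cbb : ℝ := ∫ y, bb 0 1 y

theorem pp_sc (x : E3) {t : ℝ} (ht : 0 < t) (z : E3) : pp x t (x + t • z) = pp 0 1 z := by
  rw [pp, pp, add_sub_cancel_left, norm_smul, sub_zero, mul_pow, Real.norm_eq_abs, sq_abs, mul_div_cancel_left₀ _ (by positivity)]
  simp

theorem int_sc (x : E3) {t : ℝ} (ht : 0 < t) (f : E3 → ℝ) : ∫ y, f y = t ^ 3 * ∫ z, f (x + t • z) := by
  have h1 := Measure.integral_comp_smul (volume : Measure E3) (fun z => f (x + z)) t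
  rw [finrank_euclideanSpace_fin, integral_add_left_eq_self (μ := volume) f x] at h1
  rw [h1, abs_of_pos (by positivity), smul_eq_mul, mul_inv_cancel_left₀ (by positivity)]

theorem int_rr (x : E3) {t : ℝ} (ht : 0 < t) : ∫ y, rr x t y = c00 := by
  rw [int_sc x ht, c00, ← integral_const_mul]
  congr 1; ext z
  rw [rr, rr, pp_sc x ht]
  field_simp

theorem int_bb (x : E3) {t : ℝ} (ht : 0 < t) : ∫ y, bb x t y = t ^ 3 * cbb := by
  rw [int_sc x ht, cbb]
  congr 2; ext z
  rw [bb, bb, pp_sc x ht]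

theorem int_pos' {f : E3 → ℝ} (hf : Continuous f) (hc : HasCompactSupport f) (h0 : ∀ y, 0 ≤ f y) (h1 : 0 < f 0) : 0 < ∫ y, f y := by
  rw [integral_pos_iff_support_of_nonneg h0 (hf.integrable_of_hasCompactSupport hc)]
  exact hf.isOpen_support.measure_pos _ ⟨0, h1.ne'⟩

theorem rr_cs {x : E3} {t : ℝ} (ht : 0 < t) : HasCompactSupport (rr x t) := by
  refine HasCompactSupport.intro (isCompact_closedBall x t) fun y hy => rr_zero ht ?_
  rw [mem_closedBall, not_le] at hy
  exact hy.le

theorem c00_pos : 0 < c00 := int_pos' (cont_rr 0 1) (rr_cs one_pos) (rr_nn 0 one_pos) (by simp [rr, pp])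
theorem cbb_pos : 0 < cbb := int_pos' (cont_bb 0 1) (bb_cs one_pos) (bb_nn 0 1) (by simp [bb, pp])

def LP (w : E3 → ℝ) (x : E3) : Prop :=
  Filter.Tendsto (fun t => ⨍ y in closedBall x t, ‖w y - w x‖) (nhdsWithin 0 (Ioi 0)) (nhds 0)

theorem ae_LP {w : E3 → ℝ} (hw : Integrable w) : ∀ᵐ x, LP w x := by
  filter_upwards [IsUnifLocDoublingMeasure.ae_tendsto_average_norm_sub volume hw.locallyIntegrable 1] with x hx
  refine hx (fun _ => x) id Filter.tendsto_id ?_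
  filter_upwards [self_mem_nhdsWithin] with t ht
  exact mem_closedBall_self (by simpa using le_of_lt ht)

theorem LP_cont {w : E3 → ℝ} (hw : Continuous w) (x : E3) : LP w x := by
  rw [LP, Metric.tendsto_nhdsWithin_nhds]
  intro ε hε
  obtain ⟨δ, hδ, h⟩ := Metric.continuousAt_iff.1 hw.continuousAt (ε / 2) (half_pos hε)
  refine ⟨δ, hδ, fun {t} ht htd => ?_⟩
  rw [Real.dist_0_eq_abs] at htd
  have ht0 : (0:ℝ) < t := ht
  rw [abs_of_pos ht0] at htd
  have hv : volume.real (closedBall x t) ≠ 0 := (ENNReal.toReal_pos (measure_closedBall_pos volume x ht).ne' measure_closedBall_lt_top.ne).ne'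
  rw [Real.dist_0_eq_abs, setAverage_eq, smul_eq_mul]
  have := norm_setIntegral_le_of_norm_le_const (μ := volume) (s := closedBall x t) (f := fun y => ‖w y - w x‖) (C := ε / 2) measure_closedBall_lt_top
    fun y hy => by
      have := h (lt_of_le_of_lt hy htd)
      rw [dist_eq_norm] at this
      rw [norm_norm]; exact this.le
  rw [abs_mul, abs_inv, abs_of_nonneg measureReal_nonneg, inv_mul_lt_iff₀ (by positivity)]
  rw [Real.norm_eq_abs] at this
  have hv' : 0 < volume.real (closedBall x t) := by positivity
  nlinarith

theorem mv_lim {w : E3 → ℝ} (hw : Integrable w) {x : E3} (hx : LP w x) :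
    Filter.Tendsto (fun t => ∫ y, w y * rr x t y) (nhdsWithin 0 (Ioi 0)) (nhds (c00 * w x)) := by
  rw [tendsto_iff_norm_sub_tendsto_zero]
  have hx' := hx.const_mul (6 * vB)
  rw [mul_zero] at hx'
  refine squeeze_zero' (Filter.Eventually.of_forall fun _ => norm_nonneg _) ?_ hx'
  filter_upwards [self_mem_nhdsWithin] with t ht
  have ht : (0:ℝ) < t := ht
  have hr : Integrable (rr x t) := (cont_rr x t).integrable_of_hasCompactSupport (rr_cs ht)
  have hb : ∀ y, ‖rr x t y‖ ≤ 6 / t ^ 3 := fun y => by rw [Real.norm_eq_abs, abs_of_nonneg (rr_nn x ht y)]; exact rr_le x ht y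
  have hwr : Integrable (fun y => w y * rr x t y) := hw.mul_bdd hr.aestronglyMeasurable (Filter.Eventually.of_forall hb)
  have hwx : Integrable (fun y => w x * rr x t y) := hr.const_mul _
  rw [← int_rr x ht, mul_comm, ← integral_const_mul, ← integral_sub hwr hwx]
  have e : ∫ y, (w y * rr x t y - w x * rr x t y) = ∫ y in closedBall x t, (w y - w x) * rr x t y := by
    rw [setIntegral_eq_integral_of_forall_compl_eq_zero]
    · congr 1; ext y; ring
    · intro y hy
      rw [mem_closedBall, not_le] at hy
      rw [rr_zero ht hy.le, mul_zero]
  rw [e]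
  have hvB : volume.real (closedBall x t) = vB * t ^ 3 := by
    have h0 : 0 ≤ vB := ENNReal.toReal_nonneg
    rw [Measure.real, vol_cb' x ht.le, ENNReal.toReal_ofReal (by positivity)]
  have hv0 : 0 < vB * t ^ 3 := by
    rw [← hvB]
    exact ENNReal.toReal_pos (measure_closedBall_pos volume x ht).ne' measure_closedBall_lt_top.ne
  have hwi : IntegrableOn (fun y => ‖w y - w x‖) (closedBall x t) :=
    (hw.integrableOn.sub (integrableOn_const measure_closedBall_lt_top.ne)).norm
  calc _ ≤ ∫ y in closedBall x t, ‖w y - w x‖ * (6 / t ^ 3) := norm_integral_le_of_norm_le (hwi.mul_const _)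
          (Filter.Eventually.of_forall fun y => by
            rw [norm_mul]
            exact mul_le_mul_of_nonneg_left (hb y) (norm_nonneg _))
    _ = _ := by
      rw [integral_mul_const, setAverage_eq, smul_eq_mul, hvB]
      have : vB ≠ 0 := left_ne_zero_of_mul hv0.ne'
      field_simp

theorem grow {f f' : ℝ → ℝ} {T A L : ℝ} (hf : ∀ t, 0 < t → t < T → HasDerivAt f (f' t) t) (hA : ∀ t, 0 < t → t < T → f' t ≤ A * t)
    (hL : Filter.Tendsto f (nhdsWithin 0 (Ioi 0)) (nhds L)) {t : ℝ} (ht : 0 < t) (htT : t < T) : f t ≤ L + A / 2 * t ^ 2 := by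
  have hg : ∀ s ∈ Ioo 0 T, HasDerivAt (fun s => f s - A / 2 * s ^ 2) (f' s - A * s) s := fun s hs => by
    refine ((hf s hs.1 hs.2).sub ((hasDerivAt_pow 2 s).const_mul (A / 2))).congr_deriv ?_
    push_cast; ring
  have hanti : AntitoneOn (fun s => f s - A / 2 * s ^ 2) (Ioo 0 T) := by
    refine antitoneOn_of_deriv_nonpos (convex_Ioo 0 T) (fun s hs => (hg s hs).continuousAt.continuousWithinAt) ?_ ?_
    · rw [interior_Ioo]
      exact fun s hs => (hg s hs).differentiableAt.differentiableWithinAt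
    · rw [interior_Ioo]
      intro s hs
      rw [(hg s hs).deriv]
      linarith [hA s hs.1 hs.2]
  have h2 : Filter.Tendsto (fun s : ℝ => f s - A / 2 * s ^ 2) (nhdsWithin 0 (Ioi 0)) (nhds (L - A / 2 * 0 ^ 2)) := by
    refine hL.sub (Filter.Tendsto.mono_left ?_ nhdsWithin_le_nhds)
    exact Continuous.tendsto (by fun_prop) 0
  have h3 := ge_of_tendsto h2 (b := f t - A / 2 * t ^ 2) (by
    filter_upwards [Ioo_mem_nhdsGT ht] with s hs
    exact hanti ⟨hs.1, hs.2.trans htT⟩ ⟨ht, htT⟩ hs.2.le)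
  linarith
end

section
theorem T2.cf {φ : E3 → ℝ} {D D2} (h : T2 φ D D2) : Continuous φ := continuous_iff_continuousAt.2 fun x => (h.d1 x).continuousAt
theorem T2.cd {φ : E3 → ℝ} {D D2} (h : T2 φ D D2) : Continuous D := continuous_iff_continuousAt.2 fun x => (h.d2 x).continuousAt
theorem T2.ct {φ : E3 → ℝ} {D D2} (h : T2 φ D D2) : Continuous fun x => trc (D2 x) := cont_trc.comp h.c
theorem T2.eD {φ : E3 → ℝ} {D D2} (h : T2 φ D D2) : fderiv ℝ φ = D := funext fun x => (h.d1 x).fderiv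
theorem T2.eD2 {φ : E3 → ℝ} {D D2} (h : T2 φ D D2) : fderiv ℝ D = D2 := funext fun x => (h.d2 x).fderiv
theorem T2.ts {φ : E3 → ℝ} {D D2} (h : T2 φ D D2) : tsupport (fun x => trc (D2 x)) ⊆ tsupport φ := by
  have h1 := (tsupport_fderiv_subset ℝ (f := D)).trans ((h.eD ▸ tsupport_fderiv_subset ℝ (f := φ)) : tsupport D ⊆ tsupport φ)
  rw [h.eD2] at h1
  refine (closure_mono fun x hx => ?_).trans h1
  intro h0
  exact hx (by simp [trc, h0])
theorem T2.cs {φ : E3 → ℝ} {D D2} (h : T2 φ D D2) (hc : HasCompactSupport φ) : HasCompactSupport fun x => trc (D2 x) :=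
  hc.of_isClosed_subset (isClosed_tsupport _) h.ts

theorem green {φ ψ : E3 → ℝ} {D D2 E E2} (h : T2 φ D D2) (k : T2 ψ E E2) (hc : HasCompactSupport φ) (kc : HasCompactSupport ψ) :
    ∫ x, φ x * trc (E2 x) = ∫ x, trc (D2 x) * ψ x := by
  have hD : HasCompactSupport D := h.eD ▸ hc.fderiv (𝕜 := ℝ)
  have hE : HasCompactSupport E := k.eD ▸ kc.fderiv (𝕜 := ℝ)
  have hD2 : HasCompactSupport D2 := h.eD2 ▸ hD.fderiv (𝕜 := ℝ)
  have e1 : ∀ i, HasCompactSupport fun x => D x (ee i) := fun i => hD.comp_left (g := fun L : E3 →L[ℝ] ℝ => L (ee i)) rfl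
  have e2 : ∀ i, HasCompactSupport fun x => D2 x (ee i) (ee i) := fun i => hD2.comp_left (g := fun L : BL => L (ee i) (ee i)) rfl
  have c1 : ∀ i, Continuous fun x => D x (ee i) := fun i => h.cd.clm_apply continuous_const
  have c2 : ∀ i, Continuous fun x => E x (ee i) := fun i => k.cd.clm_apply continuous_const
  have c3 : ∀ i, Continuous fun x => D2 x (ee i) (ee i) := fun i => (h.c.clm_apply continuous_const).clm_apply continuous_const
  have c4 : ∀ i, Continuous fun x => E2 x (ee i) (ee i) := fun i => (k.c.clm_apply continuous_const).clm_apply continuous_const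
  have d1 : ∀ i x, HasFDerivAt (fun x => D x (ee i)) ((D2 x).flip (ee i)) x := fun i x => by
    simpa using (h.d2 x).clm_apply (hasFDerivAt_const (ee i) x)
  have d2 : ∀ i x, HasFDerivAt (fun x => E x (ee i)) ((E2 x).flip (ee i)) x := fun i x => by
    simpa using (k.d2 x).clm_apply (hasFDerivAt_const (ee i) x)
  have I1 : ∀ i, Integrable fun x => φ x * E2 x (ee i) (ee i) := fun i => (h.cf.mul (c4 i)).integrable_of_hasCompactSupport hc.mul_right
  have I2 : ∀ i, Integrable fun x => D x (ee i) * E x (ee i) := fun i => ((c1 i).mul (c2 i)).integrable_of_hasCompactSupport (e1 i).mul_right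
  have I3 : ∀ i, Integrable fun x => D2 x (ee i) (ee i) * ψ x := fun i => ((c3 i).mul k.cf).integrable_of_hasCompactSupport (e2 i).mul_right
  have I4 : ∀ i, Integrable fun x => φ x * E x (ee i) := fun i => (h.cf.mul (c2 i)).integrable_of_hasCompactSupport hc.mul_right
  have I5 : ∀ i, Integrable fun x => D x (ee i) * ψ x := fun i => ((c1 i).mul k.cf).integrable_of_hasCompactSupport (e1 i).mul_right
  simp only [trc, Finset.mul_sum, Finset.sum_mul]
  rw [integral_finsetSum _ fun i _ => I1 i, integral_finsetSum _ fun i _ => I3 i]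
  refine Finset.sum_congr rfl fun i _ => ?_
  have g1 := integral_mul_fderiv_eq_neg_fderiv_mul_of_integrable (μ := volume) (f := φ) (g := fun x => E x (ee i)) (v := ee i)
    (by simpa only [(h.d1 _).fderiv] using I2 i) (by simpa only [(d2 i _).fderiv, ContinuousLinearMap.flip_apply] using I1 i) (I4 i)
    (fun x _ => (h.d1 x).differentiableAt) (fun x _ => (d2 i x).differentiableAt)
  have g2 := integral_mul_fderiv_eq_neg_fderiv_mul_of_integrable (μ := volume) (f := fun x => D x (ee i)) (g := ψ) (v := ee i)
    (by simpa only [(d1 i _).fderiv, ContinuousLinearMap.flip_apply] using I3 i) (by simpa only [(k.d1 _).fderiv] using I2 i) (I5 i)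
    (fun x _ => (d1 i x).differentiableAt) (fun x _ => (k.d1 x).differentiableAt)
  simp only [(h.d1 _).fderiv, (d2 i _).fderiv, ContinuousLinearMap.flip_apply] at g1
  simp only [(k.d1 _).fderiv, (d1 i _).fderiv, ContinuousLinearMap.flip_apply] at g2
  rw [g1, g2, neg_neg]

theorem rr_symm (x y : E3) (t : ℝ) : rr x t y = rr y t x := by rw [rr, rr, pp, pp, norm_sub_rev]

theorem sub_base {U η : E3 → ℝ} {D D2} (hU : Integrable U) (hU0 : ∀ x, 0 ≤ U x) (hη : T2 η D D2) (hc : HasCompactSupport η)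
    (h0 : ∀ x, 0 ≤ η x) {T : ℝ} (hT : 0 < T)
    (h : ∀ᵐ x, x ∈ tsupport η → ∀ t, 0 < t → t < T → c00 * U x ≤ ∫ y, U y * rr x t y) : 0 ≤ ∫ y, U y * trc (D2 y) := by
  have hηi : Integrable η := hη.cf.integrable_of_hasCompactSupport hc
  have hbd : ∀ {f : E3 → ℝ}, Continuous f → HasCompactSupport f → Integrable fun y => U y * f y := fun {f} hf hfc => by
    obtain ⟨C, hC⟩ := hfc.exists_bound_of_continuous hf
    exact hU.mul_bdd hf.aestronglyMeasurable (Filter.Eventually.of_forall hC)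
  have iT := hbd hη.ct (hη.cs hc)
  have iE := hbd hη.cf hc
  suffices hs : ∀ ε > 0, 0 ≤ (∫ y, U y * trc (D2 y)) + ε * ∫ y, U y by
    have hUU : 0 ≤ ∫ y, U y := integral_nonneg hU0
    by_contra hneg
    push Not at hneg
    have := hs (-(∫ y, U y * trc (D2 y)) / (2 * ((∫ y, U y) + 1))) (div_pos (by linarith) (by positivity))
    have h2 : (-(∫ y, U y * trc (D2 y)) / (2 * ((∫ y, U y) + 1))) * ∫ y, U y ≤ -(∫ y, U y * trc (D2 y)) / 2 := by
      rw [div_mul_eq_mul_div, div_le_div_iff₀ (by positivity) (by norm_num)]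
      nlinarith
    linarith
  intro ε hε
  obtain ⟨δ, hδ, hu⟩ := Metric.uniformContinuous_iff.1 ((hη.cs hc).uniformContinuous_of_continuous hη.ct) ε hε
  set t := min T δ / 2 with htd
  have hm : 0 < min T δ := lt_min hT hδ
  have ht : 0 < t := by positivity
  have htT : t < min T δ := by linarith
  have hJ : ∀ y, ∫ x, η x * rr y t x ≤ c00 * η y + (cbb * (trc (D2 y) + ε)) / 2 * t ^ 2 := by
    intro y
    refine grow (T := min T δ) (fun s hs _ => mv_der hηi y hs) (fun s hs hsT => ?_) (mv_lim hηi (LP_cont hη.cf y)) ht htT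
    obtain ⟨E, E2, hE, hE2⟩ := bb_T2 y hs
    have g := green hη hE hc (bb_cs hs)
    simp only [hE2] at g
    have hbi : Integrable (bb y s) := (cont_bb y s).integrable_of_hasCompactSupport (bb_cs hs)
    have : ∫ x, trc (D2 x) * bb y s x ≤ ∫ x, (trc (D2 y) + ε) * bb y s x := by
      refine integral_mono ((hη.ct.mul (cont_bb y s)).integrable_of_hasCompactSupport (bb_cs hs).mul_left) (hbi.const_mul _) fun x => ?_
      by_cases hx : s ≤ dist x y
      · simp [bb_zero hs hx]
      · push Not at hx
        have := hu (hx.trans (hsT.trans_le (min_le_right _ _)))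
        rw [Real.dist_eq] at this
        exact mul_le_mul_of_nonneg_right (by linarith [(abs_lt.1 this).2]) (bb_nn _ _ _)
    rw [g, div_le_iff₀ (by positivity)]
    refine this.trans_eq ?_
    rw [integral_const_mul, int_bb y hs]
    ring
  have hcr : Continuous fun p : E3 × E3 => rr p.1 t p.2 := by unfold rr pp; fun_prop
  have hpi : Integrable (fun p : E3 × E3 => η p.1 * U p.2 * rr p.1 t p.2) (volume.prod volume) := by
    refine (hηi.mul_prod hU).mul_bdd (c := 6 / t ^ 3) hcr.aestronglyMeasurable (Filter.Eventually.of_forall fun p => ?_)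
    rw [Real.norm_eq_abs, abs_of_nonneg (rr_nn _ ht _)]
    exact rr_le _ ht _
  have hsw := integral_integral_swap (f := fun x y => η x * U y * rr x t y) hpi
  have e1 : ∀ x, ∫ y, η x * U y * rr x t y = η x * ∫ y, U y * rr x t y := fun x => by
    rw [← integral_const_mul]; simp only [mul_assoc]
  have e2 : ∀ y, ∫ x, η x * U y * rr x t y = U y * ∫ x, η x * rr y t x := fun y => by
    rw [← integral_const_mul]; congr 1; ext x; rw [rr_symm x y]; ring
  have hi1 := hpi.integral_prod_left
  have hi2 := hpi.integral_prod_right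
  simp only [e1, e2] at hsw hi1 hi2
  have k1 : ∫ x, U x * η x * c00 ≤ ∫ x, η x * ∫ y, U y * rr x t y := by
    refine integral_mono_ae (iE.mul_const _) hi1 ?_
    filter_upwards [h] with x hx
    by_cases hxs : x ∈ tsupport η
    · have := mul_le_mul_of_nonneg_left (hx hxs t ht (htT.trans_le (min_le_left _ _))) (h0 x)
      linarith
    · simp [image_eq_zero_of_notMem_tsupport hxs]
  have i3 : Integrable fun y => U y * η y * c00 + (cbb / 2 * t ^ 2) * (U y * trc (D2 y) + ε * U y) :=
    (iE.mul_const _).add ((iT.add (hU.const_mul ε)).const_mul _)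
  have k2 : ∫ y, U y * ∫ x, η x * rr y t x ≤ ∫ y, (U y * η y * c00 + (cbb / 2 * t ^ 2) * (U y * trc (D2 y) + ε * U y)) := by
    refine integral_mono hi2 i3 fun y => ?_
    have := mul_le_mul_of_nonneg_left (hJ y) (hU0 y)
    simp only
    linarith
  have i4 : Integrable fun y => U y * trc (D2 y) + ε * U y := iT.add (hU.const_mul ε)
  rw [integral_add (iE.mul_const _) (i4.const_mul _), integral_const_mul, integral_add iT (hU.const_mul ε), integral_const_mul] at k2
  have k3 : 0 ≤ (cbb / 2 * t ^ 2) * ((∫ y, U y * trc (D2 y)) + ε * ∫ y, U y) := by linarith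
  have := cbb_pos
  exact nonneg_of_mul_nonneg_right k3 (by positivity)
end

section
theorem cut1 : ∃ C : ℝ, 0 ≤ C ∧ ∀ ε δ : ℝ, 0 < ε → 2 * ε < δ → ∃ k k1 k2 : ℝ → ℝ, (∀ s, HasDerivAt k (k1 s) s) ∧
    (∀ s, HasDerivAt k1 (k2 s) s) ∧ Continuous k2 ∧ (∀ s, 0 ≤ k s ∧ k s ≤ 1) ∧ (∀ s ≤ ε, k s = 0) ∧ (∀ s, δ ≤ s → k s = 1) ∧
    (∀ s, 0 < s → |k1 s| ≤ C / δ) ∧ (∀ s, δ ≤ s → k1 s = 0) ∧ (∀ s, 0 < s → k2 s ≤ C / (ε * δ)) ∧ ∀ s, 2 * ε < s → k2 s ≤ 0 := by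
  obtain ⟨χ, B, hB, hχ, h0, h1, h01, hb1, hb2, hd0⟩ := exists_chi
  have hχ1 : ContDiff ℝ 1 (deriv χ) := ((contDiff_succ_iff_deriv (n := 1)).1 (by simpa [one_add_one_eq_two] using hχ)).2.2
  have dχ : ∀ s, HasDerivAt χ (deriv χ s) s := fun s => (hχ.differentiable (by norm_num) s).hasDerivAt
  have dχ1 : ∀ s, HasDerivAt (deriv χ) (deriv (deriv χ) s) s := fun s => (hχ1.differentiable (by norm_num) s).hasDerivAt
  have cχ2 : Continuous (deriv (deriv χ)) := hχ1.continuous_deriv le_rfl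
  have hd2 : ∀ s, 2 < s → deriv (deriv χ) s = 0 := fun s hs => by
    have : deriv χ =ᶠ[nhds s] fun _ => (0:ℝ) := by
      filter_upwards [Ioi_mem_nhds hs] with u hu using hd0 u hu
    rw [this.deriv_eq]; simp
  refine ⟨18 * B + 6, by positivity, fun ε δ hε hδ => ?_⟩
  have hδ0 : 0 < δ := by linarith
  set p : ℝ → ℝ := fun s => max (1 - s / δ) 0 with hp
  have hl : ∀ s, HasDerivAt (fun s : ℝ => 1 - s / δ) (-(1 / δ)) s := fun s => ((hasDerivAt_id s).div_const δ).const_sub 1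
  have dg : ∀ s, HasDerivAt (fun s => 1 - p s ^ 3) (3 / δ * p s ^ 2) s := fun s => by
    refine (((pos_pow_deriv (k := 2) (by norm_num) (1 - s / δ)).comp s (hl s)).const_sub 1).congr_deriv ?_
    simp only [hp]; push_cast; ring
  have dg1 : ∀ s, HasDerivAt (fun s => 3 / δ * p s ^ 2) (-(6 / δ ^ 2 * p s)) s := fun s => by
    refine (((pos_pow_deriv (k := 1) le_rfl (1 - s / δ)).comp s (hl s)).const_mul (3 / δ)).congr_deriv ?_
    simp only [hp]; push_cast; field_simp; ring
  have dX : ∀ s, HasDerivAt (fun s => χ (s / ε)) (deriv χ (s / ε) / ε) s := fun s => by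
    refine ((dχ (s / ε)).comp s ((hasDerivAt_id s).div_const ε)).congr_deriv ?_
    ring
  have dX1 : ∀ s, HasDerivAt (fun s => deriv χ (s / ε) / ε) (deriv (deriv χ) (s / ε) / ε ^ 2) s := fun s => by
    refine (((dχ1 (s / ε)).comp s ((hasDerivAt_id s).div_const ε)).div_const ε).congr_deriv ?_
    field_simp
  have p0 : ∀ s, 0 ≤ p s := fun s => le_max_right _ _
  have p1 : ∀ s, 0 < s → p s ≤ 1 := fun s hs => max_le (by have : 0 < s / δ := by positivity
                                                           linarith) zero_le_one
  have pg : ∀ s, 0 < s → 1 - p s ≤ s / δ := fun s _ => by linarith [le_max_left (1 - s / δ) 0]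
  have pz : ∀ s, δ ≤ s → p s = 0 := fun s hs => max_eq_right (by rw [sub_nonpos, le_div_iff₀ hδ0]; linarith)
  have g0 : ∀ s, 0 < s → 0 ≤ 1 - p s ^ 3 := fun s hs => by linarith [pow_le_one₀ (n := 3) (p0 s) (p1 s hs)]
  have g3 : ∀ s, 0 < s → 1 - p s ^ 3 ≤ 3 * (s / δ) := fun s hs => by
    have := pg s hs
    nlinarith [p0 s, p1 s hs, mul_nonneg (p0 s) (p0 s), mul_nonneg (sub_nonneg.2 (p1 s hs)) (p0 s)]
  have q1 : ∀ s, 0 < s → p s ^ 2 ≤ 1 := fun s hs => pow_le_one₀ (p0 s) (p1 s hs)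
  have hse : ∀ s, s ≤ ε → s / ε ≤ 1 := fun s hs => by rwa [div_le_one hε]
  have hse2 : ∀ s, 2 * ε < s → 2 < s / ε := fun s hs => by rwa [lt_div_iff₀ hε]
  refine ⟨fun s => χ (s / ε) * (1 - p s ^ 3), fun s => deriv χ (s / ε) / ε * (1 - p s ^ 3) + χ (s / ε) * (3 / δ * p s ^ 2),
    fun s => deriv (deriv χ) (s / ε) / ε ^ 2 * (1 - p s ^ 3) + deriv χ (s / ε) / ε * (3 / δ * p s ^ 2) +
      (deriv χ (s / ε) / ε * (3 / δ * p s ^ 2) + χ (s / ε) * (-(6 / δ ^ 2 * p s))), fun s => (dX s).mul (dg s),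
    fun s => ((dX1 s).mul (dg s)).add ((dX s).mul (dg1 s)), ?_, ?_, ?_, ?_, ?_, ?_, ?_, ?_⟩
  · have := hχ.continuous
    have := hχ1.continuous
    simp only [hp]
    fun_prop
  · intro s
    by_cases hs : s ≤ ε
    · simp [h0 _ (hse s hs)]
    · have hs0 : 0 < s := by linarith
      exact ⟨mul_nonneg (h01 _).1 (g0 s hs0), mul_le_one₀ (h01 _).2 (g0 s hs0) (by linarith [pow_nonneg (p0 s) 3])⟩
  · intro s hs
    simp [h0 _ (hse s hs)]
  · intro s hs
    simp [pz s hs, h1 _ (hse2 s (by linarith)).le]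
  · intro s hs
    have a1 : |deriv χ (s / ε) / ε * (1 - p s ^ 3)| ≤ 6 * B / δ := by
      by_cases h : 2 * ε < s
      · rw [hd0 _ (hse2 s h)]; simp; positivity
      · rw [abs_mul, abs_div, abs_of_pos hε, abs_of_nonneg (g0 s hs)]
        calc _ ≤ B / ε * (3 * ((2 * ε) / δ)) := by
              have h3 := g3 s hs
              have h4 : s / δ ≤ (2 * ε) / δ := by gcongr; linarith
              exact mul_le_mul (by gcongr; exact hb1 _) (by linarith) (g0 s hs) (by positivity)
          _ = _ := by field_simp; try ring
    have a2 : |χ (s / ε) * (3 / δ * p s ^ 2)| ≤ 3 / δ := by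
      rw [abs_of_nonneg (mul_nonneg (h01 _).1 (by positivity))]
      calc _ ≤ 1 * (3 / δ * 1) := by
            refine mul_le_mul (h01 _).2 ?_ (by positivity) zero_le_one
            gcongr
            exact q1 s hs
        _ = _ := by ring
    refine (abs_add_le _ _).trans ((add_le_add a1 a2).trans ?_)
    rw [← add_div]
    exact div_le_div_of_nonneg_right (by linarith) (by positivity)
  · intro s hs
    simp [pz s hs, hd0 _ (hse2 s (by linarith))]
  · intro s hs
    have a0 : χ (s / ε) * (-(6 / δ ^ 2 * p s)) ≤ 0 := by
      have : 0 ≤ χ (s / ε) * (6 / δ ^ 2 * p s) := mul_nonneg (h01 _).1 (mul_nonneg (by positivity) (p0 s))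
      linarith
    have a1 : deriv (deriv χ) (s / ε) / ε ^ 2 * (1 - p s ^ 3) ≤ 6 * B / (ε * δ) := by
      by_cases h : 2 * ε < s
      · rw [hd2 _ (hse2 s h)]; simp; positivity
      · calc _ ≤ B / ε ^ 2 * (3 * ((2 * ε) / δ)) := by
              have h3 := g3 s hs
              have h4 : s / δ ≤ (2 * ε) / δ := by gcongr; linarith
              exact mul_le_mul (by gcongr; exact (le_abs_self _).trans (hb2 _)) (by linarith) (g0 s hs) (by positivity)
          _ = _ := by field_simp; try ring
    have a2 : deriv χ (s / ε) / ε * (3 / δ * p s ^ 2) ≤ 3 * B / (ε * δ) := by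
      calc _ ≤ B / ε * (3 / δ * 1) := by
            refine mul_le_mul (by gcongr; exact (le_abs_self _).trans (hb1 _)) ?_ (by positivity) (by positivity)
            gcongr
            exact q1 s hs
        _ = _ := by field_simp
    have a3 : 6 * B / (ε * δ) + 3 * B / (ε * δ) + 3 * B / (ε * δ) ≤ (18 * B + 6) / (ε * δ) := by
      rw [← add_div, ← add_div]
      exact div_le_div_of_nonneg_right (by linarith) (by positivity)
    linarith
  · intro s hs
    have : 0 ≤ χ (s / ε) * (6 / δ ^ 2 * p s) := mul_nonneg (h01 _).1 (mul_nonneg (by positivity) (p0 s))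
    beta_reduce
    rw [hd2 _ (hse2 s hs), hd0 _ (hse2 s hs)]
    simp only [zero_div, zero_mul, zero_add]
    linarith

theorem T2.cut {η : E3 → ℝ} {D D2} (h : T2 η D D2) {k k1 k2 : ℝ → ℝ} (hk : ∀ s, HasDerivAt k (k1 s) s)
    (hk1 : ∀ s, HasDerivAt k1 (k2 s) s) (hk2 : Continuous k2) (m : E3) (c : ℝ) :
    ∃ E E2, T2 (fun x => η x * k (⟪m, x⟫ - c)) E E2 ∧ ∀ x, trc (E2 x) = k (⟪m, x⟫ - c) * trc (D2 x) + 2 * (k1 (⟪m, x⟫ - c) * D x m) +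
      η x * k2 (⟪m, x⟫ - c) * ‖m‖ ^ 2 := by
  set I : E3 →L[ℝ] ℝ := innerSL ℝ m with hI
  have hI' : ∀ x, I x = ⟪m, x⟫ := fun _ => rfl
  have hs : ∀ x, HasFDerivAt (fun x : E3 => ⟪m, x⟫ - c) I x := fun x => (I.hasFDerivAt (x := x)).sub_const c
  have d0 : ∀ x, HasFDerivAt (fun x => k (⟪m, x⟫ - c)) (k1 (⟪m, x⟫ - c) • I) x := fun x => (hk _).comp_hasFDerivAt x (hs x)
  have d1 : ∀ x, HasFDerivAt (fun x => k1 (⟪m, x⟫ - c)) (k2 (⟪m, x⟫ - c) • I) x := fun x => (hk1 _).comp_hasFDerivAt x (hs x)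
  have ck : Continuous k := continuous_iff_continuousAt.2 fun s => (hk s).continuousAt
  have ck1 : Continuous k1 := continuous_iff_continuousAt.2 fun s => (hk1 s).continuousAt
  refine ⟨fun x => η x • (k1 (⟪m, x⟫ - c) • I) + k (⟪m, x⟫ - c) • D x,
    fun x => (η x • (k2 (⟪m, x⟫ - c) • I).smulRight I + (D x).smulRight (k1 (⟪m, x⟫ - c) • I)) +
      (k (⟪m, x⟫ - c) • D2 x + (k1 (⟪m, x⟫ - c) • I).smulRight (D x)), ⟨fun x => (h.d1 x).mul (d0 x), fun x => ?_, ?_⟩, fun x => ?_⟩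
  · exact ((h.d1 x).smul ((d1 x).smul_const I)).add ((d0 x).smul (h.d2 x))
  · have := h.cf
    have cD : ∀ a, Continuous fun x => D x a := fun a => h.cd.clm_apply continuous_const
    have cD2 : ∀ a b, Continuous fun x => D2 x a b := fun a b => (h.c.clm_apply continuous_const).clm_apply continuous_const
    rw [continuous_clm_apply]; intro a
    rw [continuous_clm_apply]; intro b
    have := cD a
    have := cD b
    have := cD2 a b
    simp only [add_apply, smul_apply, ContinuousLinearMap.smulRight_apply, smul_eq_mul]
    fun_prop
  · have e1 : ∑ i, m i * m i = ‖m‖ ^ 2 := by rw [EuclideanSpace.norm_sq_eq]; simp [sq]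
    have e2 : D x m = ∑ i, m i * D x (ee i) := by
      conv_lhs => rw [← e_sum m]
      simp only [map_sum, map_smul, smul_eq_mul]
    rw [e2, ← e1]
    simp only [trc, add_apply, smul_apply, ContinuousLinearMap.smulRight_apply, smul_eq_mul, hI', inner_ee, Fin.sum_univ_three]
    ring
end

section
theorem removal {U η : E3 → ℝ} {D D2} (hU : Integrable U) (hU0 : ∀ x, 0 ≤ U x) (m : E3) (c : ℝ)
    (hs : ∀ x, U x ≠ 0 → 0 < ⟪m, x⟫ - c) (hη : T2 η D D2) (hc : HasCompactSupport η) (h0 : ∀ x, 0 ≤ η x)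
    (hM : ∀ γ > 0, ∃ ε0 > 0, ∀ ε, 0 < ε → ε < ε0 → ∫ x in tsupport η ∩ {x | ⟪m, x⟫ - c < ε}, U x ≤ γ * ε)
    (hP : ∀ ε > 0, ∀ φ E E2, T2 φ E E2 → (∀ x, 0 ≤ φ x) → tsupport φ ⊆ tsupport η ∩ {x | ε ≤ ⟪m, x⟫ - c} →
      0 ≤ ∫ x, U x * trc (E2 x)) : 0 ≤ ∫ x, U x * trc (D2 x) := by
  obtain ⟨C, hC, hcut⟩ := cut1
  have hK : IsCompact (tsupport η) := hc
  obtain ⟨B0, hB0⟩ := hK.exists_bound_of_continuousOn hη.ct.continuousOn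
  obtain ⟨B1, hB1⟩ := hK.exists_bound_of_continuousOn (f := fun x => D x m) (hη.cd.clm_apply continuous_const).continuousOn
  obtain ⟨B2, hB2⟩ := hK.exists_bound_of_continuousOn hη.cf.continuousOn
  have hSm : ∀ ε : ℝ, MeasurableSet (tsupport η ∩ {x | ⟪m, x⟫ - c < ε}) := fun ε =>
    hK.measurableSet.inter (measurableSet_lt (by fun_prop) measurable_const)
  have iUt : ∀ {φ : E3 → ℝ} {E E2}, T2 φ E E2 → HasCompactSupport φ → Integrable fun x => U x * trc (E2 x) := fun h hc =>
    hU.mul_of_top_left (h.ct.memLp_top_of_hasCompactSupport (h.cs hc) _)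
  suffices H : ∀ γ > 0, 0 ≤ (∫ x, U x * trc (D2 x)) + γ * (|B0| + 2 * |B1| * C + 3 * |B2| * C * ‖m‖ ^ 2) by
    have hlim : Filter.Tendsto (fun γ => (∫ x, U x * trc (D2 x)) + γ * (|B0| + 2 * |B1| * C + 3 * |B2| * C * ‖m‖ ^ 2))
        (nhdsWithin 0 (Ioi 0)) (nhds ((∫ x, U x * trc (D2 x)) + 0 * (|B0| + 2 * |B1| * C + 3 * |B2| * C * ‖m‖ ^ 2))) :=
      ((Continuous.tendsto (by fun_prop) 0).mono_left nhdsWithin_le_nhds)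
    simp only [zero_mul, add_zero] at hlim
    exact ge_of_tendsto hlim (by filter_upwards [self_mem_nhdsWithin] with γ hγ using H γ hγ)
  intro γ hγ
  obtain ⟨e1, he1, hM1⟩ := hM γ hγ
  obtain ⟨δ, hδ0, hδ⟩ : ∃ δ : ℝ, 0 < δ ∧ δ < e1 ∧ δ ≤ 1 := ⟨min (e1 / 2) 1, by positivity, by
    have := min_le_left (e1 / 2) 1
    linarith, min_le_right _ _⟩
  obtain ⟨e2, he2, hM2⟩ := hM (γ * δ) (by positivity)
  obtain ⟨ε, hε0, hε1, hε2⟩ : ∃ ε : ℝ, 0 < ε ∧ 3 * ε < e2 ∧ 2 * ε < δ := ⟨min (e2 / 4) (δ / 4), by positivity, by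
    have := min_le_left (e2 / 4) (δ / 4)
    linarith, by
    have := min_le_right (e2 / 4) (δ / 4)
    linarith⟩
  obtain ⟨k, k1, k2, hk, hk1, ck2, k01, kz, ko, b1, z1, b2, n2⟩ := hcut ε δ hε0 hε2
  obtain ⟨E, E2, hE, tE⟩ := hη.cut hk hk1 ck2 m c
  have hsub : tsupport (fun x => η x * k (⟪m, x⟫ - c)) ⊆ tsupport η ∩ {x | ε ≤ ⟪m, x⟫ - c} := by
    refine closure_minimal (fun x hx => ?_) ((isClosed_tsupport η).inter (isClosed_le continuous_const (by fun_prop)))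
    rw [Function.mem_support] at hx
    refine ⟨subset_tsupport _ (left_ne_zero_of_mul hx), ?_⟩
    by_contra h
    simp only [mem_setOf_eq, not_le] at h
    exact hx (by rw [kz _ h.le, mul_zero])
  have h1 := hP ε hε0 _ _ _ hE (fun x => mul_nonneg (h0 x) (k01 _).1) hsub
  have hcE : HasCompactSupport (fun x => η x * k (⟪m, x⟫ - c)) := hK.of_isClosed_subset (isClosed_tsupport _) (hsub.trans inter_subset_left)
  set A : ℝ := |B0| + 2 * (C / δ * |B1|) with hA
  set B : ℝ := |B2| * (C / (ε * δ)) * ‖m‖ ^ 2 with hB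
  have hA0 : 0 ≤ A := by positivity
  have hB0' : 0 ≤ B := by positivity
  have i1 := iUt hη hc
  have i2 : ∀ (a ε : ℝ), Integrable fun x => (tsupport η ∩ {x | ⟪m, x⟫ - c < ε}).indicator (fun x => a * U x) x := fun a ε =>
    (hU.const_mul a).indicator (hSm ε)
  have h2 : ∫ x, U x * trc (E2 x) ≤ ∫ x, (U x * trc (D2 x) + (tsupport η ∩ {x | ⟪m, x⟫ - c < δ}).indicator (fun x => A * U x) x) +
      (tsupport η ∩ {x | ⟪m, x⟫ - c < 3 * ε}).indicator (fun x => B * U x) x := by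
    refine integral_mono (iUt hE hcE) ((i1.add (i2 A δ)).add (i2 B (3 * ε))) fun x => ?_
    have n1 : 0 ≤ (tsupport η ∩ {x | ⟪m, x⟫ - c < δ}).indicator (fun x => A * U x) x := indicator_nonneg (fun x _ => mul_nonneg hA0 (hU0 x)) x
    have n3 : 0 ≤ (tsupport η ∩ {x | ⟪m, x⟫ - c < 3 * ε}).indicator (fun x => B * U x) x := indicator_nonneg (fun x _ => mul_nonneg hB0' (hU0 x)) x
    beta_reduce
    by_cases hu : U x = 0
    · rw [hu, zero_mul, zero_mul]; linarith
    have sp := hs x hu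
    by_cases hx : x ∈ tsupport η
    swap
    · have z2 : trc (E2 x) = 0 := image_eq_zero_of_notMem_tsupport (f := fun x => trc (E2 x)) fun h => hx (hsub (hE.ts h)).1
      have z3 : trc (D2 x) = 0 := image_eq_zero_of_notMem_tsupport (f := fun x => trc (D2 x)) fun h => hx (hη.ts h)
      rw [z2, z3]; linarith
    have t0 : |trc (D2 x)| ≤ |B0| := (hB0 x hx).trans (le_abs_self _)
    have t1 : |D x m| ≤ |B1| := (hB1 x hx).trans (le_abs_self _)
    have t2 : η x ≤ |B2| := (le_abs_self _).trans ((hB2 x hx).trans (le_abs_self _))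
    set s := ⟪m, x⟫ - c with hsd
    have f1 : U x * ((k s - 1) * trc (D2 x) + 2 * (k1 s * D x m)) ≤ (tsupport η ∩ {x | ⟪m, x⟫ - c < δ}).indicator (fun x => A * U x) x := by
      by_cases h : s < δ
      · have hm : x ∈ tsupport η ∩ {x | ⟪m, x⟫ - c < δ} := ⟨hx, h⟩
        rw [indicator_of_mem hm, mul_comm A]
        refine mul_le_mul_of_nonneg_left (add_le_add ?_ ?_) (hU0 x)
        · refine (le_abs_self _).trans ?_
          rw [abs_mul]
          have : |k s - 1| ≤ 1 := abs_le.2 ⟨by linarith [(k01 s).1], by linarith [(k01 s).2]⟩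
          nlinarith [abs_nonneg (trc (D2 x)), abs_nonneg (k s - 1)]
        · refine mul_le_mul_of_nonneg_left ((le_abs_self _).trans ?_) zero_le_two
          rw [abs_mul]
          exact mul_le_mul (b1 s sp) t1 (abs_nonneg _) (by positivity)
      · push Not at h
        rw [ko s h, z1 s h]
        simpa using n1
    have f2 : U x * (η x * k2 s * ‖m‖ ^ 2) ≤ (tsupport η ∩ {x | ⟪m, x⟫ - c < 3 * ε}).indicator (fun x => B * U x) x := by
      by_cases h : s < 3 * ε
      · have hm : x ∈ tsupport η ∩ {x | ⟪m, x⟫ - c < 3 * ε} := ⟨hx, h⟩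
        rw [indicator_of_mem hm, mul_comm B]
        refine mul_le_mul_of_nonneg_left (mul_le_mul_of_nonneg_right ?_ (by positivity)) (hU0 x)
        calc η x * k2 s ≤ η x * (C / (ε * δ)) := mul_le_mul_of_nonneg_left (b2 s sp) (h0 x)
          _ ≤ _ := mul_le_mul_of_nonneg_right t2 (by positivity)
      · push Not at h
        refine le_trans ?_ n3
        exact mul_nonpos_of_nonneg_of_nonpos (hU0 x) (mul_nonpos_of_nonpos_of_nonneg
          (mul_nonpos_of_nonneg_of_nonpos (h0 x) (n2 s (by linarith))) (by positivity))
    rw [tE x]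
    calc _ = U x * trc (D2 x) + U x * ((k s - 1) * trc (D2 x) + 2 * (k1 s * D x m)) + U x * (η x * k2 s * ‖m‖ ^ 2) := by ring
      _ ≤ _ := by linarith
  have i12 : Integrable fun x => U x * trc (D2 x) + (tsupport η ∩ {x | ⟪m, x⟫ - c < δ}).indicator (fun x => A * U x) x := i1.add (i2 A δ)
  rw [integral_add i12 (i2 B (3 * ε)), integral_add i1 (i2 A δ), integral_indicator (hSm _), integral_indicator (hSm _),
    integral_const_mul, integral_const_mul] at h2
  have m1 := mul_le_mul_of_nonneg_left (hM1 δ hδ0 hδ.1) hA0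
  have m2 := mul_le_mul_of_nonneg_left (hM2 (3 * ε) (by positivity) hε1) hB0'
  have e1' : A * (γ * δ) ≤ γ * (|B0| + 2 * |B1| * C) := by
    have : A * (γ * δ) = γ * (|B0| * δ + 2 * |B1| * C) := by rw [hA]; field_simp
    rw [this]
    have : |B0| * δ ≤ |B0| := mul_le_of_le_one_right (abs_nonneg _) hδ.2
    exact mul_le_mul_of_nonneg_left (by linarith) hγ.le
  have e2' : B * (γ * δ * (3 * ε)) = γ * (3 * |B2| * C * ‖m‖ ^ 2) := by rw [hB]; field_simp
  linarith
end

section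
theorem rr_lip (x x' y : E3) {t : ℝ} (ht : 0 < t) : |rr x t y - rr x' t y| ≤ 24 / t ^ 4 * ‖x - x'‖ := by
  have hp : ∀ x, pp x t y = 1 - min ‖y - x‖ t ^ 2 / t ^ 2 := fun x => by
    rcases le_total ‖y - x‖ t with h | h
    · rw [min_eq_left h, pp, max_eq_left]
      rw [sub_nonneg, div_le_one (by positivity)]
      exact pow_le_pow_left₀ (norm_nonneg _) h 2
    · rw [min_eq_right h, pp, max_eq_right, div_self (by positivity), sub_self]
      rw [sub_nonpos, one_le_div (by positivity)]
      exact pow_le_pow_left₀ ht.le h 2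
  have h1 : |pp x t y - pp x' t y| ≤ 2 / t * ‖x - x'‖ := by
    have e : pp x t y - pp x' t y = (min ‖y - x'‖ t - min ‖y - x‖ t) * ((min ‖y - x'‖ t + min ‖y - x‖ t) / t ^ 2) := by
      rw [hp, hp]; ring
    have a1 : |min ‖y - x'‖ t - min ‖y - x‖ t| ≤ ‖x - x'‖ := by
      refine (abs_min_sub_min_le_max _ _ _ _).trans ?_
      rw [sub_self, abs_zero]
      refine max_le ((abs_norm_sub_norm_le _ _).trans_eq ?_) (norm_nonneg _)
      congr 1; abel
    have a2 : 0 ≤ min ‖y - x'‖ t := le_min (norm_nonneg _) ht.le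
    have a3 : 0 ≤ min ‖y - x‖ t := le_min (norm_nonneg _) ht.le
    rw [e, abs_mul, mul_comm, abs_of_nonneg (a := (_ / _ : ℝ)) (by positivity)]
    refine mul_le_mul ?_ a1 (abs_nonneg _) (by positivity)
    rw [div_le_div_iff₀ (by positivity) ht]
    nlinarith [min_le_right ‖y - x'‖ t, min_le_right ‖y - x‖ t]
  have e : rr x t y - rr x' t y = 6 / t ^ 3 * ((pp x t y + pp x' t y) * (pp x t y - pp x' t y)) := by
    simp only [rr]; ring
  rw [e, abs_mul, abs_mul, abs_of_pos (by positivity : 0 < 6 / t ^ 3), abs_of_nonneg (add_nonneg (pp_nn _ _ _) (pp_nn _ _ _))]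
  calc _ ≤ 6 / t ^ 3 * (2 * (2 / t * ‖x - x'‖)) := by
        refine mul_le_mul_of_nonneg_left (mul_le_mul ?_ h1 (abs_nonneg _) zero_le_two) (by positivity)
        linarith [pp_le x t y, pp_le x' t y]
    _ = _ := by field_simp; ring

theorem grow_const {f : ℝ → ℝ} {T L : ℝ} (hf : ∀ t, 0 < t → t < T → HasDerivAt f 0 t)
    (hL : Filter.Tendsto f (nhdsWithin 0 (Ioi 0)) (nhds L)) {t : ℝ} (ht : 0 < t) (htT : t < T) : f t = L := by
  have a := grow (A := 0) hf (fun t _ _ => by simp) hL ht htT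
  have b := grow (A := 0) (f := fun t => -f t) (f' := fun _ => -0) (fun t h1 h2 => (hf t h1 h2).neg) (fun t _ _ => by simp) hL.neg ht htT
  simp only [zero_div, zero_mul, add_zero] at a b
  linarith

theorem T2.sub {φ ψ : E3 → ℝ} {D D2 E E2} (h : T2 φ D D2) (k : T2 ψ E E2) :
    T2 (fun x => φ x - ψ x) (fun x => D x - E x) (fun x => D2 x - E2 x) :=
  ⟨fun x => (h.d1 x).sub (k.d1 x), fun x => (h.d2 x).sub (k.d2 x), by
    have a := h.c
    have b := k.c
    rw [continuous_clm_apply] at a b ⊢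
    intro y
    have a := a y
    have b := b y
    rw [continuous_clm_apply] at a b ⊢
    exact fun z => (a z).sub (b z)⟩

variable {ι : Type} {Ω : Set E3}

structure Har (Ω B : Set E3) (u : E3 → ℝ) : Prop where
  oB : IsOpen B
  z : ∀ x, x ∉ Ω → u x = 0
  i1 : Integrable u
  i2 : Integrable fun x => u x ^ 2
  hh : ∀ φ D D2, T2 φ D D2 → (∀ x ∈ frontier Ω, φ x = 0) → tsupport φ ⊆ B → ∫ x, u x * trc (D2 x) = 0

theorem int_lb {u : E3 → ℝ} (hu : Integrable u) (x : E3) {t : ℝ} (ht : 0 < t) : Integrable fun y => u y * lb x t y :=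
  hu.mul_bdd (c := 42 / t ^ 2) (cont_lb x t).aestronglyMeasurable (Filter.Eventually.of_forall fun y => lb_bd x ht y)

theorem int_rr' {u : E3 → ℝ} (hu : Integrable u) (x : E3) {t : ℝ} (ht : 0 < t) : Integrable fun y => u y * rr x t y :=
  hu.mul_bdd (c := 6 / t ^ 3) (cont_rr x t).aestronglyMeasurable
    (Filter.Eventually.of_forall fun y => by rw [Real.norm_eq_abs, abs_of_nonneg (rr_nn x ht y)]; exact rr_le x ht y)

theorem har_base [Fintype ι] (P : HPoly ι Ω) {B : Set E3} {u : E3 → ℝ} (H : Har Ω B u) {η : E3 → ℝ} {D D2} (hη : T2 η D D2)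
    (hc : HasCompactSupport η) (h0 : ∀ x, 0 ≤ η x) (hB : tsupport η ⊆ B) {c : ℝ} (hc0 : 0 < c)
    (hl : ∀ x ∈ tsupport η, ∀ i, c ≤ P.l i x) : 0 ≤ ∫ x, |u x| * trc (D2 x) := by
  obtain ⟨δ, hδ, hδB⟩ := IsCompact.exists_cthickening_subset_open (s := tsupport η) hc H.oB hB
  refine sub_base H.i1.abs (fun _ => abs_nonneg _) hη hc h0 (T := min c δ) (by positivity) ?_
  filter_upwards [ae_LP H.i1] with x hx hxs t ht htT
  have e : ∫ y, u y * rr x t y = c00 * u x := by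
    refine grow_const (f := fun t => ∫ y, u y * rr x t y) (T := min c δ) (fun s hs hsT => ?_) (mv_lim H.i1 hx) ht htT
    obtain ⟨E, E2, hE, tE⟩ := bb_T2 x hs
    refine (mv_der H.i1 x hs).congr_deriv ?_
    have := H.hh _ _ _ hE (fun y hy => bb_zero hs ?_) ?_
    · simp only [tE] at this
      rw [this, zero_div]
    · obtain ⟨_, i, hi⟩ := P.mem_fr.1 hy
      have h1 := hl x hxs i
      have h2 := P.l_lip i x y
      rw [hi, sub_zero] at h2
      rw [dist_comm, dist_eq_norm]
      linarith [le_abs_self (P.l i x), min_le_left c δ]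
    · refine (bb_ts hs).trans (Subset.trans ?_ hδB)
      exact (closedBall_subset_closedBall (hsT.le.trans (min_le_right _ _))).trans (closedBall_subset_cthickening hxs δ)
  have h1 : |∫ y, u y * rr x t y| ≤ ∫ y, |u y| * rr x t y := by
    refine (abs_integral_le_integral_abs).trans_eq (integral_congr_ae (Filter.Eventually.of_forall fun y => ?_))
    simp only [abs_mul, abs_of_nonneg (rr_nn x ht y)]
  rwa [e, abs_mul, abs_of_pos c00_pos] at h1

theorem face_bd [Fintype ι] (P : HPoly ι Ω) {B : Set E3} {u : E3 → ℝ} (H : Har Ω B u) {K : Set E3} (hK : IsCompact K) (hB : K ⊆ B) {c : ℝ}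
    (hc0 : 0 < c) {i : ι} (hl : ∀ x ∈ K, ∀ j, j ≠ i → c ≤ P.l i x + P.l j x) :
    ∃ C ≥ 0, ∃ e > 0, ∀ᵐ x, x ∈ K → x ∈ Ω → P.l i x < e → |u x| ≤ C * P.l i x := by
  obtain ⟨δ, hδ, hδB⟩ := hK.exists_cthickening_subset_open H.oB hB
  obtain ⟨e, he, hec, hed⟩ : ∃ e : ℝ, 0 < e ∧ 4 * e ≤ c ∧ 3 * e ≤ δ := ⟨min (c / 4) (δ / 3), by positivity, by
    have := min_le_left (c / 4) (δ / 3)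
    linarith, by
    have := min_le_right (c / 4) (δ / 3)
    linarith⟩
  have hc00 := c00_pos
  have hI : 0 ≤ ∫ y, |u y| := integral_nonneg fun _ => abs_nonneg _
  refine ⟨24 / (e / 2) ^ 4 * 2 / c00 * ∫ y, |u y|, by positivity, e, he, ?_⟩
  filter_upwards [ae_LP H.i1] with x hx hxK hxΩ hxe
  have hx0 : 0 < P.l i x := P.mem.1 hxΩ i
  set x' : E3 := x - (2 * P.l i x) • P.n i with hx'
  have hn : ⟪P.n i, P.n i⟫ = 1 := by rw [real_inner_self_eq_norm_sq, P.unit i]; norm_num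
  have hxx : ‖x - x'‖ = 2 * P.l i x := by
    rw [hx', sub_sub_cancel, norm_smul, P.unit i, mul_one, Real.norm_eq_abs, abs_of_pos (by positivity)]
  have hlx' : P.l i x' = -P.l i x := by
    rw [hx', sub_eq_add_neg, P.l_add, inner_neg_right, inner_smul_right, hn]; ring
  have l1 : Filter.Tendsto (fun t => ∫ y, u y * rr x' t y) (nhdsWithin 0 (Ioi 0)) (nhds 0) := by
    refine (tendsto_const_nhds (x := (0:ℝ))).congr' ?_
    filter_upwards [Ioo_mem_nhdsGT hx0] with t ht
    rw [eq_comm]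
    refine integral_eq_zero_of_ae (Filter.Eventually.of_forall fun y => ?_)
    by_cases hy : y ∈ Ω
    · have h1 := P.mem.1 hy i
      have h2 := P.l_lip i y x'
      rw [hlx'] at h2
      simp [rr_zero (x := x') (y := y) ht.1 (by rw [dist_eq_norm]; linarith [le_abs_self (P.l i y - -P.l i x), ht.2])]
    · simp [H.z y hy]
  have key : (∫ y, u y * rr x (e / 2) y) - (∫ y, u y * rr x' (e / 2) y) = c00 * u x - 0 := by
    refine grow_const (f := fun t => (∫ y, u y * rr x t y) - ∫ y, u y * rr x' t y) (T := e) (fun s hs hsT => ?_)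
      ((mv_lim H.i1 hx).sub l1) (by positivity) (by linarith)
    obtain ⟨E, E2, hE, tE⟩ := bb_T2 x hs
    obtain ⟨F, F2, hF, tF⟩ := bb_T2 x' hs
    refine ((mv_der H.i1 x hs).sub (mv_der H.i1 x' hs)).congr_deriv ?_
    have tt : ∀ y, trc (E2 y - F2 y) = lb x s y - lb x' s y := fun y => by
      rw [← tE, ← tF]; simp only [trc, sub_apply, Finset.sum_sub_distrib]
    have := H.hh _ _ _ (hE.sub hF) (fun y hy => ?_) ?_
    · simp only [tt, mul_sub] at this
      rw [integral_sub (int_lb H.i1 x hs) (int_lb H.i1 x' hs)] at this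
      rw [← sub_div, this, zero_div]
    · obtain ⟨_, j, hj⟩ := P.mem_fr.1 hy
      by_cases hji : j = i
      · subst hji
        have : ‖y - x‖ ^ 2 = ‖y - x'‖ ^ 2 := by
          have e1 : y - x' = (y - x) + (2 * P.l j x) • P.n j := by rw [hx']; abel
          have e2 : ⟪y - x, P.n j⟫ = -P.l j x := by
            have := P.l_add j x (y - x)
            rw [add_sub_cancel, hj] at this
            rw [real_inner_comm]; linarith
          rw [e1, norm_add_sq_real, inner_smul_right, e2, norm_smul, P.unit j, Real.norm_eq_abs, mul_one, sq_abs]; ring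
        simp only [bb, pp, this, sub_self]
      · have h1 := hl x hxK j hji
        have h2 := P.l_lip j x y
        have h3 := P.l_lip j x' y
        have h4 := P.l_lip j x x'
        rw [hj, sub_zero] at h2 h3
        rw [hxx] at h4
        rw [bb_zero hs, bb_zero hs, sub_self]
        · rw [dist_comm, dist_eq_norm]
          linarith [le_abs_self (P.l j x'), le_abs_self (P.l j x - P.l j x')]
        · rw [dist_comm, dist_eq_norm]
          linarith [le_abs_self (P.l j x)]
    · refine Subset.trans ?_ hδB
      refine Subset.trans ?_ (closedBall_subset_cthickening hxK δ)
      refine closure_minimal (fun y hy => ?_) isClosed_closedBall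
      by_contra hyb
      rw [mem_closedBall, not_le] at hyb
      refine hy ?_
      have h5 : dist y x ≤ dist y x' + dist x x' := dist_triangle_right _ _ _
      rw [dist_eq_norm x x', hxx] at h5
      beta_reduce
      rw [bb_zero hs (by linarith), bb_zero hs (by linarith), sub_self]
  have h6 : |c00 * u x - 0| ≤ ∫ y, |u y| * (24 / (e / 2) ^ 4 * (2 * P.l i x)) := by
    rw [← key, ← integral_sub (int_rr' H.i1 x (by positivity)) (int_rr' H.i1 x' (by positivity))]
    refine abs_integral_le_integral_abs.trans (integral_mono_of_nonneg (Filter.Eventually.of_forall fun y => abs_nonneg _)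
      (H.i1.abs.mul_const _) (Filter.Eventually.of_forall fun y => ?_))
    beta_reduce
    rw [← mul_sub, abs_mul, ← hxx]
    exact mul_le_mul_of_nonneg_left (rr_lip x x' y (by positivity)) (abs_nonneg _)
  rw [integral_mul_const, sub_zero, abs_mul, abs_of_pos hc00] at h6
  calc |u x| ≤ ((∫ y, |u y|) * (24 / (e / 2) ^ 4 * (2 * P.l i x))) / c00 := by rw [le_div_iff₀ hc00]; linarith
    _ = _ := by ring
end

section
variable {ι : Type} {Ω : Set E3}

theorem har_faces [Fintype ι] [DecidableEq ι] (P : HPoly ι Ω) {B : Set E3} {u : E3 → ℝ} (H : Har Ω B u) (F : Finset ι) : ∀ {η : E3 → ℝ} {D D2},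
    T2 η D D2 → HasCompactSupport η → (∀ x, 0 ≤ η x) → tsupport η ⊆ B → ∀ c > 0, (∀ x ∈ tsupport η, ∀ i j, j ≠ i → c ≤ P.l i x + P.l j x) →
    (∀ x ∈ tsupport η, ∀ i, i ∉ F → c ≤ P.l i x) → 0 ≤ ∫ x, |u x| * trc (D2 x) := by
  induction F using Finset.induction_on with
  | empty => exact fun hη hc h0 hB c hc0 _ hl => har_base P H hη hc h0 hB hc0 fun x hx i => hl x hx i (by simp)
  | insert i F hi ih =>
    intro η D D2 hη hc h0 hB c hc0 hp hl
    refine removal H.i1.abs (fun _ => abs_nonneg _) (P.n i) (P.c i) (fun x hx => P.mem.1 (by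
      by_contra h
      exact hx (by rw [H.z x h, abs_zero])) i) hη hc h0 ?_ ?_
    · intro γ hγ
      obtain ⟨C, hC, e, he, hbd⟩ := face_bd P H (K := tsupport η) hc hB hc0 (i := i) fun x hx j hj => hp x hx i j hj
      obtain ⟨L, hL, hlay⟩ := P.layer
      refine ⟨min e (γ / (C * L + 1)), by positivity, fun ε hε hε0 => ?_⟩
      have hm : MeasurableSet {x : E3 | P.l i x < ε} := measurableSet_lt (P.l_cont i).measurable measurable_const
      have hv := hlay i ε hε
      have hvr : volume.real (Ω ∩ {x | P.l i x < ε}) ≤ L * ε := ENNReal.toReal_le_of_le_ofReal (by positivity) hv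
      calc ∫ x in tsupport η ∩ {x | ⟪P.n i, x⟫ - P.c i < ε}, |u x| = ∫ x in tsupport η ∩ {x | P.l i x < ε}, |u x| := rfl
        _ = ∫ x, (tsupport η ∩ {x | P.l i x < ε}).indicator (fun x => |u x|) x :=
            (integral_indicator ((isClosed_tsupport η).measurableSet.inter hm)).symm
        _ ≤ ∫ x, (Ω ∩ {x | P.l i x < ε}).indicator (fun _ => C * ε) x := by
            refine integral_mono_ae (H.i1.abs.indicator ((isClosed_tsupport η).measurableSet.inter hm)) ?_ ?_
            · rw [integrable_indicator_iff (P.op.measurableSet.inter hm)]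
              exact integrableOn_const (hv.trans_lt ENNReal.ofReal_lt_top).ne
            · filter_upwards [hbd] with x hx
              by_cases hxK : x ∈ tsupport η ∩ {x | P.l i x < ε}
              · rw [indicator_of_mem hxK]
                by_cases hxΩ : x ∈ Ω
                · have hm2 : x ∈ Ω ∩ {x | P.l i x < ε} := ⟨hxΩ, hxK.2⟩
                  rw [indicator_of_mem hm2]
                  have h1 : P.l i x < ε := hxK.2
                  exact (hx hxK.1 hxΩ (h1.trans (hε0.trans_le (min_le_left _ _)))).trans (mul_le_mul_of_nonneg_left h1.le hC)
                · rw [H.z x hxΩ, abs_zero]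
                  exact indicator_nonneg (fun _ _ => by positivity) _
              · rw [indicator_of_notMem hxK]
                exact indicator_nonneg (fun _ _ => by positivity) _
        _ = volume.real (Ω ∩ {x | P.l i x < ε}) * (C * ε) := by
            rw [integral_indicator (P.op.measurableSet.inter hm), setIntegral_const, smul_eq_mul]
        _ ≤ L * ε * (C * ε) := mul_le_mul_of_nonneg_right hvr (by positivity)
        _ ≤ γ * ε := by
            have h1 : ε ≤ γ / (C * L + 1) := hε0.le.trans (min_le_right _ _)
            rw [le_div_iff₀ (by positivity)] at h1
            nlinarith
    · intro ε hε φ E E2 hφ hφ0 hφs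
      refine ih hφ (hc.of_isClosed_subset (isClosed_tsupport _) (hφs.trans inter_subset_left)) hφ0
        ((hφs.trans inter_subset_left).trans hB) (min c ε) (by positivity) (fun x hx i j hij => (min_le_left _ _).trans (hp x (hφs hx).1 i j hij)) ?_
      intro x hx j hj
      by_cases hji : j = i
      · subst hji
        exact (min_le_right _ _).trans (hφs hx).2
      · exact (min_le_left _ _).trans (hl x (hφs hx).1 j (by simp [hji, hj]))

theorem har_pairs [Fintype ι] [DecidableEq ι] (P : HPoly ι Ω) {B : Set E3} {u : E3 → ℝ} (H : Har Ω B u) (F : Finset (ι × ι)) : ∀ {η : E3 → ℝ} {D D2},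
    T2 η D D2 → HasCompactSupport η → (∀ x, 0 ≤ η x) → tsupport η ⊆ B → ∀ c > 0,
    (∀ x ∈ tsupport η, ∀ i j, j ≠ i → (i, j) ∉ F → c ≤ P.l i x + P.l j x) → 0 ≤ ∫ x, |u x| * trc (D2 x) := by
  induction F using Finset.induction_on with
  | empty => exact fun hη hc h0 hB c hc0 hl => har_faces P H Finset.univ hη hc h0 hB c hc0 (fun x hx i j hij => hl x hx i j hij (by simp)) (by simp)
  | insert q F hi ih =>
    obtain ⟨i, j⟩ := q
    intro η D D2 hη hc h0 hB c hc0 hl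
    by_cases hji : j = i
    · refine ih hη hc h0 hB c hc0 fun x hx i' j' h h' => hl x hx i' j' h ?_
      simp only [Finset.mem_insert, Prod.mk.injEq, h', or_false]
      rintro ⟨rfl, rfl⟩
      exact h hji
    rcases P.indep_or i j (Ne.symm hji) with hind | ⟨δ, hδ, hsum⟩
    swap
    · refine ih hη hc h0 hB (min c δ) (by positivity) fun x hx i' j' h h' => ?_
      by_cases he : i' = i ∧ j' = j
      · obtain ⟨rfl, rfl⟩ := he
        rw [hsum]; exact min_le_right _ _
      · exact (min_le_left _ _).trans (hl x hx i' j' h (by simp [h', he]))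
    have hs : ∀ x, ⟪P.n i + P.n j, x⟫ - (P.c i + P.c j) = P.l i x + P.l j x := fun x => by
      simp only [HPoly.l, inner_add_left]; ring
    refine removal H.i1.abs (fun _ => abs_nonneg _) (P.n i + P.n j) (P.c i + P.c j) (fun x hx => ?_) hη hc h0 ?_ ?_
    · have : x ∈ Ω := by
        by_contra h
        exact hx (by rw [H.z x h, abs_zero])
      rw [hs]; linarith [P.mem.1 this i, P.mem.1 this j]
    · intro γ hγ
      obtain ⟨R, hR⟩ := P.bdd.subset_closedBall 0
      obtain ⟨C, hC, hv⟩ := vol_pair R (P.unit i) (P.unit j) hind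
      set S : ℝ → Set E3 := fun ε => Ω ∩ {x | P.l i x + P.l j x < ε} with hS
      have hm : ∀ ε, MeasurableSet {x : E3 | P.l i x + P.l j x < ε} := fun ε =>
        measurableSet_lt ((P.l_cont i).add (P.l_cont j)).measurable measurable_const
      have hSm : ∀ ε, MeasurableSet (S ε) := fun ε => P.op.measurableSet.inter (hm ε)
      have hSv : ∀ ε, 0 < ε → volume (S ε) ≤ ENNReal.ofReal (C * ε ^ 2) := fun ε hε => by
        refine (measure_mono ?_).trans (hv (P.c i) (P.c j) ε hε)
        exact fun x hx => ⟨hR hx.1, (P.eq x).1 hx.1 i, (P.eq x).1 hx.1 j, hx.2⟩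
      have t0 : Filter.Tendsto (fun ε => volume (S ε)) (nhdsWithin 0 (Ioi 0)) (nhds 0) := by
        refine tendsto_of_tendsto_of_tendsto_of_le_of_le' tendsto_const_nhds (h := fun ε => ENNReal.ofReal (C * ε ^ 2)) ?_
          (Filter.Eventually.of_forall fun _ => zero_le) (by filter_upwards [self_mem_nhdsWithin] with ε hε using hSv ε hε)
        have : Filter.Tendsto (fun ε : ℝ => ENNReal.ofReal (C * ε ^ 2)) (nhds 0) (nhds (ENNReal.ofReal (C * 0 ^ 2))) :=
          (ENNReal.continuous_ofReal.comp (by fun_prop : Continuous fun ε : ℝ => C * ε ^ 2)).tendsto 0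
        simp only [ne_eq, OfNat.ofNat_ne_zero, not_false_eq_true, zero_pow, mul_zero, ENNReal.ofReal_zero] at this
        exact this.mono_left nhdsWithin_le_nhds
      have t1 := H.i2.tendsto_setIntegral_nhds_zero t0
      have t2 := (t1.eventually (gt_mem_nhds (show (0:ℝ) < γ ^ 2 / (C + 1) by positivity)))
      obtain ⟨e, he, hee⟩ := mem_nhdsGT_iff_exists_Ioo_subset.1 t2
      refine ⟨e, he, fun ε hε hε0 => ?_⟩
      have hw : ∫ x in S ε, u x ^ 2 < γ ^ 2 / (C + 1) := hee ⟨hε, hε0⟩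
      have hvr : volume.real (S ε) ≤ C * ε ^ 2 := ENNReal.toReal_le_of_le_ofReal (by positivity) (hSv ε hε)
      set a : ℝ := (C + 1) * ε / γ with ha
      have ha0 : 0 < a := by positivity
      have iS : IntegrableOn (fun _ : E3 => (1 / (2 * a) : ℝ)) (S ε) := integrableOn_const ((hSv ε hε).trans_lt ENNReal.ofReal_lt_top).ne
      have i2 : Integrable (fun x => a / 2 * u x ^ 2) (volume.restrict (S ε)) := (H.i2.const_mul _).integrableOn
      simp only [hs]
      calc ∫ x in tsupport η ∩ {x | P.l i x + P.l j x < ε}, |u x|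
          = ∫ x, (tsupport η ∩ {x | P.l i x + P.l j x < ε}).indicator (fun x => |u x|) x :=
            (integral_indicator ((isClosed_tsupport η).measurableSet.inter (hm ε))).symm
        _ ≤ ∫ x, (S ε).indicator (fun x => |u x|) x := by
            refine integral_mono (H.i1.abs.indicator ((isClosed_tsupport η).measurableSet.inter (hm ε))) (H.i1.abs.indicator (hSm ε)) fun x => ?_
            have nn : 0 ≤ (S ε).indicator (fun x => |u x|) x := indicator_nonneg (fun _ _ => abs_nonneg _) _
            by_cases hxK : x ∈ tsupport η ∩ {x | P.l i x + P.l j x < ε}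
            · rw [indicator_of_mem hxK]
              by_cases hxΩ : x ∈ Ω
              · have hm2 : x ∈ S ε := ⟨hxΩ, hxK.2⟩
                rw [indicator_of_mem hm2]
              · rwa [H.z x hxΩ, abs_zero]
            · rwa [indicator_of_notMem hxK]
        _ = ∫ x in S ε, |u x| := integral_indicator (hSm ε)
        _ ≤ ∫ x in S ε, (a / 2 * u x ^ 2 + 1 / (2 * a)) := by
            refine integral_mono H.i1.abs.integrableOn (i2.add iS) fun x => ?_
            beta_reduce
            have : a / 2 * u x ^ 2 + 1 / (2 * a) - |u x| = (a * |u x| - 1) ^ 2 / (2 * a) := by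
              rw [← sq_abs (u x)]; field_simp; ring
            have : 0 ≤ (a * |u x| - 1) ^ 2 / (2 * a) := by positivity
            linarith
        _ = a / 2 * (∫ x in S ε, u x ^ 2) + volume.real (S ε) * (1 / (2 * a)) := by
            rw [integral_add i2 iS, integral_const_mul, setIntegral_const, smul_eq_mul]
        _ ≤ a / 2 * (γ ^ 2 / (C + 1)) + ((C + 1) * ε ^ 2) * (1 / (2 * a)) := by
            refine add_le_add (mul_le_mul_of_nonneg_left hw.le (by positivity)) (mul_le_mul_of_nonneg_right ?_ (by positivity))
            nlinarith [sq_nonneg ε]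
        _ = γ * ε := by rw [ha]; field_simp; ring
    · intro ε hε φ E E2 hφ hφ0 hφs
      refine ih hφ (hc.of_isClosed_subset (isClosed_tsupport _) (hφs.trans inter_subset_left)) hφ0
        ((hφs.trans inter_subset_left).trans hB) (min c ε) (by positivity) ?_
      intro x hx i' j' h h'
      by_cases he : i' = i ∧ j' = j
      · obtain ⟨rfl, rfl⟩ := he
        have := (hφs hx).2
        rw [Set.mem_ofPred_eq, hs] at this
        exact (min_le_right _ _).trans this
      · exact (min_le_left _ _).trans (hl x (hφs hx).1 i' j' h (by simp [h', he]))

theorem har_sub [Fintype ι] (P : HPoly ι Ω) {B : Set E3} {u : E3 → ℝ} (H : Har Ω B u) {η : E3 → ℝ} {D D2}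
    (hη : T2 η D D2) (hc : HasCompactSupport η) (h0 : ∀ x, 0 ≤ η x) (hB : tsupport η ⊆ B) : 0 ≤ ∫ x, |u x| * trc (D2 x) := by
  classical
  exact har_pairs P H Finset.univ hη hc h0 hB 1 one_pos (by simp)
end

section
variable {ι : Type} {Ω : Set E3}

theorem har_sup [Fintype ι] (P : HPoly ι Ω) {x0 : E3} {r : ℝ} (hr : 0 < r) {u : E3 → ℝ} (H : Har Ω (ball x0 (2 * r)) u) :
    ∀ᵐ y, y ∈ closedBall x0 r → r ^ 3 * u y ^ 2 ≤ 48 / c00 * ∫ z in closedBall x0 (2 * r), u z ^ 2 := by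
  have hc := c00_pos
  filter_upwards [ae_LP H.i1.abs] with y hy hyr
  have ht : 0 < r / 2 := by positivity
  have i2r := int_rr' H.i2 y ht
  have h1 : c00 * |u y| ≤ ∫ z, |u z| * rr y (r / 2) z := by
    have := grow (A := 0) (T := r) (f := fun t => -∫ z, |u z| * rr y t z) (fun t h1 h2 => (mv_der H.i1.abs y h1).neg) (fun t h1 h2 => ?_)
      (mv_lim H.i1.abs hy).neg ht (by linarith)
    · simp only [zero_div, zero_mul, add_zero] at this
      linarith
    · obtain ⟨E, E2, hE, tE⟩ := bb_T2 y h1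
      have := har_sub P H hE (bb_cs h1) (bb_nn y t) ((bb_ts h1).trans (closedBall_subset_ball' (by rw [mem_closedBall] at hyr; linarith)))
      simp only [tE] at this
      rw [zero_mul]
      exact neg_nonpos.2 (by positivity)
  have h2 : ∫ z, u z ^ 2 * rr y (r / 2) z ≤ 48 / r ^ 3 * ∫ z in closedBall x0 (2 * r), u z ^ 2 := by
    rw [← integral_const_mul, ← integral_indicator measurableSet_closedBall]
    refine integral_mono i2r ((H.i2.const_mul _).indicator measurableSet_closedBall) fun z => ?_
    beta_reduce
    by_cases hz : z ∈ closedBall x0 (2 * r)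
    · rw [indicator_of_mem hz, mul_comm]
      refine mul_le_mul_of_nonneg_right ((rr_le y ht z).trans_eq ?_) (sq_nonneg _)
      field_simp; norm_num
    · rw [indicator_of_notMem hz, rr_zero ht, mul_zero]
      rw [mem_closedBall, not_le] at hz
      rw [mem_closedBall] at hyr
      have := dist_triangle z y x0
      linarith
  have h3 : c00 * u y ^ 2 ≤ ∫ z, u z ^ 2 * rr y (r / 2) z := by
    by_cases hu : u y = 0
    · rw [hu]
      simp only [ne_eq, OfNat.ofNat_ne_zero, not_false_eq_true, zero_pow, mul_zero]
      exact integral_nonneg fun z => mul_nonneg (sq_nonneg _) (rr_nn y ht z)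
    have hu0 : 0 < |u y| := abs_pos.2 hu
    have ir : Integrable (rr y (r / 2)) := (cont_rr _ _).integrable_of_hasCompactSupport (rr_cs ht)
    have h4 : 2 * |u y| * ∫ z, |u z| * rr y (r / 2) z ≤ (∫ z, u z ^ 2 * rr y (r / 2) z) + u y ^ 2 * c00 := by
      rw [← int_rr y ht, ← integral_const_mul, ← integral_const_mul, ← integral_add i2r (ir.const_mul _)]
      refine integral_mono ((int_rr' H.i1.abs y ht).const_mul _) (i2r.add (ir.const_mul _)) fun z => ?_
      beta_reduce
      have := mul_nonneg (sq_nonneg (|u z| - |u y|)) (rr_nn y ht z)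
      rw [← sq_abs (u z), ← sq_abs (u y)]
      linarith
    have h5 := mul_le_mul_of_nonneg_left h1 (by positivity : 0 ≤ 2 * |u y|)
    have : 2 * |u y| * (c00 * |u y|) = 2 * (c00 * u y ^ 2) := by rw [← sq_abs (u y)]; ring
    linarith
  have h6 := h3.trans h2
  calc r ^ 3 * u y ^ 2 = r ^ 3 / c00 * (c00 * u y ^ 2) := by field_simp
    _ ≤ r ^ 3 / c00 * (48 / r ^ 3 * ∫ z in closedBall x0 (2 * r), u z ^ 2) := by gcongr
    _ = _ := by field_simp
end

section
variable {ι : Type} {Ω : Set E3}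

theorem riesz_abs {V H : Type*} [AddCommMonoid V] [Module ℝ V] [NormedAddCommGroup H] [InnerProductSpace ℝ H] [CompleteSpace H]
    (A B : V →ₗ[ℝ] H) (h : ∀ v, ‖B v‖ ≤ ‖A v‖) (g : H) : ∃ u : H, ‖u‖ ≤ ‖g‖ ∧ ∀ v, inner ℝ u (A v) = inner ℝ g (B v) := by
  letI : AddCommGroup V := Module.addCommMonoidToAddCommGroup ℝ
  obtain ⟨s, hs⟩ := A.rangeRestrict.exists_rightInverse_of_surjective (LinearMap.range_rangeRestrict A)
  have hs' : ∀ y : LinearMap.range A, A (s y) = y := fun y => congrArg Subtype.val (LinearMap.congr_fun hs y)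
  have hb : ∀ v, ‖inner ℝ g (B v)‖ ≤ ‖g‖ * ‖A v‖ := fun v =>
    (norm_inner_le_norm g (B v)).trans (mul_le_mul_of_nonneg_left (h v) (norm_nonneg g))
  let F0 : LinearMap.range A →ₗ[ℝ] ℝ := (innerSL ℝ g).toLinearMap ∘ₗ B ∘ₗ s
  have hF0 : ∀ y, F0 y = inner ℝ g (B (s y)) := fun _ => rfl
  let F : LinearMap.range A →L[ℝ] ℝ := F0.mkContinuous ‖g‖ fun y => by
    rw [hF0]
    refine (hb (s y)).trans_eq ?_
    rw [hs']; rfl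
  obtain ⟨L, hL, hLn⟩ := exists_extension_norm_eq _ F
  refine ⟨(InnerProductSpace.toDual ℝ H).symm L, ?_, fun v => ?_⟩
  · rw [LinearIsometryEquiv.norm_map, hLn]
    exact LinearMap.mkContinuous_norm_le _ (norm_nonneg _) _
  · rw [InnerProductSpace.toDual_symm_apply]
    have h1 := hL ⟨A v, LinearMap.mem_range_self A v⟩
    have h2 : F ⟨A v, LinearMap.mem_range_self A v⟩ = inner ℝ g (B (s ⟨A v, LinearMap.mem_range_self A v⟩)) := rfl
    have h3 := hb (s ⟨A v, LinearMap.mem_range_self A v⟩ - v)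
    rw [map_sub, map_sub, hs', sub_self, norm_zero, mul_zero, inner_sub_right] at h3
    have h4 := sub_eq_zero.1 (norm_le_zero_iff.1 h3)
    rw [← h4, ← h2]
    exact h1

theorem toLp_inner {μ : Measure E3} {f g : E3 → ℝ} (hf : MemLp f 2 μ) (hg : MemLp g 2 μ) :
    inner ℝ (hf.toLp f) (hg.toLp g) = ∫ x, f x * g x ∂μ := by
  rw [L2.inner_def]
  refine integral_congr_ae ?_
  filter_upwards [hf.coeFn_toLp, hg.coeFn_toLp] with x h1 h2
  rw [h1, h2]
  simp [mul_comm]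

theorem trc_add (M N : BL) : trc (M + N) = trc M + trc N := by simp only [trc, add_apply, Finset.sum_add_distrib]
theorem trc_smul (c : ℝ) (M : BL) : trc (c • M) = c * trc M := by simp only [trc, smul_apply, smul_eq_mul, Finset.mul_sum]

def VV [Fintype ι] (P : HPoly ι Ω) : Submodule ℝ (E3 → BL) where
  carrier := {M | ∃ D, CF Ω D M ∧ ∀ i, Tan P D i}
  add_mem' := by
    rintro M N ⟨D, h, hT⟩ ⟨E, k, kT⟩
    have : ContinuousAdd BL := ContinuousLinearMap.topologicalAddGroup.toContinuousAdd
    refine ⟨fun x => D x + E x, ⟨h.c1.add k.c1, h.c2.add k.c2, fun x hx => (h.der x hx).add (k.der x hx), fun x hx a b => ?_⟩,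
      fun i y hy hyi t ht => ?_⟩
    · simp only [Pi.add_apply, add_apply, h.symm x hx a b, k.symm x hx a b]
    · rw [add_apply, hT i y hy hyi t ht, kT i y hy hyi t ht, add_zero]
  zero_mem' := ⟨fun _ => 0, ⟨continuousOn_const, continuousOn_const, fun x _ => hasFDerivWithinAt_const _ _ _, fun _ _ _ _ => rfl⟩,
    fun _ _ _ _ _ _ => rfl⟩
  smul_mem' := by
    rintro c M ⟨D, h, hT⟩
    refine ⟨fun x => c • D x, ⟨h.c1.const_smul c, h.c2.const_smul c, fun x hx => (h.der x hx).const_smul c, fun x hx a b => ?_⟩,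
      fun i y hy hyi t ht => ?_⟩
    · simp only [Pi.smul_apply, smul_apply, h.symm x hx a b]
    · rw [smul_apply, hT i y hy hyi t ht, smul_zero]

theorem HPoly.memLp (P : HPoly ι Ω) {f : E3 → ℝ} (hf : ContinuousOn f (closure Ω)) : MemLp f 2 (volume.restrict Ω) := by
  have h1 := P.cont_int hf
  rw [memLp_two_iff_integrable_sq h1.1]
  exact P.cont_int (hf.pow 2)

theorem mkL {V : Type*} [AddCommMonoid V] [Module ℝ V] {μ : Measure E3} (a : V → E3 → ℝ) (ha : ∀ M N, a (M + N) = a M + a N)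
    (hs : ∀ (c : ℝ) M, a (c • M) = c • a M) (hm : ∀ M, MemLp (a M) 2 μ) :
    ∃ A : V →ₗ[ℝ] Lp ℝ 2 μ, ∀ M, A M = (hm M).toLp _ := ⟨
    { toFun := fun M => (hm M).toLp _
      map_add' := fun M N => by
        rw [← MemLp.toLp_add]
        congr 1; exact ha _ _
      map_smul' := fun c M => by
        rw [RingHom.id_apply, ← MemLp.toLp_const_smul]
        congr 1; exact hs _ _ }, fun _ => rfl⟩

theorem riesz2 {V : Type*} [AddCommMonoid V] [Module ℝ V] {μ : Measure E3} (a b : V → E3 → ℝ) (ha : ∀ M N, a (M + N) = a M + a N)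
    (hs : ∀ (c : ℝ) M, a (c • M) = c • a M) (hm : ∀ M, MemLp (a M) 2 μ) (ha' : ∀ M N, b (M + N) = b M + b N)
    (hs' : ∀ (c : ℝ) M, b (c • M) = c • b M) (hm' : ∀ M, MemLp (b M) 2 μ) (hab : ∀ M, ∫ x, b M x ^ 2 ∂μ ≤ ∫ x, a M x ^ 2 ∂μ)
    {g : E3 → ℝ} (hg : MemLp g 2 μ) : ∃ u : E3 → ℝ, Measurable u ∧ MemLp u 2 μ ∧ ∫ x, u x ^ 2 ∂μ ≤ ∫ x, g x ^ 2 ∂μ ∧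
      ∀ M, ∫ x, u x * a M x ∂μ = ∫ x, g x * b M x ∂μ := by
  obtain ⟨A, hA⟩ := mkL a ha hs hm
  obtain ⟨B, hB⟩ := mkL b ha' hs' hm'
  have hn : ∀ {f : E3 → ℝ} (hf : MemLp f 2 μ), ‖hf.toLp f‖ ^ 2 = ∫ x, f x ^ 2 ∂μ := fun hf => by
    rw [← real_inner_self_eq_norm_sq, toLp_inner hf hf]
    simp only [sq]
  have hAB : ∀ v, ‖B v‖ ≤ ‖A v‖ := fun M => by
    refine le_of_sq_le_sq ?_ (norm_nonneg _)
    rw [hA, hB, hn, hn]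
    exact hab M
  obtain ⟨u, hu, hid⟩ := riesz_abs A B hAB (hg.toLp g)
  have huL := Lp.memLp u
  have hue : u = huL.toLp u := (Lp.toLp_coeFn u huL).symm
  refine ⟨u, (Lp.stronglyMeasurable u).measurable, huL, ?_, fun M => ?_⟩
  · rw [← hn huL, ← hn hg, ← hue]
    exact pow_le_pow_left₀ (norm_nonneg _) hu 2
  · rw [← toLp_inner huL (hm M), ← toLp_inner hg (hm' M), ← hue, ← hA, ← hB]
    exact hid M

theorem VV_mem [Fintype ι] {P : HPoly ι Ω} {M : E3 → BL} (h : M ∈ VV P) : ∃ D, CF Ω D M ∧ ∀ i, Tan P D i := h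

theorem le_hs2 (M : BL) (i j : Fin 3) : M (ee i) (ee j) ^ 2 ≤ hs2 M :=
  (Finset.single_le_sum (f := fun j => M (ee i) (ee j) ^ 2) (fun _ _ => sq_nonneg _) (Finset.mem_univ j)).trans
      (Finset.single_le_sum (f := fun i => ∑ j, M (ee i) (ee j) ^ 2) (fun _ _ => Finset.sum_nonneg fun _ _ => sq_nonneg _) (Finset.mem_univ i))

theorem CF.cij {D : E3 → E3 →L[ℝ] ℝ} {D2 : E3 → BL} (h : CF Ω D D2) (i j : Fin 3) :
    ContinuousOn (fun x => D2 x (ee i) (ee j)) (closure Ω) := (h.c2.clm_apply continuousOn_const).clm_apply continuousOn_const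

theorem riesz3 [Fintype ι] (P : HPoly ι Ω) (i j : Fin 3) {g : E3 → ℝ} (hg : MemLp g 2 (volume.restrict Ω)) :
    ∃ u : E3 → ℝ, Measurable u ∧ MemLp u 2 (volume.restrict Ω) ∧ ∫ x in Ω, u x ^ 2 ≤ ∫ x in Ω, g x ^ 2 ∧
      ∀ M : VV P, ∫ x in Ω, u x * trc (M.1 x) = ∫ x in Ω, g x * M.1 x (ee i) (ee j) := by
  refine riesz2 (V := VV P) (fun M x => trc (M.1 x)) (fun M x => M.1 x (ee i) (ee j)) ?_ ?_ ?_ ?_ ?_ ?_ ?_ hg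
  · exact fun M N => funext fun x => trc_add _ _
  · exact fun c M => funext fun x => trc_smul _ _
  · exact fun M => by obtain ⟨D, h, _⟩ := VV_mem M.2; exact P.memLp h.ctr
  · exact fun M N => rfl
  · exact fun c M => rfl
  · exact fun M => by obtain ⟨D, h, _⟩ := VV_mem M.2; exact P.memLp (h.cij i j)
  · intro M
    obtain ⟨D, h, hT⟩ := VV_mem M.2
    have := l2_id P h hT
    beta_reduce
    rw [← this]
    exact integral_mono (P.cont_int ((h.cij i j).pow 2)) (P.cont_int h.chs) fun x => le_hs2 _ i j

theorem riesz [Fintype ι] (P : HPoly ι Ω) (i j : Fin 3) {g : E3 → ℝ} (hz : ∀ x, x ∉ Ω → g x = 0) (hm : Measurable g)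
    (h2 : Integrable fun x => g x ^ 2) : ∃ u : E3 → ℝ, Measurable u ∧ (∀ x, x ∉ Ω → u x = 0) ∧ (Integrable fun x => u x ^ 2) ∧
      ∫ x, u x ^ 2 ≤ ∫ x, g x ^ 2 ∧ ∀ D D2, CF Ω D D2 → (∀ i, Tan P D i) → ∫ x, u x * trc (D2 x) = ∫ x, g x * D2 x (ee i) (ee j) := by
  have hg : MemLp g 2 (volume.restrict Ω) := (memLp_two_iff_integrable_sq hm.aestronglyMeasurable).2 h2.restrict
  obtain ⟨u, hum, huL, hu, hid⟩ := riesz3 P i j hg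
  have hΩ := P.op.measurableSet
  have hsq : (fun x => Ω.indicator u x ^ 2) = Ω.indicator fun x => u x ^ 2 := by
    ext x
    by_cases hx : x ∈ Ω <;> simp [hx]
  refine ⟨Ω.indicator u, hum.indicator hΩ, fun x hx => indicator_of_notMem hx _, ?_, ?_, ?_⟩
  · rw [hsq, integrable_indicator_iff hΩ]
    exact huL.integrable_sq
  · rw [hsq, integral_indicator hΩ, ← setIntegral_eq_integral_of_forall_compl_eq_zero (s := Ω) (f := fun x => g x ^ 2) (fun x hx => by rw [hz x hx]; norm_num)]
    exact hu
  · intro D D2 h hT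
    have hM : D2 ∈ VV P := ⟨D, h, hT⟩
    have := hid ⟨D2, hM⟩
    rw [← setIntegral_eq_integral_of_forall_compl_eq_zero (s := Ω) (f := fun x => g x * D2 x (ee i) (ee j)) (fun x hx => by rw [hz x hx, zero_mul]), ← this,
      ← setIntegral_eq_integral_of_forall_compl_eq_zero (s := Ω) (f := fun x => Ω.indicator u x * trc (D2 x)) (fun x hx => by rw [indicator_of_notMem hx, zero_mul])]
    exact setIntegral_congr_fun hΩ fun x hx => by simp [hx]
end

section
variable {ι : Type} {Ω : Set E3}

theorem T2.toCF {φ : E3 → ℝ} {D D2} (h : T2 φ D D2) : CF Ω D D2 :=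
  ⟨h.cd.continuousOn, h.c.continuousOn, fun x _ => (h.d2 x).hasFDerivWithinAt,
    fun x _ a b => second_derivative_symmetric h.d1 (h.d2 x) a b⟩

theorem tan_fr [Fintype ι] (P : HPoly ι Ω) {φ : E3 → ℝ} {D : E3 → E3 →L[ℝ] ℝ} (hd : ∀ x ∈ closure Ω, HasFDerivWithinAt φ (D x) (closure Ω) x)
    (hφ : ∀ x ∈ frontier Ω, φ x = 0) (i : ι) : Tan P D i := fun y hy hyi t ht =>
  face_der P (hd y hy) (fun z hz hzi => hφ z (P.mem_fr.2 ⟨P.mem_cl.1 hz, i, hzi⟩)) hy hyi ht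

theorem T2.z {φ : E3 → ℝ} {D D2} (h : T2 φ D D2) {y : E3} (hy : y ∉ tsupport φ) : D2 y = 0 := by
  have h1 := (tsupport_fderiv_subset ℝ (f := D)).trans ((h.eD ▸ tsupport_fderiv_subset ℝ (f := φ)) : tsupport D ⊆ tsupport φ)
  rw [h.eD2] at h1
  by_contra h0
  exact hy (h1 (subset_closure h0))

theorem HPoly.int_mul (P : HPoly ι Ω) {u f : E3 → ℝ} (hm : Measurable u) (hz : ∀ x, x ∉ Ω → u x = 0) (h2 : Integrable fun x => u x ^ 2)
    (hf : ContinuousOn f (closure Ω)) : Integrable fun x => u x * f x := by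
  have h1 : MemLp u 2 (volume.restrict Ω) := (memLp_two_iff_integrable_sq hm.aestronglyMeasurable).2 h2.restrict
  have h3 : IntegrableOn (fun x => u x * f x) Ω := h1.integrable_mul (P.memLp hf)
  rwa [integrableOn_iff_integrable_of_support_subset] at h3
  intro x hx
  by_contra hn
  exact hx (by simp [hz x hn])

theorem loc_dual [Fintype ι] (P : HPoly ι Ω) {i j : Fin 3} {g u : E3 → ℝ} (gz : ∀ x, x ∉ Ω → g x = 0) (gm : Measurable g)
    (g2 : Integrable fun x => g x ^ 2) (um : Measurable u) (uz : ∀ x, x ∉ Ω → u x = 0) (u2 : Integrable fun x => u x ^ 2)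
    (hid : ∀ D D2, CF Ω D D2 → (∀ i, Tan P D i) → ∫ x, u x * trc (D2 x) = ∫ x, g x * D2 x (ee i) (ee j))
    (x : E3) {r τ : ℝ} (hr : 0 < r) (hτ : 0 < τ)
    (hs : 8 * (48 / c00) * ∫ y in closedBall x (2 * r), (u y ^ 2 + g y ^ 2) ≤ τ ^ 2 * r ^ 3) :
    ∃ v : E3 → ℝ, Measurable v ∧ (Integrable fun x => v x ^ 2) ∧ (∫ y, v y ^ 2 ≤ ∫ y in closedBall x (2 * r), g y ^ 2) ∧
      ∀ᵐ y, y ∈ closedBall x r → τ < |u y| → u y ^ 2 ≤ 4 * v y ^ 2 := by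
  set B := closedBall x (2 * r)
  have hB : MeasurableSet B := isClosed_closedBall.measurableSet
  have hc := c00_pos
  have hsq : (fun x => B.indicator g x ^ 2) = B.indicator fun x => g x ^ 2 := by
    ext x
    by_cases hx : x ∈ B <;> simp [hx]
  obtain ⟨v, vm, vz, v2, hv, vid⟩ := riesz P i j (g := B.indicator g) (fun y hy => by
    by_cases hyB : y ∈ B <;> simp [hyB, gz y hy]) (gm.indicator hB) (by rw [hsq]; exact g2.indicator hB)
  rw [hsq, integral_indicator hB] at hv
  have wz : ∀ y, y ∉ Ω → u y - v y = 0 := fun y hy => by rw [uz y hy, vz y hy, sub_self]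
  have w2 : Integrable fun y => (u y - v y) ^ 2 := by
    refine ((u2.const_mul 2).add (v2.const_mul 2)).mono' ((um.sub vm).pow_const 2).aestronglyMeasurable (Filter.Eventually.of_forall fun y => ?_)
    rw [Real.norm_eq_abs, abs_of_nonneg (sq_nonneg _)]
    simp only [Pi.add_apply]
    nlinarith [sq_nonneg (u y + v y)]
  have H : Har Ω (ball x (2 * r)) fun y => u y - v y := by
    refine ⟨isOpen_ball, wz, ?_, w2, fun φ D D2 h hφ hsup => ?_⟩
    · have := P.int_mul (um.sub vm) wz w2 (f := fun _ => 1) continuousOn_const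
      simpa using this
    · have hC : CF Ω D D2 := h.toCF
      have hT := tan_fr P (fun x _ => (h.d1 x).hasFDerivWithinAt) hφ
      have e1 := hid D D2 hC hT
      have e2 := vid D D2 hC hT
      have i1 := P.int_mul um uz u2 hC.ctr
      have i2 := P.int_mul vm vz v2 hC.ctr
      simp only [sub_mul]
      rw [integral_sub i1 i2, e1, e2, sub_eq_zero]
      congr 1; ext y
      by_cases hy : y ∈ B
      · rw [indicator_of_mem hy]
      · rw [h.z fun h' => hy (ball_subset_closedBall (hsup h'))]
        simp
  refine ⟨v, vm, v2, hv, ?_⟩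
  filter_upwards [har_sup P hr H] with y hy hyr hyt
  have h1 := hy hyr
  have h2 : ∫ z in B, (u z - v z) ^ 2 ≤ 2 * ∫ z in B, (u z ^ 2 + g z ^ 2) := by
    rw [integral_add u2.integrableOn g2.integrableOn]
    have h3 : ∫ z in B, (u z - v z) ^ 2 ≤ ∫ z in B, (2 * u z ^ 2 + 2 * v z ^ 2) :=
      integral_mono w2.integrableOn ((u2.const_mul 2).add (v2.const_mul 2)).integrableOn fun z => by
        beta_reduce
        nlinarith [sq_nonneg (u z + v z)]
    rw [integral_add (u2.const_mul 2).integrableOn (v2.const_mul 2).integrableOn, integral_const_mul, integral_const_mul] at h3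
    have h4 : ∫ z in B, v z ^ 2 ≤ ∫ z, v z ^ 2 := setIntegral_le_integral v2 (Filter.Eventually.of_forall fun _ => sq_nonneg _)
    linarith
  have h5 : 4 * (r ^ 3 * (u y - v y) ^ 2) ≤ τ ^ 2 * r ^ 3 := by
    have := mul_le_mul_of_nonneg_left h2 (show 0 ≤ 48 / c00 by positivity)
    linarith
  have h6 : (2 * |u y - v y|) ^ 2 ≤ τ ^ 2 := by
    rw [mul_pow, sq_abs]
    have h7 : 0 < r ^ 3 := by positivity
    nlinarith
  have h7 := abs_le_of_sq_le_sq' h6 hτ.le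
  have h8 : |u y| ≤ 2 * |v y| := by
    have := abs_sub_abs_le_abs_sub (u y) (v y)
    linarith [h7.2]
  rw [← sq_abs (u y), ← sq_abs (v y)]
  nlinarith [abs_nonneg (u y)]

theorem dualq [Fintype ι] (P : HPoly ι Ω) {q : ℝ} (hq : 2 < q) : ∃ C : ℝ, 0 ≤ C ∧ ∀ (i j : Fin 3) (g : E3 → ℝ), (∀ x, x ∉ Ω → g x = 0) →
    Measurable g → (Integrable fun x => g x ^ 2) → ∃ u : E3 → ℝ, Measurable u ∧ (∀ x, x ∉ Ω → u x = 0) ∧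
      (∫⁻ x, ENNReal.ofReal (|u x| ^ q) ≤ ENNReal.ofReal C * ∫⁻ x, ENNReal.ofReal (|g x| ^ q)) ∧
      ∀ D D2, CF Ω D D2 → (∀ i, Tan P D i) → ∫ x, u x * trc (D2 x) = ∫ x, g x * D2 x (ee i) (ee j) := by
  have hc := c00_pos
  have hK : 0 < 48 / c00 := by positivity
  obtain ⟨C, hC, hg⟩ := good2 (C0 := 8 * (48 / c00) + 4) (by linarith) hq
  refine ⟨C, hC, fun i j g gz gm g2 => ?_⟩
  obtain ⟨u, um, uz, u2, -, hid⟩ := riesz P i j gz gm g2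
  refine ⟨u, um, uz, hg (fun x => |u x|) (fun x => |g x|) um.abs gm.abs (fun _ => abs_nonneg _) (fun _ => abs_nonneg _) ?_ ?_ ?_, hid⟩
  · simp only [sq_abs]
    exact u2.lintegral_lt_top.ne
  · simp only [sq_abs]
    exact g2.lintegral_lt_top.ne
  intro x r τ hr hτ hs
  simp only [sq_abs] at hs ⊢
  set B := closedBall x (2 * r)
  have i0 : ∀ {f : E3 → ℝ}, (Integrable fun x => f x ^ 2) → ∀ S : Set E3, ∫⁻ y in S, ENNReal.ofReal (f y ^ 2) = ENNReal.ofReal (∫ y in S, f y ^ 2) :=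
    fun hf S => (ofReal_integral_eq_lintegral_ofReal hf.restrict (Filter.Eventually.of_forall fun _ => sq_nonneg _)).symm
  have n0 : ∀ {f : E3 → ℝ} (S : Set E3), 0 ≤ ∫ y in S, f y ^ 2 := fun S => integral_nonneg fun _ => sq_nonneg _
  rw [lintegral_add_left (um.pow_const 2).ennreal_ofReal, i0 u2, i0 g2, ← ENNReal.ofReal_add (n0 _) (n0 _),
    ← ENNReal.ofReal_mul (by positivity), ENNReal.ofReal_le_ofReal_iff (by positivity)] at hs
  obtain ⟨v, vm, v2, hv, hae⟩ := loc_dual P gz gm g2 um uz u2 hid x hr hτ (by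
    rw [integral_add u2.integrableOn g2.integrableOn]
    refine le_trans ?_ hs
    have := add_nonneg (n0 (f := u) B) (n0 (f := g) B)
    nlinarith)
  have hS : MeasurableSet ({y | τ < |u y|} ∩ closedBall x r) := (measurableSet_lt measurable_const um.abs).inter isClosed_closedBall.measurableSet
  calc ∫⁻ y in {y | τ < |u y|} ∩ closedBall x r, ENNReal.ofReal (u y ^ 2)
      ≤ ∫⁻ y in {y | τ < |u y|} ∩ closedBall x r, ENNReal.ofReal (4 * v y ^ 2) := by
        refine setLIntegral_mono_ae ((vm.pow_const 2).const_mul 4).ennreal_ofReal.aemeasurable ?_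
        filter_upwards [hae] with y hy h'
        exact ENNReal.ofReal_le_ofReal (hy h'.2 h'.1)
    _ ≤ ∫⁻ y, ENNReal.ofReal (4 * v y ^ 2) := setLIntegral_le_lintegral _ _
    _ = ENNReal.ofReal (4 * ∫ y, v y ^ 2) := by
        rw [← integral_const_mul, ofReal_integral_eq_lintegral_ofReal (v2.const_mul 4) (Filter.Eventually.of_forall fun _ => by positivity)]
    _ ≤ ENNReal.ofReal ((8 * (48 / c00) + 4) * ∫ y in B, g y ^ 2) := by
        refine ENNReal.ofReal_le_ofReal ?_
        have := n0 (f := g) B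
        nlinarith
    _ = _ := by rw [i0 g2, ENNReal.ofReal_mul (by positivity)]
end

section
variable {ι : Type} {Ω : Set E3}

theorem p_lt2 [Fintype ι] (P : HPoly ι Ω) {p : ℝ} (hp : 1 < p) (hp2 : p < 2) : ∃ C : ℝ, 0 ≤ C ∧ ∀ (i j : Fin 3)
    (D : E3 → E3 →L[ℝ] ℝ) (D2 : E3 → BL), CF Ω D D2 → (∀ i, Tan P D i) →
      ∫ x in Ω, |D2 x (ee i) (ee j)| ^ p ≤ C * ∫ x in Ω, |trc (D2 x)| ^ p := by
  have hp1 : 0 < p - 1 := by linarith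
  set q := p / (p - 1) with hq
  have hqp : (p - 1) * q = p := by rw [hq]; field_simp
  have hq2 : 2 < q := by rw [hq, lt_div_iff₀ hp1]; linarith
  have hpq : q.HolderConjugate p := (Real.HolderConjugate.conjExponent hp).symm
  obtain ⟨C, hC, hd⟩ := dualq P hq2
  have hΩ := P.op.measurableSet
  refine ⟨C ^ (p - 1), by positivity, fun i j D D2 h hT => ?_⟩
  set f : E3 → ℝ := fun x => D2 x (ee i) (ee j) with hf
  have cf : ContinuousOn f (closure Ω) := h.cij i j
  have mf : Measurable (Ω.indicator f) := meas_ind hΩ (cf.mono subset_closure)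
  set g : E3 → ℝ := fun x => Ω.indicator f x * |Ω.indicator f x| ^ (p - 2) with hg
  have gz : ∀ x, x ∉ Ω → g x = 0 := fun x hx => by simp [hg, hx]
  have ga : ∀ x, |g x| = |Ω.indicator f x| ^ (p - 1) := fun x => by
    rw [hg]
    beta_reduce
    by_cases h0 : Ω.indicator f x = 0
    · rw [h0, zero_mul, abs_zero, Real.zero_rpow hp1.ne']
    · rw [abs_mul, abs_of_nonneg (a := |_| ^ _) (by positivity), show p - 1 = 1 + (p - 2) by ring,
        Real.rpow_add (abs_pos.2 h0), Real.rpow_one]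
  have gm : Measurable g := mf.mul (mf.abs.pow_const _)
  have g2 : Integrable fun x => g x ^ 2 := by
    have e : (fun x => g x ^ 2) = Ω.indicator fun x => (|f x| ^ (p - 1)) ^ 2 := by
      ext x
      rw [← sq_abs, ga]
      by_cases hx : x ∈ Ω <;> simp [hx, hp1.ne']
    rw [e, integrable_indicator_iff hΩ]
    exact P.cont_int ((cf.abs.rpow_const fun x _ => Or.inr hp1.le).pow 2)
  obtain ⟨u, um, uz, hu, hid⟩ := hd i j g gz gm g2
  have e1 := hid D D2 h hT
  set X := ∫ x in Ω, |f x| ^ p with hX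
  set Y := ∫ x in Ω, |trc (D2 x)| ^ p with hY
  have hX0 : 0 ≤ X := integral_nonneg fun _ => by positivity
  have hY0 : 0 ≤ Y := integral_nonneg fun _ => by positivity
  have iX : ENNReal.ofReal X = ∫⁻ x in Ω, ENNReal.ofReal (|f x| ^ p) :=
    ofReal_integral_eq_lintegral_ofReal (P.cont_int (cf.abs.rpow_const fun x _ => Or.inr (by linarith))) (Filter.Eventually.of_forall fun _ => by positivity)
  have iY : ENNReal.ofReal Y = ∫⁻ x in Ω, ENNReal.ofReal (|trc (D2 x)| ^ p) :=
    ofReal_integral_eq_lintegral_ofReal (P.cont_int (h.ctr.abs.rpow_const fun x _ => Or.inr (by linarith))) (Filter.Eventually.of_forall fun _ => by positivity)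
  have e2 : ∫ x, g x * D2 x (ee i) (ee j) = X := by
    rw [← setIntegral_eq_integral_of_forall_compl_eq_zero (s := Ω) (f := fun x => g x * D2 x (ee i) (ee j)) (fun x hx => by rw [gz x hx, zero_mul])]
    refine setIntegral_congr_fun hΩ fun x hx => ?_
    change g x * f x = |f x| ^ p
    rw [hg]
    beta_reduce
    rw [indicator_of_mem hx]
    by_cases h0 : f x = 0
    · simp [h0, (by linarith : p ≠ 0)]
    · rw [mul_right_comm, ← sq, ← sq_abs, ← Real.rpow_natCast, ← Real.rpow_add (abs_pos.2 h0)]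
      congr 1
      push_cast; ring
  have e3 : ∫⁻ x, ENNReal.ofReal (|g x| ^ q) = ENNReal.ofReal X := by
    rw [iX, ← ind_all hΩ f (fun s => |s| ^ p) (by simp [(by linarith : p ≠ 0)])]
    congr 1; ext x
    rw [ga, ← Real.rpow_mul (abs_nonneg _), hqp]
  rw [e3, ← ENNReal.ofReal_mul hC] at hu
  have hu' : ∫⁻ x in Ω, ENNReal.ofReal |u x| ^ q ≤ ENNReal.ofReal (C * X) := by
    refine (setLIntegral_le_lintegral _ _).trans (le_trans (le_of_eq ?_) hu)
    congr 1; ext x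
    rw [ENNReal.ofReal_rpow_of_nonneg (abs_nonneg _) (by linarith)]
  have hY' : ∫⁻ x in Ω, ENNReal.ofReal |trc (D2 x)| ^ p = ENNReal.ofReal Y := by
    rw [iY]
    congr 1; ext x
    rw [ENNReal.ofReal_rpow_of_nonneg (abs_nonneg _) (by linarith)]
  have k1 : ENNReal.ofReal X ≤ ∫⁻ x in Ω, ENNReal.ofReal |u x| * ENNReal.ofReal |trc (D2 x)| := by
    rw [← e2, ← e1, ← setIntegral_eq_integral_of_forall_compl_eq_zero (s := Ω) (f := fun x => u x * trc (D2 x)) (fun x hx => by rw [uz x hx, zero_mul])]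
    refine (ENNReal.ofReal_le_ofReal (le_abs_self _)).trans ?_
    rw [← Real.norm_eq_abs]
    refine (ofReal_norm _).trans_le ((enorm_integral_le_lintegral_enorm _).trans_eq ?_)
    congr 1; ext x
    rw [← ENNReal.ofReal_mul (abs_nonneg _), ← abs_mul, ← Real.norm_eq_abs, ofReal_norm]
  have k2 := ENNReal.lintegral_mul_le_Lp_mul_Lq (volume.restrict Ω) hpq (f := fun x => ENNReal.ofReal |u x|) (g := fun x => ENNReal.ofReal |trc (D2 x)|)
    um.abs.ennreal_ofReal.aemeasurable ((ContinuousOn.aemeasurable (h.ctr.abs.mono subset_closure) hΩ).ennreal_ofReal)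
  have hq0 : 0 ≤ 1 / q := by positivity
  have hp0 : 0 ≤ 1 / p := by positivity
  have k3 : ENNReal.ofReal X ≤ ENNReal.ofReal ((C * X) ^ (1 / q) * Y ^ (1 / p)) := by
    refine k1.trans (k2.trans ?_)
    rw [ENNReal.ofReal_mul (by positivity), ← ENNReal.ofReal_rpow_of_nonneg (by positivity) hq0, ← ENNReal.ofReal_rpow_of_nonneg hY0 hp0, hY']
    exact mul_le_mul_left (ENNReal.rpow_le_rpow hu' hq0) _
  rw [ENNReal.ofReal_le_ofReal_iff (by positivity)] at k3
  rcases hX0.eq_or_lt with h0 | h0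
  · rw [← h0]
    positivity
  have k4 := Real.rpow_le_rpow hX0 k3 (by linarith : (0:ℝ) ≤ p)
  have e5 : 1 / q * p = p - 1 := by rw [hq]; field_simp
  rw [Real.mul_rpow (by positivity) (by positivity), ← Real.rpow_mul (by positivity), ← Real.rpow_mul hY0, e5,
    one_div_mul_cancel (by linarith), Real.rpow_one, Real.mul_rpow hC hX0] at k4
  have e6 : X ^ p = X ^ (p - 1) * X := by rw [← Real.rpow_add_one h0.ne']; simp
  rw [e6] at k4
  have h3 : 0 < X ^ (p - 1) := by positivity
  refine le_of_mul_le_mul_left (k4.trans_eq ?_) h3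
  ring
end

section
variable {ι : Type} {Ω : Set E3}

theorem HPoly.ray (P : HPoly ι Ω) {x e : E3} (hx : x ∈ Ω) (he : ‖e‖ = 1) :
    ∃ b : ℝ, 0 < b ∧ x + b • e ∈ frontier Ω ∧ ∀ t, 0 ≤ t → t < b → x + t • e ∈ Ω := by
  obtain ⟨R, hR⟩ := Metric.isBounded_iff.1 P.bdd
  set S : Set ℝ := {t | x + t • e ∈ Ω} with hS
  have hc : Continuous fun t : ℝ => x + t • e := by fun_prop
  have oS : IsOpen S := P.op.preimage hc
  have S0 : (0:ℝ) ∈ S := by simpa [hS] using hx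
  have bS : BddAbove S := ⟨R, fun t ht => by
    have := hR ht hx
    rw [dist_eq_norm, add_sub_cancel_left, norm_smul, he, mul_one] at this
    exact (le_abs_self t).trans this⟩
  have hb : sSup S ∈ closure S := csSup_mem_closure ⟨0, S0⟩ bS
  have hgt : ∀ t ∈ S, t < sSup S := fun t ht => by
    obtain ⟨ε, hε, hb⟩ := Metric.isOpen_iff.1 oS t ht
    have : t + ε / 2 ∈ S := hb (by rw [mem_ball, Real.dist_eq, add_sub_cancel_left, abs_of_pos] <;> linarith)
    linarith [le_csSup bS this]
  refine ⟨sSup S, hgt 0 S0, ?_, fun t h0 ht => ?_⟩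
  · rw [P.op.frontier_eq]
    refine ⟨?_, fun h => lt_irrefl _ (hgt _ h)⟩
    exact map_mem_closure (f := fun t : ℝ => x + t • e) hc hb fun t ht => ht
  · obtain ⟨s, hs, hts⟩ := exists_lt_of_lt_csSup ⟨0, S0⟩ ht
    have hs0 : 0 < s := h0.trans_lt hts
    have := P.cvx hx hs (a := 1 - t / s) (b := t / s) (by rw [sub_nonneg, div_le_one hs0]; exact hts.le) (by positivity) (by ring)
    have e1 : (1 - t / s) • x + (t / s) • (x + s • e) = x + t • e := by
      rw [smul_add, smul_smul, div_mul_cancel₀ _ hs0.ne', ← add_assoc, ← add_smul]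
      simp
    rwa [e1] at this

theorem line1 {f f' : ℝ → ℝ} {s t : ℝ} (hst : s ≤ t) (hf : ContinuousOn f (Icc s t)) (hd : ∀ y ∈ Ioo s t, HasDerivAt f (f' y) y)
    (hf' : ContinuousOn f' (Icc s t)) : ENNReal.ofReal |f t - f s| ≤ ∫⁻ y in Ioo s t, ENNReal.ofReal |f' y| := by
  have h := intervalIntegral.integral_eq_sub_of_hasDerivAt_of_le hst hf hd (hf'.intervalIntegrable_of_Icc hst)
  rw [← h, intervalIntegral.integral_of_le hst, integral_Ioc_eq_integral_Ioo, ← Real.norm_eq_abs, ofReal_norm]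
  refine (enorm_integral_le_lintegral_enorm _).trans_eq ?_
  simp only [← Real.norm_eq_abs, ofReal_norm]

theorem line2 {f f' : ℝ → ℝ} {a b c d : ℝ} (hf : ContinuousOn f (Icc a b)) (hd : ∀ y ∈ Ioo a b, HasDerivAt f (f' y) y)
    (hf' : ContinuousOn f' (Icc a b)) (hc : c ∈ Icc a b) (hd' : d ∈ Icc a b) : ENNReal.ofReal |f c - f d| ≤ ∫⁻ y in Ioo a b, ENNReal.ofReal |f' y| := by
  wlog h : d ≤ c generalizing c d
  · rw [abs_sub_comm]
    exact this hd' hc (by linarith)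
  have s1 : Icc d c ⊆ Icc a b := Icc_subset_Icc hd'.1 hc.2
  have s2 : Ioo d c ⊆ Ioo a b := Ioo_subset_Ioo hd'.1 hc.2
  exact (line1 h (hf.mono s1) (fun y hy => hd y (s2 hy)) (hf'.mono s1)).trans (lintegral_mono_set s2)

theorem line_bd (P : HPoly ι Ω) : ∃ R : ℝ, 0 < R ∧ ∀ (e : E3), ‖e‖ = 1 → ∀ (v : E3 → ℝ) (D : E3 → E3 →L[ℝ] ℝ) (D2 : E3 → BL), CF Ω D D2 →
    (∀ x ∈ closure Ω, HasFDerivWithinAt v (D x) (closure Ω) x) → (∀ x ∈ frontier Ω, v x = 0) → ∀ x ∈ Ω,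
    ENNReal.ofReal |v x| ≤ ∫⁻ t in Icc (-R) R, ENNReal.ofReal (Ω.indicator (fun y => |D y e|) (x + t • e)) ∧
    ENNReal.ofReal |D x e| ≤ ∫⁻ t in Icc (-R) R, ENNReal.ofReal (Ω.indicator (fun y => |D2 y e e|) (x + t • e)) := by
  obtain ⟨R, hR⟩ := Metric.isBounded_iff.1 P.bdd
  refine ⟨max R 1, by positivity, fun e he v D D2 h hv h0 x hx => ?_⟩
  obtain ⟨b, hb, hbf, hbi⟩ := P.ray hx he
  obtain ⟨a, ha, haf, hai⟩ := P.ray hx (e := -e) (by rwa [norm_neg])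
  have hI : ∀ t ∈ Ioo (-a) b, x + t • e ∈ Ω := fun t ht => by
    rcases le_total 0 t with h' | h'
    · exact hbi t h' ht.2
    · have := hai (-t) (by linarith) (by linarith [ht.1])
      rwa [smul_neg, neg_smul, neg_neg] at this
  have hcl : ∀ t ∈ Icc (-a) b, x + t • e ∈ closure Ω := fun t ht => by
    rcases ht.1.eq_or_lt with h1 | h1
    · rw [← h1]
      simpa using frontier_subset_closure haf
    rcases ht.2.eq_or_lt with h2 | h2
    · rw [h2]; exact frontier_subset_closure hbf
    · exact subset_closure (hI t ⟨h1, h2⟩)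
  have hc : Continuous fun t : ℝ => x + t • e := by fun_prop
  have hcd : ∀ t : ℝ, HasDerivAt (fun t : ℝ => x + t • e) e t := fun t => by
    simpa using ((hasDerivAt_id t).smul_const e).const_add x
  have cv : ContinuousOn v (closure Ω) := fun x hx => (hv x hx).continuousWithinAt
  have c0 : ContinuousOn (fun t : ℝ => v (x + t • e)) (Icc (-a) b) := cv.comp hc.continuousOn hcl
  have c1 : ContinuousOn (fun t : ℝ => D (x + t • e) e) (Icc (-a) b) := (h.c1.comp hc.continuousOn hcl).clm_apply continuousOn_const
  have c2 : ContinuousOn (fun t : ℝ => D2 (x + t • e) e e) (Icc (-a) b) :=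
    ((h.c2.comp hc.continuousOn hcl).clm_apply continuousOn_const).clm_apply continuousOn_const
  have d0 : ∀ t ∈ Ioo (-a) b, HasDerivAt (fun t : ℝ => v (x + t • e)) (D (x + t • e) e) t := fun t ht =>
    ((hv _ (subset_closure (hI t ht))).hasFDerivAt (Filter.mem_of_superset (P.op.mem_nhds (hI t ht)) subset_closure)).comp_hasDerivAt t (hcd t)
  have d1 : ∀ t ∈ Ioo (-a) b, HasDerivAt (fun t : ℝ => D (x + t • e) e) (D2 (x + t • e) e e) t := fun t ht => by
    have := ((h.at P.op (hI t ht)).comp_hasDerivAt t (hcd t) : HasDerivAt (fun t : ℝ => D (x + t • e)) (D2 (x + t • e) e) t).clm_apply (hasDerivAt_const t e)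
    exact this.congr_deriv (by simp)
  have hmono : ∀ F : E3 → ℝ, ∫⁻ t in Ioo (-a) b, ENNReal.ofReal |F (x + t • e)| ≤
      ∫⁻ t in Icc (-max R 1) (max R 1), ENNReal.ofReal (Ω.indicator (fun y => |F y|) (x + t • e)) := fun F => by
    rw [← lintegral_indicator measurableSet_Ioo, ← lintegral_indicator measurableSet_Icc]
    refine lintegral_mono fun t => ?_
    by_cases ht : t ∈ Ioo (-a) b
    · have h1 := hR (hI t ht) hx
      rw [dist_eq_norm, add_sub_cancel_left, norm_smul, he, mul_one] at h1
      have h2 : t ∈ Icc (-max R 1) (max R 1) := abs_le.1 (h1.trans (le_max_left _ _))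
      rw [indicator_of_mem ht, indicator_of_mem h2, indicator_of_mem (hI t ht)]
    · rw [indicator_of_notMem ht]
      exact zero_le
  have m0 : (0:ℝ) ∈ Icc (-a) b := ⟨by linarith, hb.le⟩
  have mb : b ∈ Icc (-a) b := ⟨by linarith, le_rfl⟩
  have vb := h0 _ hbf
  have va : v (x + (-a) • e) = 0 := by simpa using h0 _ haf
  constructor
  · have := line2 c0 d0 c1 m0 mb
    rw [vb, zero_smul, add_zero, sub_zero] at this
    exact this.trans (hmono fun y => D y e)
  · obtain ⟨c, hc, hc0⟩ := exists_hasDerivAt_eq_zero (by linarith) c0 (by rw [vb, va]) d0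
    have := line2 c1 d1 c2 m0 (Ioo_subset_Icc_self hc)
    rw [hc0, zero_smul, add_zero, sub_zero] at this
    exact this.trans (hmono fun y => D2 y e e)

theorem avg {R p : ℝ} (hR : 0 < R) (hp : 1 < p) (hΩ : MeasurableSet Ω) (e : E3) {f h : E3 → ℝ} (hm : Measurable h) (h0 : ∀ x, 0 ≤ h x)
    (hf : ∀ x ∈ Ω, ENNReal.ofReal |f x| ≤ ∫⁻ t in Icc (-R) R, ENNReal.ofReal (h (x + t • e))) :
    ∫⁻ x in Ω, ENNReal.ofReal (|f x| ^ p) ≤ ENNReal.ofReal ((2 * R) ^ p) * ∫⁻ x, ENNReal.ofReal (h x ^ p) := by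
  have hp0 : 0 ≤ p := by linarith
  have m1 : Measurable fun z : E3 × ℝ => ENNReal.ofReal (h (z.1 + z.2 • e)) := (hm.comp (by fun_prop)).ennreal_ofReal
  have hv : (volume : Measure ℝ) (Icc (-R) R) = ENNReal.ofReal (2 * R) := by rw [Real.volume_Icc]; congr 1; ring
  calc ∫⁻ x in Ω, ENNReal.ofReal (|f x| ^ p) ≤ ∫⁻ x in Ω, ENNReal.ofReal (2 * R) ^ (p - 1) * ∫⁻ t in Icc (-R) R, ENNReal.ofReal (h (x + t • e)) ^ p := by
        refine setLIntegral_mono' hΩ fun x hx => ?_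
        rw [← ENNReal.ofReal_rpow_of_nonneg (abs_nonneg _) hp0]
        refine (ENNReal.rpow_le_rpow (hf x hx) hp0).trans ?_
        have := jens ((volume : Measure ℝ).restrict (Icc (-R) R)) hp (f := fun t => ENNReal.ofReal (h (x + t • e)))
          (m1.comp (by fun_prop : Measurable fun t : ℝ => (x, t))).aemeasurable
        rwa [Measure.restrict_apply_univ, hv] at this
    _ ≤ ∫⁻ x, ENNReal.ofReal (2 * R) ^ (p - 1) * ∫⁻ t in Icc (-R) R, ENNReal.ofReal (h (x + t • e)) ^ p := setLIntegral_le_lintegral _ _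
    _ = ENNReal.ofReal (2 * R) ^ (p - 1) * ∫⁻ t in Icc (-R) R, ∫⁻ x, ENNReal.ofReal (h (x + t • e)) ^ p := by
        rw [lintegral_const_mul' _ _ (by finiteness), lintegral_lintegral_swap (m1.pow_const p).aemeasurable]
    _ = ENNReal.ofReal (2 * R) ^ (p - 1) * (ENNReal.ofReal (2 * R) * ∫⁻ x, ENNReal.ofReal (h x ^ p)) := by
        have : ∀ t : ℝ, ∫⁻ x, ENNReal.ofReal (h (x + t • e)) ^ p = ∫⁻ x, ENNReal.ofReal (h x ^ p) := fun t => by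
          rw [lintegral_add_right_eq_self (μ := volume) (fun x => ENNReal.ofReal (h x) ^ p) (t • e)]
          congr 1; ext x
          rw [ENNReal.ofReal_rpow_of_nonneg (h0 x) hp0]
        simp only [this, lintegral_const, Measure.restrict_apply_univ, hv]
        rw [mul_comm (∫⁻ x, _)]
    _ = _ := by
        rw [← mul_assoc, ENNReal.ofReal_rpow_of_nonneg (by positivity) (by linarith), ← ENNReal.ofReal_mul (by positivity), ← Real.rpow_add_one (by positivity)]
        simp
end

section
variable {ι : Type} {Ω : Set E3}

theorem all_p [Fintype ι] (P : HPoly ι Ω) : ∃ p0 : ℝ, 2 < p0 ∧ ∀ p, 1 < p → p < p0 → ∃ C : ℝ, 0 ≤ C ∧ ∀ (i j : Fin 3)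
    (D : E3 → E3 →L[ℝ] ℝ) (D2 : E3 → BL), CF Ω D D2 → (∀ i, Tan P D i) →
      ∫ x in Ω, |D2 x (ee i) (ee j)| ^ p ≤ C * ∫ x in Ω, |trc (D2 x)| ^ p := by
  obtain ⟨p0, hp0, h2⟩ := p_gt2 P
  refine ⟨p0, hp0, fun p hp hpp => ?_⟩
  rcases lt_trichotomy p 2 with hlt | heq | hgt
  · exact p_lt2 P hp hlt
  · refine ⟨1, by norm_num, fun i j D D2 h hT => ?_⟩
    simp only [heq, Real.rpow_two, sq_abs, one_mul]
    rw [← l2_id P h hT]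
    exact integral_mono (P.cont_int ((h.cij i j).pow 2)) (P.cont_int h.chs) fun x => le_hs2 _ i j
  · obtain ⟨C, hC, hh⟩ := h2 p hgt hpp
    refine ⟨C, hC, fun i j D D2 h hT => ?_⟩
    have i0 : ∀ {f : E3 → ℝ}, ContinuousOn f (closure Ω) → ∫⁻ x in Ω, ENNReal.ofReal (|f x| ^ p) = ENNReal.ofReal (∫ x in Ω, |f x| ^ p) := fun hf =>
      (ofReal_integral_eq_lintegral_ofReal (P.cont_int (hf.abs.rpow_const fun x _ => Or.inr (by linarith))) (Filter.Eventually.of_forall fun _ => by positivity)).symm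
    have h3 := hh D D2 h hT
    rw [i0 h.ctr, ← ENNReal.ofReal_mul hC] at h3
    have hn : 0 ≤ ∫ x in Ω, |trc (D2 x)| ^ p := integral_nonneg fun _ => by positivity
    rw [← ENNReal.ofReal_le_ofReal_iff (by positivity), ← i0 (h.cij i j)]
    refine le_trans (lintegral_mono fun x => ENNReal.ofReal_le_ofReal (Real.rpow_le_rpow (abs_nonneg _) ?_ (by linarith))) h3
    rw [← Real.sqrt_sq_eq_abs]
    exact Real.sqrt_le_sqrt (le_hs2 _ i j)

theorem mk_CF (P : HPoly ι Ω) {v : E3 → ℝ} (hv : ContDiffOn ℝ 2 v (closure Ω)) :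
    ∃ D D2, CF Ω D D2 ∧ ∀ x ∈ closure Ω, HasFDerivWithinAt v (D x) (closure Ω) x := by
  have hs : Ω ⊆ interior (closure Ω) := P.op.subset_interior_iff.2 subset_closure
  have hu : UniqueDiffOn ℝ (closure Ω) := uniqueDiffOn_convex P.cvx.closure ⟨P.o, hs P.ho⟩
  have h1 : ContDiffOn ℝ 1 (fderivWithin ℝ v (closure Ω)) (closure Ω) := hv.fderivWithin hu (by norm_num)
  have h2 : ContDiffOn ℝ 0 (fderivWithin ℝ (fderivWithin ℝ v (closure Ω)) (closure Ω)) (closure Ω) := h1.fderivWithin hu (by norm_num)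
  refine ⟨_, _, ⟨h1.continuousOn, h2.continuousOn, fun x hx => (h1.differentiableOn (by norm_num) x hx).hasFDerivWithinAt, fun x hx a b => ?_⟩,
    fun x hx => (hv.differentiableOn (by norm_num) x hx).hasFDerivWithinAt⟩
  exact (hv x hx).isSymmSndFDerivWithinAt (by simp) hu (closure_mono hs hx) hx a b

theorem opb {F : Type*} [NormedAddCommGroup F] [NormedSpace ℝ F] (L : E3 →L[ℝ] F) : ‖L‖ ≤ ∑ k, ‖L (ee k)‖ := by
  refine L.opNorm_le_bound (Finset.sum_nonneg fun _ _ => norm_nonneg _) fun w => ?_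
  conv_lhs => rw [← e_sum w, map_sum]
  refine (norm_sum_le _ _).trans ?_
  rw [Finset.sum_mul]
  refine Finset.sum_le_sum fun k _ => ?_
  rw [map_smul, norm_smul, mul_comm]
  exact mul_le_mul_of_nonneg_left (PiLp.norm_apply_le w k) (norm_nonneg _)

theorem ptw {Ω : Set E3} (ho : IsOpen Ω) {v : E3 → ℝ} {D : E3 → E3 →L[ℝ] ℝ} {D2 : E3 → BL} (h : CF Ω D D2)
    (hv : ∀ x ∈ closure Ω, HasFDerivWithinAt v (D x) (closure Ω) x) {x : E3} (hx : x ∈ Ω) :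
    lap v x = trc (D2 x) ∧ ‖gradient v x‖ ≤ ∑ k, |D x (ee k)| ∧ ‖iteratedFDeriv ℝ 2 v x‖ ≤ ∑ i, ∑ j, |D2 x (ee i) (ee j)| := by
  have e1 : ∀ y ∈ Ω, fderiv ℝ v y = D y := fun y hy =>
    ((hv y (subset_closure hy)).hasFDerivAt (Filter.mem_of_superset (ho.mem_nhds hy) subset_closure)).fderiv
  have e2 : fderiv ℝ v =ᶠ[nhds x] D := Filter.eventually_of_mem (ho.mem_nhds hx) e1
  have h2 : HasFDerivAt (fderiv ℝ v) (D2 x) x := (h.at ho hx).congr_of_eventuallyEq e2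
  refine ⟨?_, ?_, ?_⟩
  · refine Finset.sum_congr rfl fun i _ => ?_
    have := (h2.clm_apply (hasFDerivAt_const (ee i) x)).fderiv
    rw [this]
    simp
  · rw [gradient, LinearIsometryEquiv.norm_map, e1 x hx]
    exact opb _
  · refine le_trans ?_ ((opb (D2 x)).trans (Finset.sum_le_sum fun i _ => opb (D2 x (ee i))))
    refine ContinuousMultilinearMap.opNorm_le_bound (norm_nonneg _) fun m => ?_
    rw [iteratedFDeriv_two_apply, h2.fderiv, Fin.prod_univ_two, ← mul_assoc]
    exact (D2 x).le_opNorm₂ _ _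

theorem low [Fintype ι] (P : HPoly ι Ω) {p : ℝ} (hp : 1 < p) : ∃ A : ℝ, 0 ≤ A ∧ ∀ (v : E3 → ℝ) (D : E3 → E3 →L[ℝ] ℝ) (D2 : E3 → BL), CF Ω D D2 →
    (∀ x ∈ closure Ω, HasFDerivWithinAt v (D x) (closure Ω) x) → (∀ x ∈ frontier Ω, v x = 0) → ∀ k,
    (∫ x in Ω, |v x| ^ p ≤ A * ∫ x in Ω, |D x (ee k)| ^ p) ∧ ∫ x in Ω, |D x (ee k)| ^ p ≤ A * ∫ x in Ω, |D2 x (ee k) (ee k)| ^ p := by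
  obtain ⟨R, hR, hl⟩ := line_bd P
  have hm := P.op.measurableSet
  refine ⟨(2 * R) ^ p, by positivity, fun v D D2 h hv h0 k => ?_⟩
  have hk := hl (ee k) (by simp) v D D2 h hv h0
  have key : ∀ f F : E3 → ℝ, ContinuousOn f (closure Ω) → ContinuousOn F (closure Ω) →
      (∀ x ∈ Ω, ENNReal.ofReal |f x| ≤ ∫⁻ t in Icc (-R) R, ENNReal.ofReal (Ω.indicator (fun y => |F y|) (x + t • ee k))) →
      ∫ x in Ω, |f x| ^ p ≤ (2 * R) ^ p * ∫ x in Ω, |F x| ^ p := by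
    intro f F hf hF hb
    have i0 : ∀ {f : E3 → ℝ}, ContinuousOn f (closure Ω) → ∫⁻ x in Ω, ENNReal.ofReal (|f x| ^ p) = ENNReal.ofReal (∫ x in Ω, |f x| ^ p) := fun hf =>
      (ofReal_integral_eq_lintegral_ofReal (P.cont_int (hf.abs.rpow_const fun x _ => Or.inr (by linarith))) (Filter.Eventually.of_forall fun _ => by positivity)).symm
    have := avg hR hp hm (ee k) (meas_ind hm (hF.abs.mono subset_closure)) (fun x => indicator_nonneg (fun _ _ => abs_nonneg _) x) hb
    have hn : 0 ≤ ∫ x in Ω, |F x| ^ p := integral_nonneg fun _ => by positivity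
    rwa [ind_all hm (fun y => |F y|) (fun s => s ^ p) (Real.zero_rpow (by linarith)), i0 hf, i0 hF, ← ENNReal.ofReal_mul (by positivity),
      ENNReal.ofReal_le_ofReal_iff (by positivity)] at this
  have c1 : ContinuousOn (fun x => D x (ee k)) (closure Ω) := h.c1.clm_apply continuousOn_const
  exact ⟨key _ _ (fun x hx => (hv x hx).continuousWithinAt) c1 fun x hx => (hk x hx).1, key _ _ c1 (h.cij k k) fun x hx => (hk x hx).2⟩

theorem main_ne [Fintype ι] (P : HPoly ι Ω) : ∃ p₀ : ℝ, 2 < p₀ ∧ ∀ p : ℝ, 1 < p → p < p₀ →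
      ∃ C : ℝ, ∀ v : E3 → ℝ, ContDiffOn ℝ 2 v (closure Ω) → (∀ x ∈ frontier Ω, v x = 0) →
        W2pN Ω p v ≤ C * LpN Ω p (fun x => lap v x) := by
  obtain ⟨p0, hp0, hall⟩ := all_p P
  have hm := P.op.measurableSet
  refine ⟨p0, hp0, fun p hp hpp => ?_⟩
  obtain ⟨C, hC, hC2⟩ := hall p hp hpp
  obtain ⟨A, hA, hA2⟩ := low P hp
  have hp' : 0 ≤ p := by linarith
  set B : ℝ := A * (A * C) + 3 ^ (p - 1) * (3 * (A * C)) + 3 ^ (p - 1) * (3 * (3 ^ (p - 1) * (3 * C))) with hB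
  have hB0 : 0 ≤ B := by positivity
  refine ⟨B ^ (1 / p), fun v hv h0 => ?_⟩
  obtain ⟨D, D2, h, hd⟩ := mk_CF P hv
  have hT := tan_fr P hd h0
  rw [W2pN, LpN]
  have hL : ∫ x in Ω, |lap v x| ^ p = ∫ x in Ω, |trc (D2 x)| ^ p := setIntegral_congr_fun hm fun x hx => by
    change |lap v x| ^ p = _
    rw [(ptw P.op h hd hx).1]
  rw [hL]
  set Y := ∫ x in Ω, |trc (D2 x)| ^ p with hY
  have hY0 : 0 ≤ Y := integral_nonneg fun _ => by positivity
  rw [← Real.mul_rpow hB0 hY0]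
  refine Real.rpow_le_rpow (integral_nonneg fun _ => by positivity) ?_ (by positivity)
  have int : ∀ {f : E3 → ℝ}, ContinuousOn f (closure Ω) → IntegrableOn (fun x => |f x| ^ p) Ω := fun hf =>
    P.cont_int (hf.abs.rpow_const fun x _ => Or.inr hp')
  have i0 : IntegrableOn (fun x => |v x| ^ p) Ω := int hv.continuousOn
  have i1 : ∀ k, IntegrableOn (fun x => |D x (ee k)| ^ p) Ω := fun k => int (h.c1.clm_apply continuousOn_const)
  have i2 : ∀ i j, IntegrableOn (fun x => |D2 x (ee i) (ee j)| ^ p) Ω := fun i j => int (h.cij i j)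
  have s1 : IntegrableOn (fun x => 3 ^ (p - 1) * ∑ k, |D x (ee k)| ^ p) Ω := (integrable_finsetSum _ fun k _ => i1 k).const_mul _
  have s2' : ∀ i, IntegrableOn (fun x => 3 ^ (p - 1) * ∑ j, |D2 x (ee i) (ee j)| ^ p) Ω := fun i => (integrable_finsetSum _ fun j _ => i2 i j).const_mul _
  have s2 : IntegrableOn (fun x => 3 ^ (p - 1) * ∑ i, 3 ^ (p - 1) * ∑ j, |D2 x (ee i) (ee j)| ^ p) Ω := (integrable_finsetSum _ fun i _ => s2' i).const_mul _
  have pw : ∀ f : Fin 3 → ℝ, (∀ i, 0 ≤ f i) → (∑ i, f i) ^ p ≤ 3 ^ (p - 1) * ∑ i, f i ^ p := fun f hf => by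
    simpa using Real.rpow_sum_le_const_mul_sum_rpow_of_nonneg Finset.univ hp.le fun i _ => hf i
  calc ∫ x in Ω, (|v x| ^ p + ‖gradient v x‖ ^ p + ‖iteratedFDeriv ℝ 2 v x‖ ^ p)
      ≤ ∫ x in Ω, (|v x| ^ p + 3 ^ (p - 1) * ∑ k, |D x (ee k)| ^ p + 3 ^ (p - 1) * ∑ i, 3 ^ (p - 1) * ∑ j, |D2 x (ee i) (ee j)| ^ p) := by
        refine integral_mono_of_nonneg (Filter.Eventually.of_forall fun x => by positivity) ((i0.add s1).add s2) ?_
        filter_upwards [ae_restrict_mem hm] with x hx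
        obtain ⟨-, h1, h2⟩ := ptw P.op h hd hx
        refine add_le_add (add_le_add le_rfl ?_) ?_
        · exact (Real.rpow_le_rpow (norm_nonneg _) h1 hp').trans (pw _ fun _ => abs_nonneg _)
        · refine (Real.rpow_le_rpow (norm_nonneg _) h2 hp').trans ((pw _ fun _ => Finset.sum_nonneg fun _ _ => abs_nonneg _).trans ?_)
          exact mul_le_mul_of_nonneg_left (Finset.sum_le_sum fun i _ => pw _ fun _ => abs_nonneg _) (by positivity)
    _ = (∫ x in Ω, |v x| ^ p) + 3 ^ (p - 1) * (∑ k, ∫ x in Ω, |D x (ee k)| ^ p) +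
          3 ^ (p - 1) * ∑ i, 3 ^ (p - 1) * ∑ j, (∫ x in Ω, |D2 x (ee i) (ee j)| ^ p) := by
        have s01 : IntegrableOn (fun x => |v x| ^ p + 3 ^ (p - 1) * ∑ k, |D x (ee k)| ^ p) Ω := i0.add s1
        rw [integral_add s01 s2, integral_add i0 s1, integral_const_mul, integral_const_mul, integral_finsetSum _ fun k _ => i1 k,
          integral_finsetSum _ fun i _ => s2' i]
        congr 3
        ext i
        rw [integral_const_mul, integral_finsetSum _ fun j _ => i2 i j]
    _ ≤ A * (A * (C * Y)) + 3 ^ (p - 1) * (∑ _k : Fin 3, A * (C * Y)) + 3 ^ (p - 1) * ∑ _i : Fin 3, 3 ^ (p - 1) * ∑ _j : Fin 3, C * Y := by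
        have b2 := fun i j => hC2 i j D D2 h hT
        have b1 := fun k => (hA2 v D D2 h hd h0 k).2.trans (mul_le_mul_of_nonneg_left (b2 k k) hA)
        have b0 := (hA2 v D D2 h hd h0 0).1.trans (mul_le_mul_of_nonneg_left (b1 0) hA)
        refine add_le_add (add_le_add b0 ?_) ?_
        · exact mul_le_mul_of_nonneg_left (Finset.sum_le_sum fun k _ => b1 k) (by positivity)
        · exact mul_le_mul_of_nonneg_left (Finset.sum_le_sum fun i _ => mul_le_mul_of_nonneg_left (Finset.sum_le_sum fun j _ => b2 i j) (by positivity)) (by positivity)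
    _ = B * Y := by
        simp only [Finset.sum_const, Finset.card_univ, Fintype.card_fin, nsmul_eq_mul]
        rw [hB]
        push_cast
        ring
end

/-- **`W^{2,p}` regularity on convex polyhedra, a priori form (Lemma 2.1).** -/
theorem W2p_regularity_convex_polyhedron
    (Ω : Set E3) (hΩ : IsConvexPolyhedron Ω) :
    ∃ p₀ : ℝ, 2 < p₀ ∧ ∀ p : ℝ, 1 < p → p < p₀ →
      ∃ C : ℝ, ∀ v : E3 → ℝ, ContDiffOn ℝ 2 v (closure Ω) →
        (∀ x ∈ frontier Ω, v x = 0) →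
        W2pN Ω p v ≤ C * LpN Ω p (fun x => lap v x) := by
  rcases Ω.eq_empty_or_nonempty with he | hne
  · refine ⟨3, by norm_num, fun p hp _ => ⟨0, fun v _ _ => ?_⟩⟩
    rw [W2pN, he, setIntegral_empty, Real.zero_rpow (one_div_ne_zero (by linarith)), zero_mul]
  · obtain ⟨ι, _, ⟨P⟩⟩ := exists_poly Ω hΩ hne
    exact main_ne P
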